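/- For every integer k ≥ 1 and every u ∈ (0,1), the determinant of the 2k×2k Wrońskian matrix ω̆_{2k}(u) := ( (d/du)^{i−1} ν̆¹_{k,j}(u) )_{1≤i≤2k, 1≤j≤2k} equals λ_{2k} / ( u^k · ∏_{j=1}^{k+1} ((2j−1)² − u) )^{k}, where λ_{2k} := ((2k+1)/(2(k+1))) · ((−1)^{k(k−1)/2} / 2^{(2k−1)k}) · ((2k+1)!)^{2k} / ∏_{n=1}^{2k+1} n^n. -/

import Mathlib

open scoped BigOperators
open Matrix Polynomial Filter

/-- The modified Bessel function `I₀`. -/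
noncomputable def besselI0 (t : ℝ) : ℝ :=
  (1 / Real.pi) * ∫ θ in (0:ℝ)..Real.pi, Real.exp (t * Real.cos θ)

/-- The modified Bessel function `K₀`. -/
noncomputable def besselK0 (t : ℝ) : ℝ :=
  ∫ v in Set.Ioi (0:ℝ), Real.exp (-(t * Real.cosh v))

/-- Off-shell Bessel moment `IvKM(a,b;n|u)`. -/
noncomputable def IvKM (a b n : ℕ) (u : ℝ) : ℝ :=
  ∫ t in Set.Ioi (0:ℝ),
    besselI0 (Real.sqrt u * t) * besselI0 t ^ (a - 1) * besselK0 t ^ b * t ^ n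

/-- Off-shell Bessel moment `IKvM(a,b;n|u)`. -/
noncomputable def IKvM (a b n : ℕ) (u : ℝ) : ℝ :=
  ∫ t in Set.Ioi (0:ℝ),
    besselK0 (Real.sqrt u * t) * besselI0 t ^ a * besselK0 t ^ (b - 1) * t ^ n

/-- The normalized off-shell Bessel moments `ν̆ℓ_{k,j}(u)` (for `1 ≤ j ≤ 3k+1`). -/
noncomputable def nuS (k l j : ℕ) (u : ℝ) : ℝ :=
  if j = 1 then
    Real.pi ^ (-(k : ℝ) - 1 / 2) *
      ((IvKM 1 (2 * k + 1) (2 * l - 1) u + (2 * k + 1 : ℝ) * IKvM 1 (2 * k + 1) (2 * l - 1) u) /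
        (2 * (k + 1)))
  else if j ≤ k + 1 then
    Real.pi ^ ((j : ℝ) - k - 3 / 2) * IvKM j (2 * k + 2 - j) (2 * l - 1) u
  else
    Real.pi ^ ((j : ℝ) - 2 * k - 3 / 2) * IKvM (j - k) (3 * k + 2 - j) (2 * l - 1) u


/-- formal derivative of a differential operator (coefficient family). -/
noncomputable def opD (q : ℕ → ℂ[X]) : ℕ → ℂ[X] :=
  fun i => derivative (q i) + (if i = 0 then 0 else q (i - 1))

/-- operators `Q_m` with `E_m = Q_m E_0`. -/
noncomputable def Qf (n : ℕ) : ℕ → (ℕ → ℂ[X])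
  | 0 => fun i => if i = 0 then 1 else 0
  | 1 => fun i => C (-2) * opD (fun i => X * (if i = 0 then 1 else 0)) i
  | m + 2 => fun i => C (-2 / ((m : ℂ) + 2)) *
      opD (fun i => X * (Qf n (m + 1) i - C (2 * ((n : ℂ) - m)) * opD (Qf n m) i)) i

lemma Qf_zero_of_lt (n : ℕ) : ∀ m i, m < i → Qf n m i = 0 := by
  intro m
  induction m using Nat.strong_induction_on with
  | _ m ih =>
    match m with
    | 0 => intro i hi; simp [Qf, hi.ne']
    | 1 =>
      intro i hi
      have : i ≠ 0 := by omega
      have : i - 1 ≠ 0 := by omega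
      simp [Qf, opD, *]
    | m + 2 =>
      intro i hi
      have h0 : i ≠ 0 := by omega
      have h1 : i - 1 ≠ 0 := by omega
      have e1 := ih (m+1) (by omega) i (by omega)
      have e2 := ih (m+1) (by omega) (i-1) (by omega)
      have e3 := ih m (by omega) i (by omega)
      have e4 := ih m (by omega) (i-1) (by omega)
      have e5 := ih m (by omega) (i-1-1) (by omega)
      simp [Qf, opD, *]

noncomputable def ellP (n m : ℕ) : ℂ[X] := Qf n m m
noncomputable def erP (n m : ℕ) : ℂ[X] := if m = 0 then 0 else Qf n m (m - 1)

lemma ellP_zero (n : ℕ) : ellP n 0 = 1 := by simp [ellP, Qf]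
lemma ellP_one (n : ℕ) : ellP n 1 = C (-2) * X := by simp [ellP, Qf, opD]
lemma erP_zero (n : ℕ) : erP n 0 = 0 := by simp [erP]
lemma erP_one (n : ℕ) : erP n 1 = C (-2) := by simp [erP, Qf, opD]

lemma ellP_succ (n m : ℕ) : ellP n (m + 2) = C (-2 / ((m : ℂ) + 2)) * (X * (ellP n (m+1) -
    C (2 * ((n : ℂ) - m)) * ellP n m)) := by
  simp only [ellP, Qf, opD]
  have e1 := Qf_zero_of_lt n (m+1) (m+2) (by omega)
  have e3 := Qf_zero_of_lt n m (m+1) (by omega)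
  have e4 := Qf_zero_of_lt n m (m+2) (by omega)
  simp [e1, e3, e4]

lemma Qf_sub_one (n m : ℕ) : Qf n (m+1) m = erP n (m+1) := by simp [erP]

lemma erP_succ (n m : ℕ) : erP n (m + 2) = C (-2 / ((m : ℂ) + 2)) * (X * erP n (m+1) +
    derivative (X * ellP n (m+1)) -
    C (2 * ((n : ℂ) - m)) * (X * erP n m + 2 * X * derivative (ellP n m) + ellP n m)) := by
  have e1 := Qf_zero_of_lt n m (m+1) (by omega)
  rw [show erP n (m+2) = Qf n (m+2) (m+1) by simp [erP]]
  simp only [Qf, opD]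
  have h : (if m = 0 then 0 else Qf n m (m - 1)) = erP n m := rfl
  simp only [e1, Nat.add_sub_cancel, Nat.succ_ne_zero, if_false, if_neg, h, Qf_sub_one]
  change C _ * (derivative (X * (ellP n (m+1) - C _ * (derivative 0 + ellP n m))) + X * (_ - _ * (derivative (ellP n m) + _))) = _
  simp only [derivative_mul, derivative_sub, derivative_add, derivative_X, derivative_C, derivative_zero]
  ring

/-- recursions with denominators cleared -/
lemma ellP_rec (n m : ℕ) : C ((m : ℂ) + 2) * ellP n (m + 2) = C (-2) * (X * (ellP n (m+1) -
    C (2 * ((n : ℂ) - m)) * ellP n m)) := by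
  have h : ((m : ℂ) + 2) ≠ 0 := by exact_mod_cast (by omega : m + 2 ≠ 0)
  rw [ellP_succ, ← mul_assoc, ← C_mul]
  congr 2
  field_simp

lemma erP_rec (n m : ℕ) : C ((m : ℂ) + 2) * erP n (m + 2) = C (-2) * (X * erP n (m+1) +
    derivative (X * ellP n (m+1)) -
    C (2 * ((n : ℂ) - m)) * (X * erP n m + 2 * X * derivative (ellP n m) + ellP n m)) := by
  have h : ((m : ℂ) + 2) ≠ 0 := by exact_mod_cast (by omega : m + 2 ≠ 0)
  rw [erP_succ, ← mul_assoc, ← C_mul]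
  congr 2
  field_simp

noncomputable def bigD (n m : ℕ) : ℂ[X] :=
  2 * X * erP n m + C ((n : ℂ) - 1 - 2 * m) * X * derivative (ellP n m) + C (m : ℂ) * ellP n m

lemma bigD_zero (n : ℕ) : bigD n 0 = 0 := by simp [bigD, erP_zero, ellP_zero]
lemma bigD_one (n : ℕ) : bigD n 1 = C (-2 * (n : ℂ)) * X := by
  simp only [bigD, erP_one, ellP_one, derivative_mul, derivative_X, derivative_C]
  push_cast
  simp only [C_sub, C_mul, C_neg, map_one, map_ofNat]
  ring

lemma bigD_rec (n m : ℕ) : C ((m : ℂ) + 2) * bigD n (m + 2) = C (-2) * (X * (bigD n (m+1) +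
     C ((n : ℂ) - 2 * (m + 1)) * ellP n (m+1) -
    C (2 * ((n : ℂ) - m)) * (bigD n m + C ((n : ℂ) - 1 - 2 * m) * ellP n m))) := by
  have h1 := ellP_rec n m
  have h2 := erP_rec n m
  have h3 := congrArg derivative h1
  simp only [derivative_mul, derivative_sub, derivative_X, derivative_C] at h2 h3
  simp only [bigD]
  push_cast
  simp only [C_sub, C_mul, C_neg, C_add, map_one, map_ofNat] at *
  linear_combination 2 * X * h2 + (C (n:ℂ) - 1 - 2 * (C (m:ℂ) + 2)) * X * h3 + (C (m:ℂ) + 2) * h1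

noncomputable def pz (n N : ℕ) : ℂ[X] := (X + C (n : ℂ)) * ellP n N - C 4 * X * ellP n (N - 1)
noncomputable def po (n N : ℕ) : ℂ[X] := (X + C (n : ℂ)) * erP n N -
  C 4 * X * (erP n (N - 1) + derivative (ellP n (N-1)))

lemma pz_eq (N : ℕ) (hN : 1 ≤ N) : C (((N : ℂ) + 1) * (N + 2)) * ellP (N+1) (N+2) = C 4 * X * pz (N+1) N := by
  obtain ⟨M, rfl⟩ : ∃ M, N = M + 1 := ⟨N - 1, by omega⟩
  have h1 := ellP_rec (M+1+1) (M+1)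
  have h2 := ellP_rec (M+1+1) M
  simp only [pz]
  push_cast at *
  simp only [C_sub, C_mul, C_neg, C_add, map_one, map_ofNat, Nat.add_sub_cancel] at *
  ring_nf at *
  linear_combination (2 + C (M:ℂ)) * h1 - 2 * X * h2

lemma po_eq (N : ℕ) (hN : 1 ≤ N) : C (((N : ℂ) + 1) * (N + 2)) * erP (N+1) (N+2) =
    C 4 * (X * po (N+1) N + 2 * X * derivative (pz (N+1) N) + pz (N+1) N) := by
  obtain ⟨M, rfl⟩ : ∃ M, N = M + 1 := ⟨N - 1, by omega⟩
  have h1 := erP_rec (M+1+1) (M+1)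
  have h2 := erP_rec (M+1+1) M
  have h3 := ellP_rec (M+1+1) M
  have h4 := congrArg derivative h3
  simp only [pz, po]
  push_cast at *
  simp only [derivative_mul, derivative_sub, derivative_X, derivative_C, derivative_add, C_sub, C_mul, C_neg, C_add, map_one, map_ofNat, Nat.add_sub_cancel, derivative_ofNat, derivative_one, derivative_neg] at *
  ring_nf at *
  linear_combination (2 + C (M:ℂ)) * h1 - 2 * X * h2 - 2 * h3 - 2 * X * h4


/-- continuants -/
def cont {R : Type*} [CommRing R] (a b : ℕ → R) : ℕ → R
  | 0 => 1
  | 1 => a 0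
  | m + 2 => a (m + 1) * cont a b (m + 1) - b (m + 1) * cont a b m

lemma cont_front {R : Type*} [CommRing R] (a b : ℕ → R) (m : ℕ) :
    cont a b (m + 2) = a 0 * cont (fun i => a (i+1)) (fun i => b (i+1)) (m+1) -
      b 1 * cont (fun i => a (i+2)) (fun i => b (i+2)) m := by
  induction m using Nat.strong_induction_on with
  | _ m ih =>
    match m with
    | 0 => simp [cont]; ring
    | 1 => simp [cont]; ring
    | m + 2 =>
      rw [cont, ih (m+1) (by omega), ih m (by omega)]
      rw [show cont (fun i => a (i+1)) (fun i => b (i+1)) (m+2+1) = a (m+3) * cont (fun i => a (i+1)) (fun i => b (i+1)) (m+2) - b (m+3) * cont (fun i => a (i+1)) (fun i => b (i+1)) (m+1) from rfl,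
        show cont (fun i => a (i+2)) (fun i => b (i+2)) (m+2) = a (m+3) * cont (fun i => a (i+2)) (fun i => b (i+2)) (m+1) - b (m+3) * cont (fun i => a (i+2)) (fun i => b (i+2)) m from rfl]
      ring

lemma cont_rev {R : Type*} [CommRing R] (n : ℕ) : ∀ (a b a' b' : ℕ → R),
    (∀ i, i < n → a' i = a (n - 1 - i)) → (∀ i, 1 ≤ i → i < n → b' i = b (n - i)) →
    cont a' b' n = cont a b n := by
  induction n using Nat.strong_induction_on with
  | _ n ih =>
    match n with
    | 0 => intros; rfl
    | 1 => intro a b a' b' ha hb; simpa [cont] using ha 0 (by omega)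
    | n + 2 =>
      intro a b a' b' ha hb
      rw [cont_front, cont, ha 0 (by omega), hb 1 (by omega) (by omega),
        ih (n+1) (by omega) a b _ _ (fun i hi => ?_) (fun i hi hi' => ?_),
        ih n (by omega) a b _ _ (fun i hi => ?_) (fun i hi hi' => ?_)]
      · rfl
      · rw [ha _ (by omega)]; congr 1; omega
      · rw [hb _ (by omega) (by omega)]; congr 1; omega
      · rw [ha _ (by omega)]; congr 1; omega
      · rw [hb _ (by omega) (by omega)]; congr 1; omega

lemma cont_dual (n : ℕ) (e : ℂ[X]) (m : ℕ) :
    cont (R := DualNumber ℂ[X])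
      (fun m => TrivSqZeroExt.inl (-2 * X) + TrivSqZeroExt.inr (e * (-2 * X * C ((n:ℂ) - 2 * m))))
      (fun m => TrivSqZeroExt.inl (-4 * X * C ((m:ℂ) * (n + 1 - m))) +
        TrivSqZeroExt.inr (e * (-4 * X * C ((m:ℂ) * (n + 1 - m)) * C ((n:ℂ) + 1 - 2 * m)))) m =
    TrivSqZeroExt.inl (C (m.factorial : ℂ) * ellP n m) +
      TrivSqZeroExt.inr (e * (C (m.factorial : ℂ) * bigD n m)) := by
  induction m using Nat.strong_induction_on with
  | _ m ih =>
    match m with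
    | 0 => simp [cont, ellP_zero, bigD_zero]
    | 1 =>
      rw [cont, ellP_one, bigD_one]
      simp only [C_sub, C_mul, C_neg, C_add, map_one, map_ofNat, Nat.factorial, Nat.cast_zero, map_zero]
      refine congrArg₂ (· + ·) (congrArg _ ?_) (congrArg _ ?_)
      · simp
      · simp
        left; ring
    | m + 2 =>
      rw [cont, ih (m+1) (by omega), ih m (by omega)]
      have h1 := ellP_rec n m
      have h2 := bigD_rec n m
      have f1 : ((m+2).factorial : ℂ) = (m + 2) * (m+1) * m.factorial := by
        rw [Nat.factorial_succ, Nat.factorial_succ]; push_cast; ring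
      have f2 : ((m+1).factorial : ℂ) = (m+1) * m.factorial := by
        rw [Nat.factorial_succ]; push_cast; ring
      rw [f1, f2]
      push_cast
      simp only [C_sub, C_mul, C_neg, C_add, map_one, map_ofNat] at *
      ext1
      · simp only [TrivSqZeroExt.fst_sub, TrivSqZeroExt.fst_mul, TrivSqZeroExt.fst_add, TrivSqZeroExt.fst_inl, TrivSqZeroExt.fst_inr]
        linear_combination (-(C (m:ℂ) + 1) * C (m.factorial:ℂ)) * h1
      · simp only [TrivSqZeroExt.snd_sub, TrivSqZeroExt.snd_mul, TrivSqZeroExt.fst_add, TrivSqZeroExt.fst_inl, TrivSqZeroExt.fst_inr, TrivSqZeroExt.snd_add, TrivSqZeroExt.snd_inl, TrivSqZeroExt.snd_inr, smul_eq_mul, MulOpposite.smul_eq_mul_unop, MulOpposite.unop_op]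
        linear_combination (-(C (m:ℂ) + 1) * C (m.factorial:ℂ)) * e * h2

lemma bigD_top (n : ℕ) : bigD n (n + 1) = 0 := by
  have h1 := cont_dual n 1 (n+1)
  have h2 := cont_dual n (-1) (n+1)
  rw [cont_rev (n+1) _ _ _ _ (fun i hi => ?_) (fun i hi hi' => ?_)] at h2
  · rw [h1] at h2
    have h3 := congrArg TrivSqZeroExt.snd h2
    simp only [TrivSqZeroExt.snd_add, TrivSqZeroExt.snd_inl, TrivSqZeroExt.snd_inr] at h3
    have h4 : C ((n+1).factorial : ℂ) * bigD n (n+1) = 0 := by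
      have : (2:ℂ[X]) * (C ((n+1).factorial : ℂ) * bigD n (n+1)) = 0 := by linear_combination h3
      simpa using this
    have : C ((n+1).factorial : ℂ) ≠ 0 := by
      rw [Ne, C_eq_zero]; exact_mod_cast (Nat.factorial_ne_zero _)
    exact (mul_eq_zero.1 h4).resolve_left this
  · obtain ⟨j, rfl⟩ : ∃ j, n = i + j := ⟨n - i, by omega⟩
    have : i + j + 1 - 1 - i = j := by omega
    rw [this]
    push_cast
    simp only [C_sub, C_mul, C_neg, C_add, map_one, map_ofNat]
    exact congrArg₂ (· + ·) rfl (congrArg _ (by ring))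
  · obtain ⟨j, rfl⟩ : ∃ j, n = i + j := ⟨n - i, by omega⟩
    have : i + j + 1 - i = j + 1:= by omega
    rw [this]
    push_cast
    simp only [C_sub, C_mul, C_neg, C_add, map_one, map_ofNat]
    refine congrArg₂ (· + ·) (congrArg _ ?_) (congrArg _ ?_) <;> ring

lemma po_eq_deriv (k : ℕ) (hk : 1 ≤ k) : po (2*k+1) (2*k) = C (k:ℂ) * derivative (pz (2*k+1) (2*k)) := by
  have h1 := pz_eq (2*k) (by omega)
  have h2 := po_eq (2*k) (by omega)
  have h3 := bigD_top (2*k+1)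
  have h4 := congrArg derivative h1
  simp only [bigD] at h3
  simp only [derivative_mul, derivative_C, derivative_X] at h4
  push_cast at *
  simp only [C_sub, C_mul, C_neg, C_add, map_one, map_ofNat] at *
  have : (8 * X ^ 2 : ℂ[X]) * (po (2*k+1) (2*k) - C (k:ℂ) * derivative (pz (2*k+1) (2*k))) = 0 := by
    ring_nf at *
    linear_combination -2 * X * h2 + (2 + 6 * C (k:ℂ) + 4 * C (k:ℂ)^2) * h3 +  (2*C (k:ℂ)+4) * X * h4 - (2 * C (k:ℂ) + 2) * h1
  have h8 : (8 * X ^ 2 : ℂ[X]) ≠ 0 := by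
    simp
  have := (mul_eq_zero.1 this).resolve_left h8
  linear_combination this

/-- Krawtchouk-type polynomials -/
lemma cont_monic (T : ℂ) (n m : ℕ) :
    (cont (fun _ => (X : ℂ[X])) (fun i => C (T^2 * i * (n + 1 - i))) m).Monic ∧
    (cont (fun _ => (X : ℂ[X])) (fun i => C (T^2 * i * (n + 1 - i))) m).natDegree = m := by
  induction m using Nat.strong_induction_on with
  | _ m ih =>
    match m with
    | 0 => simp [cont]
    | 1 => simp [cont, monic_X]
    | m + 2 =>
      obtain ⟨a1, a2⟩ := ih (m+1) (by omega)
      obtain ⟨b1, b2⟩ := ih m (by omega)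
      rw [cont]
      have hm : (X * cont (fun _ => (X : ℂ[X])) (fun i => C (T^2 * i * (n + 1 - i))) (m+1)).Monic := monic_X.mul a1
      have hd : (X * cont (fun _ => (X : ℂ[X])) (fun i => C (T^2 * i * (n + 1 - i))) (m+1)).natDegree = m + 2 := by
        rw [monic_X.natDegree_mul a1, a2, natDegree_X]; ring
      have hlt : (C (T^2 * ((m+1:ℕ):ℂ) * (n + 1 - ((m+1:ℕ):ℂ))) * cont (fun _ => (X : ℂ[X])) (fun i => C (T^2 * i * (n + 1 - i))) m).degree < (X * cont (fun _ => (X : ℂ[X])) (fun i => C (T^2 * i * (n + 1 - i))) (m+1)).degree := by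
        rw [degree_eq_natDegree hm.ne_zero, hd]
        refine lt_of_le_of_lt degree_le_natDegree ?_
        have := natDegree_C_mul_le (T^2 * ((m+1:ℕ):ℂ) * (n + 1 - ((m+1:ℕ):ℂ))) (cont (fun _ => (X : ℂ[X])) (fun i => C (T^2 * i * (n + 1 - i))) m)
        exact Nat.cast_lt.2 (by omega)
      refine ⟨hm.sub_of_left hlt, ?_⟩
      rw [← hd]
      exact natDegree_eq_of_degree_eq (degree_sub_eq_left_of_degree_lt hlt)

lemma cont_root (T : ℂ) (n j : ℕ) (hj : j ≤ n) (m : ℕ) :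
    (cont (fun _ => (X : ℂ[X])) (fun i => C (T^2 * i * (n + 1 - i))) m).eval (((n:ℂ) - 2 * j) * T) =
    m.factorial * ((1 + C T * X) ^ (n - j) * (1 - C T * X) ^ j : ℂ[X]).coeff m := by
  set P : ℂ[X] := (1 + C T * X) ^ (n - j) * (1 - C T * X) ^ j with hP
  have hode : (1 - C (T^2) * X^2) * derivative P = P * (C (((n:ℂ) - 2 * j) * T) - C (n * T^2) * X) := by
    obtain ⟨l, rfl⟩ : ∃ l, n = j + l := ⟨n - j, by omega⟩
    rw [hP, Nat.add_sub_cancel_left]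
    have h1 : ∀ (a : ℂ[X]) (l : ℕ), a * ((l : ℂ[X]) * a ^ (l - 1)) = l * a ^ l := by
      intro a l
      cases l with
      | zero => simp
      | succ l => simp; ring
    have e1 := h1 (1 + C T * X) l
    have e2 := h1 (1 - C T * X) j
    simp only [derivative_mul, derivative_pow, derivative_add, derivative_sub, derivative_one,
      derivative_C, derivative_X]
    push_cast
    simp only [C_sub, C_mul, C_neg, C_add, map_one, map_ofNat, C_pow, map_natCast]
    linear_combination (1 - C T * X)^(j+1) * C T * e1 - (1 + C T * X)^(l+1) * C T * e2
  have h0 : P.coeff 0 = 1 := by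
    simp [hP, coeff_zero_eq_eval_zero]
  have hrec : ∀ m : ℕ, ((m:ℂ) + 2) * P.coeff (m+2) = ((n:ℂ) - 2 * j) * T * P.coeff (m+1) - T^2 * (n - m) * P.coeff m := by
    intro m
    have h := congrArg (fun q => q.coeff (m+1)) hode
    rw [sub_mul, mul_sub] at h
    simp only [coeff_sub, one_mul, coeff_mul_C, ← mul_assoc, coeff_mul_X] at h
    rw [mul_assoc, coeff_C_mul, coeff_X_pow_mul', coeff_derivative] at h
    rw [show m + 1 + 1 = m + 2 from rfl] at h
    by_cases hm : 2 ≤ m + 1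
    · rw [if_pos hm, coeff_derivative, show m + 1 - 2 + 1 = m by omega] at h
      have : ((m + 1 - 2 : ℕ) : ℂ) = m - 1 := by
        rw [Nat.cast_sub hm]; push_cast; ring
      rw [this] at h
      push_cast at h
      linear_combination h
    · obtain rfl : m = 0 := by omega
      simp at h
      simp
      linear_combination h
  have h1 : P.coeff 1 = ((n:ℂ) - 2 * j) * T := by
    have h := congrArg (fun q => q.coeff 0) hode
    rw [sub_mul, mul_sub] at h
    simp [coeff_zero_eq_eval_zero] at h
    have e : eval 0 (derivative P) = P.coeff 1 := by
      rw [← coeff_zero_eq_eval_zero, coeff_derivative]; simp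
    rw [e, ← coeff_zero_eq_eval_zero, h0] at h
    simpa using h
  induction m using Nat.strong_induction_on with
  | _ m ih =>
    match m with
    | 0 => simp [cont, h0]
    | 1 => simp [cont, h1]
    | m + 2 =>
      have e1 := ih (m+1) (by omega)
      have e2 := ih m (by omega)
      have f1 : ((m+2).factorial : ℂ) = (m + 2) * (m+1) * m.factorial := by
        rw [Nat.factorial_succ, Nat.factorial_succ]; push_cast; ring
      have f2 : ((m+1).factorial : ℂ) = (m+1) * m.factorial := by
        rw [Nat.factorial_succ]; push_cast; ring
      rw [cont, eval_sub, eval_mul, eval_mul, e1, e2, f1, f2, eval_X, eval_C]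
      push_cast
      linear_combination (-(m+1) * m.factorial) * hrec m

lemma cont_prod (T : ℂ) (hT : T ≠ 0) (n : ℕ) :
    cont (fun _ => (X : ℂ[X])) (fun i => C (T^2 * i * (n + 1 - i))) (n+1) =
     ∏ j ∈ Finset.range (n+1), (X - C (((n:ℂ) - 2 * j) * T)) := by
  obtain ⟨h1, h2⟩ := cont_monic T n (n+1)
  have hm : (∏ j ∈ Finset.range (n+1), (X - C (((n:ℂ) - 2 * j) * T))).Monic := monic_prod_X_sub_C _ _
  have hd : (∏ j ∈ Finset.range (n+1), (X - C (((n:ℂ) - 2 * j) * T))).natDegree = n + 1 := by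
    rw [natDegree_prod_of_monic _ _ (fun i _ => monic_X_sub_C _)]
    simp only [natDegree_X_sub_C, Finset.sum_const, Finset.card_range, smul_eq_mul, mul_one]
  refine eq_of_degree_sub_lt_of_eval_index_eq (Finset.range (n+1)) (v := fun j : ℕ => ((n:ℂ) - 2 * j) * T) ?_ ?_ ?_
  · intro a _ b _ hab
    simp only [mul_eq_mul_right_iff, hT, or_false] at hab
    have : (a:ℂ) = b := by linear_combination (-1/2) * hab
    exact_mod_cast this
  · rw [Finset.card_range]
    have := degree_sub_lt (p := cont (fun _ => (X : ℂ[X])) (fun i => C (T^2 * i * (n + 1 - i))) (n+1)) (q := ∏ j ∈ Finset.range (n+1), (X - C (((n:ℂ) - 2 * j) * T))) (by rw [degree_eq_natDegree h1.ne_zero, degree_eq_natDegree hm.ne_zero, h2, hd]) h1.ne_zero (by rw [h1.leadingCoeff, hm.leadingCoeff])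
    rwa [degree_eq_natDegree h1.ne_zero, h2] at this
  · intro j hj
    have hj' : j ≤ n := by simpa [Nat.lt_succ_iff] using hj
    rw [cont_root T n j hj', eval_prod, coeff_eq_zero_of_natDegree_lt, mul_zero,
      Finset.prod_eq_zero hj (by simp)]
    refine Nat.lt_succ_of_le (natDegree_mul_le.trans ?_)
    have a1 : ((1 + C T * X : ℂ[X]) ^ (n - j)).natDegree ≤ (n - j) * 1 :=
      natDegree_pow_le_of_le _ (by compute_degree)
    have a2 : ((1 - C T * X : ℂ[X]) ^ j).natDegree ≤ j * 1 :=
      natDegree_pow_le_of_le _ (by compute_degree)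
    omega

lemma ellP_eval_cont (T v : ℂ) (hT : T ^ 2 = -4 * v) (n m : ℕ) :
    (m.factorial : ℂ) * (ellP n m).eval v =
     (cont (fun _ => (X : ℂ[X])) (fun i => C (T^2 * i * (n + 1 - i))) m).eval (-2 * v) := by
  induction m using Nat.strong_induction_on with
  | _ m ih =>
    match m with
    | 0 => simp [cont, ellP_zero]
    | 1 => simp [cont, ellP_one]
    | m + 2 =>
      have e1 := ih (m+1) (by omega)
      have e2 := ih m (by omega)
      have f1 : ((m+2).factorial : ℂ) = (m + 2) * (m+1) * m.factorial := by
        rw [Nat.factorial_succ, Nat.factorial_succ]; push_cast; ring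
      have f2 : ((m+1).factorial : ℂ) = (m+1) * m.factorial := by
        rw [Nat.factorial_succ]; push_cast; ring
      have h := congrArg (eval v) (ellP_rec n m)
      simp only [eval_mul, eval_C, eval_X, eval_sub] at h
      rw [cont, eval_sub, eval_mul, eval_mul, ← e1, ← e2, f1, f2, eval_X, eval_C, hT]
      push_cast
      linear_combination ((m+1) * m.factorial) * h

lemma prod_pair {R : Type*} [CommRing R] (h : ℤ → R) (m : ℕ) :
    ∏ j ∈ Finset.range (2*m), h (2 * m - 1 - 2 * j) = ∏ i ∈ Finset.range m, (h (2 * i + 1) * h (-(2*i+1))) := by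
  induction m with
  | zero => simp
  | succ m ih =>
    rw [Finset.prod_range_succ, ← ih, show 2 * (m+1) = 2 * m + 1 + 1 by ring, Finset.prod_range_succ, Finset.prod_range_succ']
    have : ∀ j : ℕ, (2 * ((m+1:ℕ):ℤ) - 1 - 2 * ((j+1:ℕ):ℤ)) = 2 * (m:ℤ) - 1 - 2 * (j:ℤ) := by
      intro j; push_cast; ring
    simp only [this]
    rw [show (2 * ((m+1:ℕ):ℤ) - 1 - 2 * ((0:ℕ):ℤ)) = 2 * m + 1 by push_cast; ring,
      show (2 * (m:ℤ) - 1 - 2 * ((2*m:ℕ):ℤ)) = -(2 * m + 1) by push_cast; ring]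
    ring

lemma ellP_top (k : ℕ) (v : ℂ) : ((2*k+2).factorial : ℂ) * (ellP (2*k+1) (2*k+2)).eval v =
    (4 * v)^(k+1) * ∏ i ∈ Finset.range (k+1), (v + (2 * i + 1)^2) := by
  by_cases hv : v = 0
  · subst hv
    rw [ellP_succ]
    simp
  · obtain ⟨T, hT⟩ := IsAlgClosed.exists_pow_nat_eq (-4 * v) (n := 2) (by norm_num)
    have hT0 : T ≠ 0 := by
      rintro rfl
      apply hv
      simpa using hT
    rw [ellP_eval_cont T v hT, cont_prod T hT0, eval_prod]
    have := prod_pair (fun z : ℤ => -2 * v - (z:ℂ) * T) (k+1)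
    have h2 : ∀ j : ℕ, eval (-2 * v) (X - C ((((2*k+1:ℕ):ℂ) - 2 * j) * T)) =
        (-2 * v - ((2 * ((k+1 : ℕ):ℤ) - 1 - 2 * (j:ℤ) : ℤ):ℂ) * T) := by
      intro j; simp; left; ring
    simp only [h2]
    rw [show 2 * k + 1 + 1 = 2 * (k+1) by ring, this, ← Finset.card_range (k+1), ← Finset.prod_const, Finset.card_range, ← Finset.prod_mul_distrib]
    refine Finset.prod_congr rfl fun i _ => ?_
    push_cast
    linear_combination (-(2 * (i:ℂ) + 1)^2) * hT

lemma pz_prod (k : ℕ) (hk : 1 ≤ k) : ∃ c : ℂ, c ≠ 0 ∧ pz (2*k+1) (2*k) =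
    C c * (X ^ k * ∏ i ∈ Finset.range (k+1), (X + C ((2 * (i:ℂ) + 1)^2))) := by
  have hf : ((2*k+2).factorial : ℂ) ≠ 0 := by exact_mod_cast (Nat.factorial_ne_zero _)
  have h12 : ((2*k : ℂ) + 1) * (2 * k + 2) ≠ 0 := by exact_mod_cast (by positivity : (2 * k + 1) * (2 * k + 2) ≠ 0)
  refine ⟨(2*k+1) * (2*k+2) * 4^k / ((2*k+2).factorial : ℂ), div_ne_zero (mul_ne_zero h12 (pow_ne_zero _ (by norm_num))) hf, ?_⟩
  have h1 := pz_eq (2*k) (by omega)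
  have h2 : C ((2*k+2).factorial : ℂ) * ellP (2*k+1) (2*k+2) = (C 4 * X)^(k+1) *  ∏ i ∈ Finset.range (k+1), (X + C ((2 * (i:ℂ) + 1)^2)) := by
    apply Polynomial.funext
    intro v
    rw [eval_mul, eval_C, ellP_top]
    simp [eval_prod]
  have h3 : (C 4 * X : ℂ[X]) ≠ 0 := by simp
  apply mul_left_cancel₀ h3
  apply mul_left_cancel₀ (show C ((2*k+2).factorial : ℂ) ≠ 0 by simpa using hf)
  rw [← h1]
  have h4 : C ((2*k+2).factorial : ℂ) * C ((2*k+1) * (2*k+2) * 4^k / ((2*k+2).factorial : ℂ)) = C ((2*(k:ℂ)+1) * (2*k+2)) * C 4 ^ k := by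
    rw [← C_mul, ← C_pow, ← C_mul]; congr 1; field_simp
  push_cast at *
  rw [pow_succ, mul_pow] at h2
  linear_combination (C ((2*(k:ℂ)+1) * (2*k+2))) * h2 - (C 4 * X) * (X ^ k * ∏ i ∈ Finset.range (k+1), (X + C ((2 * (i:ℂ) + 1)^2))) * h4

lemma ellP_tendsto (n m : ℕ) : Tendsto (fun v : ℝ => (ellP n m).eval (v:ℂ) / (v:ℂ)^m) atTop (nhds ((-2)^m / m.factorial)) := by
  induction m using Nat.strong_induction_on with
  | _ m ih =>
    match m with
    | 0 => simp [ellP_zero]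
    | 1 =>
      simp only [ellP_one]
      refine Tendsto.congr' (f₁ := fun _ => (-2:ℂ)) ?_ (by simp)
      filter_upwards [eventually_gt_atTop 0] with v hv
      have : (v:ℂ) ≠ 0 := by exact_mod_cast hv.ne'
      simp; field_simp
    | m + 2 =>
      have e1 := ih (m+1) (by omega)
      have e2 := ih m (by omega)
      have hz : Tendsto (fun v : ℝ => ((v:ℂ))⁻¹) atTop (nhds 0) := by
        have := (Complex.continuous_ofReal.tendsto 0).comp tendsto_inv_atTop_zero
        simpa [Function.comp_def] using this
      have h := ((e1.sub ((e2.mul hz).const_mul (2 * ((n:ℂ) - m)))).const_mul (-2 / ((m:ℂ)+2)))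
      have hm2 : ((m:ℂ) + 2) ≠ 0 := by exact_mod_cast (by omega : m + 2 ≠ 0)
      have f1 : ((m+2).factorial : ℂ) = (m + 2) * (m+1).factorial := by
        rw [Nat.factorial_succ]; push_cast; ring
      have hf : ((m+1).factorial : ℂ) ≠ 0 := by exact_mod_cast (Nat.factorial_ne_zero _)
      convert Tendsto.congr' ?_ h using 2
      · rw [f1]; field_simp; ring
      · filter_upwards [eventually_gt_atTop 0] with v hv
        have : (v:ℂ) ≠ 0 := by exact_mod_cast hv.ne'
        rw [ellP_succ]
        simp only [eval_mul, eval_C, eval_X, eval_sub]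
        field_simp
        ring


lemma hasDerivAt_det {N : ℕ} (A A' : ℂ → Fin N → Fin N → ℂ) (v : ℂ)
    (h : ∀ i j, HasDerivAt (fun v => A v i j) (A' v i j) v) :
    HasDerivAt (fun v => (Matrix.of (A v)).det)
      (∑ r, ((Matrix.of (A v)).updateRow r (A' v r)).det) v := by
  have h1 : ∀ σ : Equiv.Perm (Fin N), HasDerivAt (fun v => ((Equiv.Perm.sign σ : ℤ) : ℂ) * ∏ i, A v i (σ i))
      (((Equiv.Perm.sign σ : ℤ) : ℂ) * ∑ r, ∏ i, ((Matrix.of (A v)).updateRow r (A' v r)) i (σ i)) v := by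
    intro σ
    refine HasDerivAt.const_mul _ ?_
    have := HasDerivAt.fun_finset_prod (u := Finset.univ) (f := fun i v => A v i (σ i)) (f' := fun i => A' v i (σ i)) (x := v) (fun i _ => h i (σ i))
    refine this.congr_deriv ?_
    refine Finset.sum_congr rfl fun r _ => ?_
    rw [← Finset.mul_prod_erase _ _ (Finset.mem_univ r), smul_eq_mul, mul_comm]
    congr 1
    · simp
    · refine Finset.prod_congr rfl fun i hi => ?_
      rw [Matrix.updateRow_ne (Finset.ne_of_mem_erase hi)]
      rfl
  have h2 := HasDerivAt.fun_sum (u := Finset.univ) (fun σ _ => h1 σ)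
  have e : ∀ M : Matrix (Fin N) (Fin N) ℂ, M.det = ∑ σ : Equiv.Perm (Fin N), ((Equiv.Perm.sign σ : ℤ) : ℂ) * ∏ i, M i (σ i) := by
    intro M
    rw [← Matrix.det_transpose, Matrix.det_apply']
    rfl
  simp only [e]
  refine h2.congr_deriv ?_
  rw [Finset.sum_comm]
  exact Finset.sum_congr rfl fun σ _ => by rw [Finset.mul_sum]

lemma hasDerivAt_iteratedDeriv {Ω : Set ℂ} (hΩ : IsOpen Ω) {f : ℂ → ℂ} (hf : DifferentiableOn ℂ f Ω) (i : ℕ) :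
    ∀ v ∈ Ω, HasDerivAt (iteratedDeriv i f) (iteratedDeriv (i+1) f v) v := by
  have h : DifferentiableOn ℂ (iteratedDeriv i f) Ω := by
    induction i with
    | zero => simpa using hf
    | succ i ih => rw [iteratedDeriv_succ]; exact ih.deriv hΩ
  intro v hv
  rw [iteratedDeriv_succ]
  exact (h.differentiableAt (hΩ.mem_nhds hv)).hasDerivAt

noncomputable def appQ (M : ℕ) (q : ℕ → ℂ[X]) (f : ℂ → ℂ) (v : ℂ) : ℂ :=
  ∑ i ∈ Finset.range (M+1), (q i).eval v * iteratedDeriv i f v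

lemma hasDerivAt_appQ {Ω : Set ℂ} (hΩ : IsOpen Ω) {f : ℂ → ℂ} (hf : DifferentiableOn ℂ f Ω) (M : ℕ)
    (q : ℕ → ℂ[X]) (hq : q M = 0) (v : ℂ) (hv : v ∈ Ω) :
    HasDerivAt (appQ M q f) (appQ M (opD q) f v) v := by
  have h := HasDerivAt.fun_sum (u := Finset.range (M+1)) (fun i _ =>
    ((q i).hasDerivAt v).mul (hasDerivAt_iteratedDeriv hΩ hf i v hv))
  refine h.congr_deriv ?_
  simp only [appQ, opD]
  rw [Finset.sum_add_distrib, Finset.sum_range_succ (fun x => eval v (q x) * _), hq]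
  simp only [eval_add, add_mul]
  rw [Finset.sum_add_distrib, Finset.sum_range_succ' (fun x => eval v (if x = 0 then 0 else q (x-1)) * _)]
  simp

lemma appQ_smul_X (M : ℕ) (q q' : ℕ → ℂ[X]) (a : ℂ) (f : ℂ → ℂ) (v : ℂ) :
   appQ M (fun i => X * (q i - C a * q' i)) f v = v * (appQ M q f v - a * appQ M q' f v) := by
  simp only [appQ, mul_sub, Finset.mul_sum, ← Finset.sum_sub_distrib]
  refine Finset.sum_congr rfl fun i _ => ?_
  simp
  ring

/-- the data of a solution family -/
structure SolFam (k : ℕ) (E : ℕ → ℂ → ℂ) : Prop where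
  diff : ∀ m, DifferentiableOn ℂ (E m) {v : ℂ | 0 < v.re}
  r0 : ∀ v : ℂ, 0 < v.re → E 1 v = -2 * deriv (fun v => v * E 0 v) v
  rs : ∀ m, m + 2 ≤ 2 * k → ∀ v : ℂ, 0 < v.re → ((m:ℂ) + 2) * E (m+2) v =
    -2 * deriv (fun v => v * (E (m+1) v - 2 * (((2*k+1:ℕ):ℂ) - m) * deriv (E m) v)) v
  ode : ∀ v : ℂ, 0 < v.re → (v + ((2*k+1:ℕ):ℂ)) * E (2*k) v - 4 * v * deriv (E (2*k-1)) v = 0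

lemma isOpen_rhp : IsOpen {v : ℂ | 0 < v.re} := isOpen_lt continuous_const Complex.continuous_re

lemma SolFam.eq_app {k : ℕ} {E : ℕ → ℂ → ℂ} (h : SolFam k E) (m : ℕ) : m ≤ 2 * k →
    ∀ v : ℂ, 0 < v.re → E m v = appQ (2*k+1) (Qf (2*k+1) m) (E 0) v := by
  induction m using Nat.strong_induction_on with
  | _ m ih =>
    have hev : ∀ v : ℂ, 0 < v.re → ∀ᶠ w in nhds v, 0 < w.re := fun v hv => isOpen_rhp.mem_nhds hv
    match m with
    | 0 =>
      intro _ v hv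
      rw [appQ, Finset.sum_eq_single 0 (fun i _ hi => by simp [Qf, hi]) (by simp)]
      simp [Qf]
    | 1 =>
      intro hk v hv
      rw [h.r0 v hv]
      have e1 : (fun v => v * E 0 v) = appQ (2*k+1) (fun i => X * (if i = 0 then 1 else 0)) (E 0) := by
        ext v
        rw [appQ, Finset.sum_eq_single 0 (fun i _ hi => by simp [hi]) (by simp)]
        simp
      rw [e1, (hasDerivAt_appQ isOpen_rhp (h.diff 0) _ _ (by simp) v hv).deriv]
      simp only [appQ, Qf, Finset.mul_sum]
      refine Finset.sum_congr rfl fun i _ => ?_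
      simp; ring
    | m + 2 =>
      intro hk v hv
      have hd : ∀ w : ℂ, 0 < w.re → deriv (E m) w = appQ (2*k+1) (opD (Qf (2*k+1) m)) (E 0) w := by
        intro w hw
        rw [← (hasDerivAt_appQ isOpen_rhp (h.diff 0) (2*k+1) (Qf (2*k+1) m) (Qf_zero_of_lt _ _ _ (by omega)) w hw).deriv]
        exact Filter.EventuallyEq.deriv_eq ((hev w hw).mono fun z hz => ih m (by omega) (by omega) z hz)
      have e1 : deriv (fun v => v * (E (m+1) v - 2 * (((2*k+1:ℕ):ℂ) - m) * deriv (E m) v)) v =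
         appQ (2*k+1) (opD (fun i => X * (Qf (2*k+1) (m + 1) i - C (2 * (((2*k+1:ℕ):ℂ) - m)) * opD (Qf (2*k+1) m) i))) (E 0) v := by
        rw [← (hasDerivAt_appQ isOpen_rhp (h.diff 0) (2*k+1) (fun i => X * (Qf (2*k+1) (m + 1) i - C (2 * (((2*k+1:ℕ):ℂ) - m)) * opD (Qf (2*k+1) m) i)) ?_ v hv).deriv]
        · refine Filter.EventuallyEq.deriv_eq ((hev v hv).mono fun z hz => ?_)
          beta_reduce
          rw [appQ_smul_X, ih (m+1) (by omega) (by omega) z hz, hd z hz]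
        · have e1 := Qf_zero_of_lt (2*k+1) (m+1) (2*k+1) (by omega)
          have e2 := Qf_zero_of_lt (2*k+1) m (2*k+1) (by omega)
          have e3 := Qf_zero_of_lt (2*k+1) m (2*k+1-1) (by omega)
          simp only [opD, e1, e2, e3]; simp
      have h1 := h.rs m hk v hv
      rw [e1] at h1
      have hm2 : ((m:ℂ) + 2) ≠ 0 := by exact_mod_cast (by omega : m + 2 ≠ 0)
      apply mul_left_cancel₀ hm2
      rw [h1]
      rw [Qf]
      simp only [appQ, Finset.mul_sum]
      refine Finset.sum_congr rfl fun i _ => ?_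
      rw [eval_mul, eval_C]
      field_simp

/-- The Wronskian. -/
noncomputable def Wr {N : ℕ} (f : Fin N → ℂ → ℂ) (v : ℂ) : ℂ :=
  (Matrix.of fun i j : Fin N => iteratedDeriv (i:ℕ) (f j) v).det

lemma hasDerivAt_Wr {Ω : Set ℂ} (hΩ : IsOpen Ω) {M : ℕ} (f : Fin (M+1) → ℂ → ℂ)
    (hf : ∀ j, DifferentiableOn ℂ (f j) Ω) (v : ℂ) (hv : v ∈ Ω) :
    HasDerivAt (Wr f) (((Matrix.of fun i j : Fin (M+1) => iteratedDeriv (i:ℕ) (f j) v).updateRow (Fin.last M)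
      (fun j => iteratedDeriv (M+1) (f j) v)).det) v := by
  have h := hasDerivAt_det (fun v i j => iteratedDeriv (i:ℕ) (f j) v) (fun v i j => iteratedDeriv ((i:ℕ)+1) (f j) v) v
    (fun i j => hasDerivAt_iteratedDeriv hΩ (hf j) i v hv)
  refine h.congr_deriv ?_
  rw [Fin.sum_univ_castSucc, Finset.sum_eq_zero, zero_add]
  · rfl
  · intro r _
    refine Matrix.det_zero_of_row_eq (i := r.castSucc) (j := r.succ) ?_ ?_
    · exact (Fin.castSucc_lt_succ).ne
    · rw [Matrix.updateRow_self, Matrix.updateRow_ne (Fin.castSucc_lt_succ).ne']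
      ext j; simp

lemma Wr_rel {Ω : Set ℂ} (hΩ : IsOpen Ω) {N M : ℕ} (hN : N = M + 1) (f : Fin N → ℂ → ℂ) (V : ℕ → ℂ[X]) (v : ℂ)
    (hf : ∀ j, DifferentiableOn ℂ (f j) Ω) (hv : v ∈ Ω)
    (hrel : ∀ j, appQ (N+1) V (f j) v = 0) (V1 : V (N+1) = 0) :
    ∃ W', HasDerivAt (Wr f) W' v ∧ (V N).eval v * W' = - (V (N-1)).eval v * Wr f v := by
  subst hN
  refine ⟨_, hasDerivAt_Wr hΩ f hf v hv, ?_⟩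
  rw [← Matrix.det_updateRow_smul]
  have e : (V (M+1)).eval v • (fun j => iteratedDeriv (M+1) (f j) v) =
      ∑ i : Fin (M+1), (-(V i).eval v) • (Matrix.of fun i j : Fin (M+1) => iteratedDeriv (i:ℕ) (f j) v) i := by
    ext j
    have h := hrel j
    rw [appQ, Finset.sum_range_succ, Finset.sum_range_succ, V1, Finset.sum_range] at h
    simp only [Pi.smul_apply, Finset.sum_apply, smul_eq_mul, Matrix.of_apply, neg_mul, Finset.sum_neg_distrib]
    simp only [eval_zero, zero_mul, add_zero] at h
    linear_combination h
  rw [e, Matrix.det_updateRow_sum]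
  simp [Wr]

lemma Wr_ode {k : ℕ} (hk : 1 ≤ k) (E : ℕ → Fin (2*k) → ℂ → ℂ) (h : ∀ j, SolFam k (fun m => E m j)) (v : ℂ) (hv : 0 < v.re) :
    ∃ W', HasDerivAt (Wr (E 0)) W' v ∧ (pz (2*k+1) (2*k)).eval v * W' = - (po (2*k+1) (2*k)).eval v * Wr (E 0) v := by
  obtain ⟨M, hM⟩ : ∃ M, 2 * k = M + 1 := ⟨2*k-1, by omega⟩
  have hrel : ∀ j, appQ (2*k+1) (fun i => (X + C ((2*k+1:ℕ):ℂ)) * Qf (2*k+1) (2*k) i - C 4 * X * opD (Qf (2*k+1) (2*k-1)) i) (E 0 j) v = 0 := by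
    intro j
    have h1 := (h j).ode v hv
    have hd : deriv (E (2*k-1) j) v = appQ (2*k+1) (opD (Qf (2*k+1) (2*k-1))) (E 0 j) v := by
      rw [← (hasDerivAt_appQ isOpen_rhp ((h j).diff 0) (2*k+1) (Qf (2*k+1) (2*k-1)) (Qf_zero_of_lt _ _ _ (by omega)) v hv).deriv]
      exact Filter.EventuallyEq.deriv_eq (Filter.mem_of_superset (isOpen_rhp.mem_nhds hv) fun z hz => (h j).eq_app _ (by omega) z hz)
    rw [(h j).eq_app (2*k) le_rfl v hv, hd] at h1
    rw [← h1]
    simp only [appQ, Finset.mul_sum, ← Finset.sum_sub_distrib]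
    refine Finset.sum_congr rfl fun i _ => ?_
    simp
    ring
  set V : ℕ → ℂ[X] := (fun i => (X + C ((2*k+1:ℕ):ℂ)) * Qf (2*k+1) (2*k) i - C 4 * X * opD (Qf (2*k+1) (2*k-1)) i) with hV
  have V1 : V (2*k+1) = 0 := by
    have e1 := Qf_zero_of_lt (2*k+1) (2*k) (2*k+1) (by omega)
    have e2 := Qf_zero_of_lt (2*k+1) (2*k-1) (2*k+1) (by omega)
    have e3 := Qf_zero_of_lt (2*k+1) (2*k-1) (2*k+1-1) (by omega)
    simp only [hV, opD, e1, e2, e3]; simp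
  have V2 : V (2*k) = pz (2*k+1) (2*k) := by
    have e2 := Qf_zero_of_lt (2*k+1) (2*k-1) (2*k) (by omega)
    have : k ≠ 0 := by omega
    simp only [hV, opD, e2, pz, ellP]; simp [this]
  have V3 : V (2*k-1) = po (2*k+1) (2*k) := by
    have : k ≠ 0 := by omega
    have : 2 * k - 1 ≠ 0 := by omega
    simp only [hV, opD, po, erP, ellP]; simp [*]; ring
  rw [← V2, ← V3]
  exact Wr_rel isOpen_rhp hM (E 0) V v (fun j => (h j).diff 0) hv hrel V1

noncomputable def Pk (k : ℕ) : ℂ[X] := X ^ k * ∏ i ∈ Finset.range (k+1), (X + C ((2 * (i:ℂ) + 1)^2))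

lemma Pk_ne {k : ℕ} (v : ℂ) (hv : 0 < v.re) : (Pk k).eval v ≠ 0 := by
  simp only [Pk, eval_mul, eval_pow, eval_X, eval_prod, eval_add, eval_C]
  refine mul_ne_zero (pow_ne_zero _ ?_) (Finset.prod_ne_zero_iff.2 fun i _ => ?_)
  · rintro rfl; simp at hv
  · intro h
    have := congrArg Complex.re h
    have e : ((2 * (i:ℂ) + 1)^2) = (((2 * (i:ℝ) + 1)^2 : ℝ) : ℂ) := by push_cast; ring
    rw [e, Complex.add_re, Complex.ofReal_re, Complex.zero_re] at this
    have : 0 ≤ (2 * (i:ℝ) + 1)^2 := sq_nonneg _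
    linarith

lemma Wr_const {k : ℕ} (hk : 1 ≤ k) (E : ℕ → Fin (2*k) → ℂ → ℂ) (h : ∀ j, SolFam k (fun m => E m j)) :
    ∃ c : ℂ, ∀ v : ℂ, 0 < v.re → Wr (E 0) v * (Pk k).eval v ^ k = c := by
  have hd : ∀ v : ℂ, 0 < v.re → HasDerivAt (fun v => Wr (E 0) v * (Pk k).eval v ^ k) 0 v := by
    intro v hv
    obtain ⟨W', h1, h2⟩ := Wr_ode hk E h v hv
    obtain ⟨c, hc, h3⟩ := pz_prod k hk
    have h4 := po_eq_deriv k hk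
    rw [h4, h3] at h2
    rw [show X ^ k * ∏ i ∈ Finset.range (k+1), (X + C ((2 * (i:ℂ) + 1)^2)) = Pk k from rfl] at h2
    simp only [derivative_C_mul, eval_mul, eval_C] at h2
    have h5 : (Pk k).eval v * W' = - k * (derivative (Pk k)).eval v * Wr (E 0) v := by
      apply mul_left_cancel₀ hc
      linear_combination h2
    refine (h1.mul (((Pk k).hasDerivAt v).pow k)).congr_deriv ?_
    obtain ⟨l, rfl⟩ : ∃ l, k = l + 1 := ⟨k - 1, by omega⟩
    simp only [Nat.add_sub_cancel, Pi.pow_apply]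
    push_cast at h5 ⊢
    linear_combination (eval v (Pk (l+1)))^l * h5
  obtain ⟨a, ha⟩ := isOpen_rhp.exists_is_const_of_deriv_eq_zero (convex_halfSpace_re_gt 0).isPreconnected
    (f := fun v => Wr (E 0) v * (Pk k).eval v ^ k) (fun v hv => (hd v hv).differentiableAt.differentiableWithinAt) (fun v hv => (hd v hv).deriv)
  exact ⟨a, ha⟩

lemma det_E_eq {k : ℕ} (E : ℕ → Fin (2*k) → ℂ → ℂ) (h : ∀ j, SolFam k (fun m => E m j)) (v : ℂ) (hv : 0 < v.re) :
    (Matrix.of fun m j : Fin (2*k) => E m j v).det = (∏ m : Fin (2*k), (ellP (2*k+1) m).eval v) * Wr (E 0) v := by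
  have e : (Matrix.of fun m j : Fin (2*k) => E m j v) =
     (Matrix.of fun m i : Fin (2*k) => (Qf (2*k+1) m i).eval v) * (Matrix.of fun i j : Fin (2*k) => iteratedDeriv (i:ℕ) (E 0 j) v) := by
    ext m j
    rw [Matrix.mul_apply, Matrix.of_apply, (h j).eq_app m (by omega) v hv, appQ, Finset.sum_range_succ, Finset.sum_range_succ,
      Qf_zero_of_lt _ _ _ (by omega), Qf_zero_of_lt _ _ _ (by omega), Finset.sum_range]
    simp
  rw [e, Matrix.det_mul, Matrix.det_of_lowerTriangular]
  · rfl
  · intro i j hij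
    have : i < j := hij
    simp only [Matrix.of_apply]
    rw [Qf_zero_of_lt _ _ _ (by exact_mod_cast this), eval_zero]

lemma Pk_tendsto (k : ℕ) : Tendsto (fun v : ℝ => (Pk k).eval (v:ℂ) / (v:ℂ)^(2*k+1)) atTop (nhds 1) := by
  have hz : Tendsto (fun v : ℝ => ((v:ℂ))⁻¹) atTop (nhds 0) := by
    have := (Complex.continuous_ofReal.tendsto 0).comp tendsto_inv_atTop_zero
    simpa [Function.comp_def] using this
  have h1 : Tendsto (fun v : ℝ => ∏ i ∈ Finset.range (k+1), (1 + (2 * (i:ℂ) + 1)^2 * (v:ℂ)⁻¹)) atTop (nhds (∏ i ∈ Finset.range (k+1), (1 + (2 * (i:ℂ) + 1)^2 * 0))) :=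
    tendsto_finset_prod _ fun i _ => (hz.const_mul _).const_add _
  simp only [mul_zero, add_zero, Finset.prod_const_one] at h1
  refine h1.congr' ?_
  filter_upwards [eventually_gt_atTop 0] with v hv
  have hv' : (v:ℂ) ≠ 0 := by exact_mod_cast hv.ne'
  simp only [Pk, eval_mul, eval_pow, eval_X, eval_prod, eval_add, eval_C]
  rw [show 2 * k + 1 = k + (k+1) by ring, pow_add, mul_div_mul_left _ _ (pow_ne_zero _ hv')]
  nth_rw 3 [← Finset.card_range (k+1)]
  rw [← Finset.prod_const, ← Finset.prod_div_distrib]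
  refine Finset.prod_congr rfl fun i _ => ?_
  field_simp

lemma Wr_value {k : ℕ} (hk : 1 ≤ k) (E : ℕ → Fin (2*k) → ℂ → ℂ) (h : ∀ j, SolFam k (fun m => E m j)) (c : ℂ)
    (hc : Tendsto (fun v : ℝ => (Matrix.of fun m j : Fin (2*k) => (v:ℂ) * E m j v).det) atTop (nhds c))
    (v : ℂ) (hv : 0 < v.re) :
    (∏ m ∈ Finset.range (2*k), ((-2:ℂ)^m / m.factorial)) * (Wr (E 0) v * (Pk k).eval v ^ k) = c := by
  obtain ⟨a, ha⟩ := Wr_const hk E h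
  rw [ha v hv]
  have h1 : Tendsto (fun v : ℝ => ∏ m ∈ Finset.range (2*k), (ellP (2*k+1) m).eval (v:ℂ) / (v:ℂ)^m) atTop
    (nhds (∏ m ∈ Finset.range (2*k), ((-2:ℂ)^m / m.factorial))) := tendsto_finset_prod _ fun i _ => ellP_tendsto _ _
  have h2 := (h1.mul_const a)
  have h3 := (hc.mul ((Pk_tendsto k).pow k))
  rw [one_pow, mul_one] at h3
  refine tendsto_nhds_unique h2 (h3.congr' ?_)
  filter_upwards [eventually_gt_atTop 0] with v hv
  have hv' : (v:ℂ) ≠ 0 := by exact_mod_cast hv.ne'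
  rw [← ha v (by simpa using hv)]
  have e : (Matrix.of fun m j : Fin (2*k) => (v:ℂ) * E m j v) = (v:ℂ) • (Matrix.of fun m j : Fin (2*k) => E m j v) := by
    ext; simp
  rw [e, Matrix.det_smul, Fintype.card_fin, det_E_eq E h v (by simpa using hv), Finset.prod_div_distrib, Finset.prod_range,
    Finset.prod_pow_eq_pow_sum, Finset.sum_range_id]
  have e2 : 2 * k * (2 * k - 1) / 2 = k * (2 * k - 1) := by
    rw [mul_assoc, Nat.mul_div_cancel_left _ (by norm_num)]
  rw [e2, div_pow, ← pow_mul, show (2 * k + 1) * k = 2 * k + k * (2 * k - 1) by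
    obtain ⟨l, rfl⟩ : ∃ l, k = l + 1 := ⟨k - 1, by omega⟩
    rw [show 2 * (l+1) - 1 = 2 * l + 1 by omega]; ring, pow_add]
  field_simp


namespace BW

noncomputable def al : ℂ[X] := X + C Complex.I
noncomputable def be : ℂ[X] := X - C Complex.I

lemma al_sub_be : al - be = C (2 * Complex.I) := by
  simp only [al, be, C_mul]; rw [show (C (2:ℂ)) = 2 from rfl]; ring

lemma sum_T {R : Type*} [CommRing R] (a b : R) (N : ℕ) :
    (a - b) * ∑ i ∈ Finset.range N, ((i:R) + 1) * (a^i * b^(N-1-i)) =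
      N * a^N - b * ∑ i ∈ Finset.range N, a^i * b^(N-1-i) := by
  induction N with
  | zero => simp
  | succ N ih =>
    have e1 : ∑ i ∈ Finset.range N, ((i:R) + 1) * (a^i * b^(N+1-1-i)) = b * ∑ i ∈ Finset.range N, ((i:R) + 1) * (a^i * b^(N-1-i)) := by
      rw [Finset.mul_sum]
      refine Finset.sum_congr rfl fun i hi => ?_
      have := Finset.mem_range.1 hi
      rw [show N + 1 - 1 - i = (N - 1 - i) + 1 by omega, pow_succ]; ring
    have e2 : ∑ i ∈ Finset.range N, (a^i * b^(N+1-1-i)) = b * ∑ i ∈ Finset.range N, (a^i * b^(N-1-i)) := by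
      rw [Finset.mul_sum]
      refine Finset.sum_congr rfl fun i hi => ?_
      have := Finset.mem_range.1 hi
      rw [show N + 1 - 1 - i = (N - 1 - i) + 1 by omega, pow_succ]; ring
    rw [Finset.sum_range_succ, Finset.sum_range_succ, e1, e2]
    simp only [Nat.add_sub_cancel, Nat.sub_self, pow_zero, mul_one]
    push_cast
    linear_combination b * ih

lemma sum_S {R : Type*} [CommRing R] (a b : R) (N : ℕ) :
    (a - b) * ∑ i ∈ Finset.range N, a^i * b^(N-1-i) = a^N - b^N := by
  rw [mul_comm]; exact Commute.geom_sum₂_mul (Commute.all a b) N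

/-- The column polynomials (without the power of pi). -/
noncomputable def pcol (k c : ℕ) : ℂ[X] :=
  if c = 0 then C (1 / (2 * ((k:ℂ)+1) * Complex.I)) * (al^(2*k+1) - be^(2*k+1) - C (2 * Complex.I * (2*k+1)) * al^(2*k))
  else if c ≤ k then C (2^c / Complex.I) * (al^(2*k+1-c) - be^(2*k+1-c))
  else C (-2^(c+1-k)) * al^(3*k-c)

noncomputable def mb (k i : ℕ) : ℂ[X] := al^i * be^(2*k-1-i)

noncomputable def qcol (k r : ℕ) : ℂ[X] :=
  if r = 0 then ∑ i ∈ Finset.range (2*k), C (4 * ((i:ℂ) - k)) * mb k i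
  else if r = 1 then ∑ i ∈ Finset.range (2*k), mb k i
  else if r ≤ k then be^(2*k+1-r)
  else al^(3*k-r)

noncomputable def Mf (k i r : ℕ) : ℂ :=
  if r = 0 then 4 * ((i:ℂ) - k)
  else if r = 1 then 1
  else if r ≤ k then ((2*Complex.I)^(r-2))⁻¹ * ((r-2).choose i) * (-1)^(r-2-i)
  else ((2*Complex.I)^(r-k-1))⁻¹ * ((r-k-1).choose (2*k-1-i)) * (-1)^(2*k-1-i)

noncomputable def Vf (k r c : ℕ) : ℂ :=
  if c = 0 then (if r = 0 then 1 / (2 * ((k:ℂ)+1) * Complex.I) else if r = 1 then 4 * (k+1) * (1 / (2 * ((k:ℂ)+1) * Complex.I)) else 0)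
  else if c = 1 then (if r = 1 then 4 else 0)
  else if c ≤ k then (if r = c then -(2^c / Complex.I) else if r = c + k - 1 then 2^c / Complex.I else 0)
  else (if r = c then -2^(c+1-k) else 0)

lemma qcol_eq (k r : ℕ) (hr : r < 2*k) : qcol k r = ∑ i ∈ Finset.range (2*k), C (Mf k i r) * mb k i := by
  have hI : (2*Complex.I) ≠ 0 := by simp
  unfold qcol Mf
  split_ifs with h0 h1 h2
  · rfl
  · simp
  · obtain ⟨t, rfl⟩ : ∃ t, r = t + 2 := ⟨r-2, by omega⟩
    simp only [Nat.add_sub_cancel]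
    have e : (2*k) = (t+1) + (2*k - 1 - t) := by omega
    rw [e, Finset.sum_range_add, ← e]
    rw [Finset.sum_eq_zero (s := Finset.range (2*k-1-t))]
    · have h := add_pow al (-be) t
      rw [← sub_eq_add_neg, al_sub_be] at h
      rw [add_zero]
      have h2 : be^(2*k+1-(t+2)) = C (((2*Complex.I)^t)⁻¹) * (C (2*Complex.I)^t * be^(2*k+1-(t+2))) := by
        rw [← mul_assoc, ← C_pow, ← C_mul, inv_mul_cancel₀ (pow_ne_zero _ hI)]; simp
      rw [h2, h, Finset.sum_mul, Finset.mul_sum]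
      refine Finset.sum_congr rfl fun i hi => ?_
      have := Finset.mem_range.1 hi
      rw [mb, show 2*k-1-i = (t-i) + (2*k+1-(t+2)) by omega, pow_add, neg_pow be]
      simp only [C_mul, C_pow, C_neg, C_1, Polynomial.C_eq_natCast]
      ring
    · intro i _
      rw [Nat.choose_eq_zero_of_lt (by omega)]; simp
  · obtain ⟨t, rfl⟩ : ∃ t, r = t + k + 1 := ⟨r-k-1, by omega⟩
    simp only [show t + k + 1 - k - 1 = t by omega]
    rw [← Finset.sum_range_reflect]
    have e : (2*k) = (t+1) + (2*k - 1 - t) := by omega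
    rw [e, Finset.sum_range_add, ← e]
    rw [Finset.sum_eq_zero (s := Finset.range (2*k-1-t))]
    · have h := add_pow (-be) al t
      rw [add_comm, ← sub_eq_add_neg, al_sub_be] at h
      rw [add_zero]
      have h2 : al^(3*k-(t+k+1)) = C (((2*Complex.I)^t)⁻¹) * (C (2*Complex.I)^t * al^(3*k-(t+k+1))) := by
        rw [← mul_assoc, ← C_pow, ← C_mul, inv_mul_cancel₀ (pow_ne_zero _ hI)]; simp
      rw [h2, h, Finset.sum_mul, Finset.mul_sum]
      refine Finset.sum_congr rfl fun i hi => ?_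
      have := Finset.mem_range.1 hi
      rw [mb, show 2*k-1-(2*k-1-i) = i by omega, show 2*k-1-i = (t-i) + (3*k-(t+k+1)) by omega, pow_add, neg_pow be]
      simp only [C_mul, C_pow, C_neg, C_1, Polynomial.C_eq_natCast]
      ring
    · intro i hi
      have := Finset.mem_range.1 hi
      rw [Nat.choose_eq_zero_of_lt (by omega)]; simp

lemma pcol_eq (k c : ℕ) (hk : 1 ≤ k) (hc : c < 2*k) : pcol k c = ∑ r ∈ Finset.range (2*k), C (Vf k r c) * qcol k r := by
  have hI : Complex.I ≠ 0 := Complex.I_ne_zero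
  have hII : (C Complex.I : ℂ[X])^2 = -1 := by rw [← C_pow, Complex.I_sq]; simp
  unfold pcol Vf
  split_ifs with h0 h1 h2
  · rw [show 2*k = (2*k-2) + 1 + 1 by omega, Finset.sum_range_succ', Finset.sum_range_succ',
      Finset.sum_eq_zero]
    swap
    · intro i _; simp
    rw [show (2*k-2) + 1 + 1 = 2*k by omega]
    simp only [zero_add, one_ne_zero, if_true, if_false, qcol]
    have hS := sum_S al be (2*k)
    have hT := sum_T al be (2*k)
    rw [al_sub_be] at hS hT
    have e : ∑ i ∈ Finset.range (2*k), C (4 * ((i:ℂ) - k)) * mb k i = 4 * ∑ i ∈ Finset.range (2*k), ((i:ℂ[X]) + 1) * (al^i * be^(2*k-1-i)) - 4 * (k+1) * ∑ i ∈ Finset.range (2*k), al^i * be^(2*k-1-i) := by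
      rw [Finset.mul_sum, Finset.mul_sum, ← Finset.sum_sub_distrib]
      refine Finset.sum_congr rfl fun i _ => ?_
      simp only [mb, C_mul, C_sub, Polynomial.C_eq_natCast]
      rw [show (C (4:ℂ)) = 4 from rfl]
      ring
    rw [e]
    simp only [mb]
    set S := ∑ i ∈ Finset.range (2*k), al^i * be^(2*k-1-i)
    set T := ∑ i ∈ Finset.range (2*k), ((i:ℂ[X]) + 1) * (al^i * be^(2*k-1-i))
    have hab : al = be + 2 * C Complex.I := by rw [← sub_eq_iff_eq_add', al_sub_be, C_mul]; rfl
    simp only [C_mul, C_add, Polynomial.C_eq_natCast, C_1] at hS hT ⊢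
    rw [show (C (2:ℂ)) = 2 from rfl, show (C (4:ℂ)) = 4 from rfl] at *
    push_cast at hT ⊢
    have key : al^(2*k+1) - be^(2*k+1) - 2 * C Complex.I * (2 * k + 1) * al^(2*k) = 4 * T := by
      rw [pow_succ, pow_succ]
      linear_combination (al^(2*k)) * hab + 2 * C Complex.I * hT - be * hS - 4 * T * hII
    rw [key]; ring
  · · subst h2
      rw [Finset.sum_eq_single 1]
      · simp only [one_ne_zero, if_true, if_false, qcol]
        have hS := sum_S al be (2*k)
        rw [al_sub_be] at hS
        simp only [mb, Nat.add_sub_cancel]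
        rw [← hS, ← mul_assoc, ← C_mul]
        congr 2
        field_simp; norm_num
      · intro i _ hi; simp [hi]
      · intro h; simp at h; omega
  · have hc1 := h2
    · rw [Finset.sum_eq_add (c) (c+k-1)]
      · simp only [if_true]
        rw [if_neg (show c + k - 1 ≠ c by omega)]
        simp only [qcol]
        rw [if_neg (by omega), if_neg (by omega), if_pos (by omega), if_neg (by omega), if_neg (by omega), if_neg (by omega),
          show 3*k-(c+k-1) = 2*k+1-c by omega]
        simp only [C_neg]
        ring
      · omega
      · intro i _ hi; simp [hi]
      · intro h; simp at h; omega
      · intro h; simp at h; omega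
  · omega
  · rw [Finset.sum_eq_single c]
    · have : c ≠ 1 := by omega
      simp only [this, if_true, if_false, qcol, h0, h1]
    · intro i _ hi
      simp [hi]
    · intro h; simp at h; omega

lemma mb_natDegree (k i : ℕ) (hi : i < 2*k) : (mb k i).natDegree < 2*k := by
  have h1 : al.natDegree ≤ 1 := by unfold al; compute_degree
  have h2 : be.natDegree ≤ 1 := by unfold be; compute_degree
  have h3 := natDegree_pow_le_of_le i h1
  have h4 := natDegree_pow_le_of_le (2*k-1-i) h2
  have := natDegree_mul_le_of_le h3 h4
  unfold mb
  omega

lemma pcol_coeff (k c : ℕ) (hk : 1 ≤ k) (hc : c < 2*k) (j : ℕ) :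
    (pcol k c).coeff j = ∑ r ∈ Finset.range (2*k), ∑ i ∈ Finset.range (2*k), (mb k i).coeff j * Mf k i r * Vf k r c := by
  rw [pcol_eq k c hk hc, finsetSum_coeff]
  refine Finset.sum_congr rfl fun r hr => ?_
  rw [qcol_eq k r (Finset.mem_range.1 hr), coeff_C_mul, finsetSum_coeff, Finset.mul_sum]
  refine Finset.sum_congr rfl fun i _ => ?_
  rw [coeff_C_mul]; ring

lemma pcol_coeff_zero (k c : ℕ) (hk : 1 ≤ k) (hc : c < 2*k) (j : ℕ) (hj : 2*k ≤ j) :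
    (pcol k c).coeff j = 0 := by
  rw [pcol_coeff k c hk hc]
  refine Finset.sum_eq_zero fun r _ => Finset.sum_eq_zero fun i hi => ?_
  rw [coeff_eq_zero_of_natDegree_lt (lt_of_lt_of_le (mb_natDegree k i (Finset.mem_range.1 hi)) hj)]; simp

lemma det_mb (k : ℕ) : (Matrix.of fun j i : Fin (2*k) => (mb k i).coeff j).det = (-2*Complex.I)^(k*(2*k-1)) := by
  set x : Fin (2*k) → ℂ := fun l => ((l:ℕ):ℂ)
  have h : Matrix.vandermonde x * (Matrix.of fun j i : Fin (2*k) => (mb k i).coeff j) =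
      Matrix.projVandermonde (fun l => x l + Complex.I) (fun l => x l - Complex.I) := by
    ext l i
    rw [Matrix.mul_apply, Matrix.projVandermonde_apply]
    have := eval_eq_sum_range' (mb_natDegree k i i.2) (x l)
    rw [Finset.sum_range] at this
    simp only [Matrix.vandermonde_apply, Matrix.of_apply]
    rw [Finset.sum_congr rfl (fun j _ => mul_comm _ _), ← this]
    simp only [mb, al, be, eval_mul, eval_pow, eval_add, eval_sub, eval_X, eval_C, Fin.val_rev]
    congr 2; omega
  have h2 := congrArg Matrix.det h
  rw [Matrix.det_mul, Matrix.det_vandermonde, Matrix.det_projVandermonde] at h2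
  have h3 : ∀ i j, (x j + Complex.I) * (x i - Complex.I) - (x i + Complex.I) * (x j - Complex.I) = (-2*Complex.I) * (x j - x i) := by
    intro i j; ring
  have h6 : ∀ (c : ℂ), c = -2 * Complex.I → (∏ i : Fin (2*k), ∏ j ∈ Finset.Ioi i, (c * (x j - x i))) = (∏ i : Fin (2*k), c ^ (Finset.Ioi i).card) * ∏ i : Fin (2*k), ∏ j ∈ Finset.Ioi i, (x j - x i) := by
    intro c _
    simp only [Finset.prod_mul_distrib, Finset.prod_const]
  simp only [h3] at h2
  rw [h6 _ rfl] at h2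
  have h4 : (∏ i : Fin (2*k), ∏ j ∈ Finset.Ioi i, (x j - x i)) ≠ 0 := by
    refine Finset.prod_ne_zero_iff.2 fun i _ => Finset.prod_ne_zero_iff.2 fun j hj => ?_
    have := Finset.mem_Ioi.1 hj
    simp only [x, sub_ne_zero]
    intro h
    have := Nat.cast_injective h
    omega
  rw [mul_comm] at h2
  have h5 := mul_right_cancel₀ h4 h2
  rw [h5, Finset.prod_pow_eq_pow_sum]
  congr 1
  simp only [Fin.card_Ioi]
  rw [← Finset.sum_range (fun i => 2*k-1-i), Finset.sum_range_reflect (fun i => i), Finset.sum_range_id, mul_assoc,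
    Nat.mul_div_cancel_left _ (by norm_num)]

end BW


namespace BW

lemma det_Vf (l : ℕ) : (Matrix.of fun r c : Fin (2*(l+1)) => Vf (l+1) r c).det =
    (2 / (((l:ℂ)+2) * Complex.I)) * ∏ t ∈ Finset.range l, ((4:ℂ)^(t+2) / Complex.I) := by
  rw [Matrix.det_of_lowerTriangular]
  · simp only [Matrix.of_apply]
    rw [← Finset.prod_range (fun i => Vf (l+1) i i), show 2*(l+1) = 2 + l + l by ring, Finset.prod_range_add, Finset.prod_range_add,
      mul_assoc, ← Finset.prod_mul_distrib]
    congr 1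
    · rw [Finset.prod_range_succ, Finset.prod_range_one]
      simp only [Vf]
      have : (l:ℂ) + 2 ≠ 0 := by exact_mod_cast (by omega : l + 2 ≠ 0)
      have : (l:ℂ) + 1 + 1 ≠ 0 := by exact_mod_cast (by omega : l + 1 + 1 ≠ 0)
      simp
      field_simp
      norm_num; ring
    · refine Finset.prod_congr rfl fun t ht => ?_
      have := Finset.mem_range.1 ht
      unfold Vf
      rw [if_neg (by omega), if_neg (by omega), if_pos (by omega), if_pos rfl, if_neg (by omega), if_neg (by omega), if_neg (by omega), if_pos rfl,
        show 2 + l + t + 1 - (l+1) = t + 2 by omega, show (4:ℂ) = 2 * 2 by norm_num, mul_pow, add_comm 2 t]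
      ring
  · intro i j hij
    have hij : i < j := hij
    have : (i:ℕ) < j := hij
    simp only [Matrix.of_apply]
    unfold Vf
    split_ifs <;> first | rfl | omega

def tauF (l p : ℕ) : ℕ := if p < 2*l then p + 2 else p - 2*l
def rhoF (l p : ℕ) : ℕ := if p < l then p else if p < 2*l then 3*l+1-p else if p = 2*l then l else l+1

lemma sign_of_fun {n : ℕ} (σ : Equiv.Perm (Fin n)) (e : Fin n → ℕ)
   (h : ∀ i, (-1 : ℤˣ)^(((Finset.Ioi i).filter (fun j => σ j < σ i)).card) = (-1 : ℤˣ)^(e i)) :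
   σ.sign = ∏ i, (-1 : ℤˣ)^(e i) := by
  rw [Equiv.Perm.sign_eq_prod_prod_Ioi]
  refine Finset.prod_congr rfl fun i _ => ?_
  rw [← h i, Finset.prod_ite, Finset.prod_const_one, one_mul, Finset.prod_const]
  congr 2
  refine Finset.filter_congr fun j hj => ?_
  have h1 := Finset.mem_Ioi.1 hj
  have h2 : σ i ≠ σ j := fun h => h1.ne (σ.injective h)
  constructor
  · intro h; exact lt_of_le_of_ne (not_lt.1 h) h2.symm
  · intro h; exact not_lt.2 h.le

noncomputable def tauP (l : ℕ) : Equiv.Perm (Fin (2*(l+1))) :=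
  Equiv.ofBijective (fun p => ⟨tauF l p, by have := p.2; unfold tauF; split_ifs <;> omega⟩)
   ((Finite.injective_iff_bijective).1 (by
    intro a b h
    simp only [Fin.mk.injEq, tauF] at h
    ext
    have := a.2
    have := b.2
    split_ifs at h <;> omega))

noncomputable def rhoP (l : ℕ) : Equiv.Perm (Fin (2*(l+1))) :=
  Equiv.ofBijective (fun p => ⟨rhoF l p, by have := p.2; unfold rhoF; split_ifs <;> omega⟩)
   ((Finite.injective_iff_bijective).1 (by
    intro a b h
    simp only [Fin.mk.injEq, rhoF] at h
    ext
    have := a.2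
    have := b.2
    split_ifs at h <;> omega))

lemma tauP_val (l : ℕ) (p) : ((tauP l p : Fin _) : ℕ) = tauF l p := rfl
lemma rhoP_val (l : ℕ) (p) : ((rhoP l p : Fin _) : ℕ) = rhoF l p := rfl

lemma sign_tau (l : ℕ) : (tauP l).sign = 1 := by
  rw [sign_of_fun (tauP l) (fun _ => 0)]
  · simp
  intro i
  by_cases hi : (i:ℕ) < 2*l
  · have : (Finset.Ioi i).filter (fun j => tauP l j < tauP l i) = {⟨2*l, by omega⟩, ⟨2*l+1, by omega⟩} := by
      ext j
      simp only [Finset.mem_filter, Finset.mem_Ioi, Finset.mem_insert, Finset.mem_singleton, Fin.lt_def, tauP_val, Fin.ext_iff, tauF]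
      have := j.2
      split_ifs <;> omega
    rw [this, Finset.card_pair (by simp)]; simp
  · have : (Finset.Ioi i).filter (fun j => tauP l j < tauP l i) = ∅ := by
      refine Finset.filter_eq_empty_iff.2 fun j hj => ?_
      have h := Finset.mem_Ioi.1 hj
      have := j.2
      rw [Fin.lt_def] at h
      simp only [Fin.lt_def, tauP_val, tauF]
      split_ifs <;> omega
    rw [this]; simp

lemma sign_rho (l : ℕ) : (rhoP l).sign = ∏ i : Fin (2*(l+1)), (-1 : ℤˣ)^(if (i:ℕ) < l then 0 else if (i:ℕ) < 2*l then 2*l+1-i else 0) := by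
  rw [sign_of_fun (rhoP l) (fun i => (if (i:ℕ) < l then 0 else if (i:ℕ) < 2*l then 2*l+1-i else 0))]
  intro i
  split_ifs with h1 h2
  · have : (Finset.Ioi i).filter (fun j => rhoP l j < rhoP l i) = ∅ := by
      refine Finset.filter_eq_empty_iff.2 fun j hj => ?_
      have h := Finset.mem_Ioi.1 hj
      have := j.2
      rw [Fin.lt_def] at h
      simp only [Fin.lt_def, rhoP_val, rhoF]
      split_ifs <;> omega
    rw [this]; simp
  · have : (Finset.Ioi i).filter (fun j => rhoP l j < rhoP l i) = Finset.Ioi i := by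
      refine Finset.filter_true_of_mem fun j hj => ?_
      have h := Finset.mem_Ioi.1 hj
      have := j.2
      rw [Fin.lt_def] at h
      simp only [Fin.lt_def, rhoP_val, rhoF]
      split_ifs <;> omega
    rw [this, Fin.card_Ioi]
    congr 1
  · have : (Finset.Ioi i).filter (fun j => rhoP l j < rhoP l i) = ∅ := by
      refine Finset.filter_eq_empty_iff.2 fun j hj => ?_
      have h := Finset.mem_Ioi.1 hj
      have := j.2
      rw [Fin.lt_def] at h
      simp only [Fin.lt_def, rhoP_val, rhoF]
      split_ifs <;> omega
    rw [this]; simp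

lemma det_Mf (l : ℕ) : (Matrix.of fun i r : Fin (2*(l+1)) => Mf (l+1) i r).det =
    -4 * ∏ t ∈ Finset.range l, ((-4:ℂ)^t)⁻¹ := by
  set M := (Matrix.of fun i r : Fin (2*(l+1)) => Mf (l+1) i r)
  have h1 : (M.submatrix (rhoP l) (tauP l)).det = ((rhoP l).sign : ℤ) * M.det := by
    have : M.submatrix (rhoP l) (tauP l) = (M.submatrix (rhoP l) id).submatrix id (tauP l) := rfl
    rw [this, Matrix.det_permute', Matrix.det_permute, sign_tau]; simp
  have h2 : (M.submatrix (rhoP l) (tauP l)).det = ∏ p ∈ Finset.range (2*(l+1)), Mf (l+1) (rhoF l p) (tauF l p) := by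
    rw [Matrix.det_of_upperTriangular, Finset.prod_range]
    · rfl
    · intro i j hij
      have hij : j < i := hij
      have hij : (j:ℕ) < i := hij
      have := i.2
      simp only [Matrix.submatrix_apply, M, Matrix.of_apply, tauP_val, rhoP_val]
      unfold Mf tauF
      by_cases hj : (j:ℕ) < 2*l
      · rw [if_pos hj, if_neg (by omega), if_neg (by omega)]
        by_cases hj2 : (j:ℕ) < l
        · rw [if_pos (by omega), Nat.choose_eq_zero_of_lt]
          · simp
          · unfold rhoF; split_ifs <;> omega
        · rw [if_neg (by omega), Nat.choose_eq_zero_of_lt]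
          · simp
          · unfold rhoF; split_ifs <;> omega
      · have e1 : (j:ℕ) = 2*l := by omega
        have e2 : (i:ℕ) = 2*l+1 := by omega
        rw [if_neg hj, if_pos (by omega), e2]
        unfold rhoF
        rw [if_neg (by omega), if_neg (by omega), if_neg (by omega)]; push_cast; ring
  have h3 : ((((rhoP l).sign : ℤˣ) : ℤ) : ℂ) = ∏ t ∈ Finset.range l, (-1:ℂ)^(l+1-t) := by
    rw [sign_rho, ← Finset.prod_range (fun i => (-1 : ℤˣ)^(if i < l then 0 else if i < 2*l then 2*l+1-i else 0)),
      show 2*(l+1) = l + l + 2 by ring, Finset.prod_range_add, Finset.prod_range_add, Finset.prod_range_succ, Finset.prod_range_one]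
    rw [Finset.prod_eq_one (s := Finset.range l) (f := fun i => (-1 : ℤˣ)^(if i < l then 0 else if i < 2*l then 2*l+1-i else 0))]
    · rw [if_neg (by omega), if_neg (by omega), if_neg (by omega), if_neg (by omega)]
      simp only [pow_zero, mul_one, one_mul]
      push_cast
      refine Finset.prod_congr rfl fun t ht => ?_
      have := Finset.mem_range.1 ht
      rw [if_neg (by omega), if_pos (by omega)]
      congr 1; omega
    · intro i hi
      rw [if_pos (Finset.mem_range.1 hi)]; simp
  have h4 : ∏ p ∈ Finset.range (2*(l+1)), Mf (l+1) (rhoF l p) (tauF l p) = -4 * ∏ t ∈ Finset.range l, (((-4:ℂ)^t)⁻¹ * (-1)^t) := by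
    rw [show 2*(l+1) = l + l + 2 by ring, Finset.prod_range_add, Finset.prod_range_add, Finset.prod_range_succ, Finset.prod_range_one,
      ← Finset.prod_mul_distrib, mul_comm]
    congr 1
    · have e1 : rhoF l (l + l + 0) = l := by unfold rhoF; split_ifs <;> omega
      have e2 : tauF l (l + l + 0) = 0 := by unfold tauF; split_ifs <;> omega
      have e3 : tauF l (l + l + 1) = 1 := by unfold tauF; split_ifs <;> omega
      rw [e1, e2, e3]
      simp [Mf]
    · refine Finset.prod_congr rfl fun t ht => ?_
      have := Finset.mem_range.1 ht
      unfold Mf tauF rhoF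
      simp only [show t < 2*l by omega, show t < l by omega, show l + t < 2*l by omega, show ¬ (l + t < l) by omega, if_true, if_false]
      rw [if_neg (by omega), if_neg (by omega), if_pos (by omega), if_neg (by omega), if_neg (by omega), if_neg (by omega)]
      rw [show t + 2 - 2 = t by omega, show l + t + 2 - (l+1) - 1 = t by omega, show 2*(l+1) - 1 - (3*l+1-(l+t)) = t by omega]
      simp only [Nat.choose_self, Nat.sub_self, pow_zero, Nat.cast_one, mul_one]
      rw [← mul_assoc, ← mul_inv, ← mul_pow, show (2 * Complex.I * (2 * Complex.I)) = -4 by linear_combination 4 * Complex.I_mul_I]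
  rw [h1, h3] at h2
  rw [h4] at h2
  have h5 : (∏ t ∈ Finset.range l, (-1:ℂ)^(l+1-t)) * (∏ t ∈ Finset.range l, (-1:ℂ)^t) = 1 := by
    rw [← Finset.prod_mul_distrib, Finset.prod_congr rfl (g := fun _ => (-1:ℂ)^(l+1)), Finset.prod_const, Finset.card_range, ← pow_mul]
    · exact Even.neg_one_pow (by rw [mul_comm]; exact Nat.even_mul_succ_self l)
    · intro t ht
      have := Finset.mem_range.1 ht
      rw [← pow_add]; congr 1; omega
  have h6 : (∏ t ∈ Finset.range l, (-1:ℂ)^t) * (∏ t ∈ Finset.range l, (-1:ℂ)^t) = 1 := by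
    rw [← Finset.prod_mul_distrib]
    refine Finset.prod_eq_one fun t _ => ?_
    rw [← mul_pow]; simp
  rw [Finset.prod_mul_distrib] at h2
  linear_combination (∏ t ∈ Finset.range l, (-1:ℂ)^t) * h2 - M.det * h5 - 4 * (∏ t ∈ Finset.range l, ((-4:ℂ)^t)⁻¹) * h6

lemma phase (l : ℕ) : (-8 / (((l:ℂ)+2) * Complex.I)) * (∏ t ∈ Finset.range l, (((-4:ℂ)^t)⁻¹ * ((4:ℂ)^(t+2) / Complex.I))) * (-2*Complex.I)^((l+1)*(2*l+1)) * ((2:ℂ)^(2*(l+1)*(2*l+3)))⁻¹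
   = (-1)^((l+1)*l/2) / (2 * ((l:ℂ)+2) * 2^((2*l+1)*(l+1))) := by
  have h1 : ∀ t : ℕ, ((-4:ℂ)^t)⁻¹ * ((4:ℂ)^(t+2) / Complex.I) = (-16 * Complex.I) * (-1)^t := by
    intro t
    rw [show (-4:ℂ) = (-1) * 4 by norm_num, mul_pow, pow_add, div_eq_mul_inv, Complex.inv_I, mul_inv, ← inv_pow (-1:ℂ), show ((-1:ℂ)⁻¹) = -1 by norm_num]
    have : (4:ℂ)^t ≠ 0 := pow_ne_zero _ (by norm_num)
    field_simp; norm_num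
  simp only [h1]
  have hl : (l:ℂ) + 2 ≠ 0 := by exact_mod_cast (by omega : l + 2 ≠ 0)
  have h3 : (-1:ℂ)^((l+1)*l/2) = ∏ t ∈ Finset.range (l+1), (-1:ℂ)^t := by
    rw [Finset.prod_pow_eq_pow_sum, Finset.sum_range_id]; simp
  rw [h3, Finset.prod_range_succ, Finset.prod_mul_distrib, Finset.prod_const, Finset.card_range]
  set p := ∏ t ∈ Finset.range l, (-1:ℂ)^t
  rw [show (-2*Complex.I)^((l+1)*(2*l+1)) = (2:ℂ)^((l+1)*(2*l+1)) * (-Complex.I)^((l+1)*(2*l+1)) by rw [← mul_pow]; ring_nf,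
    show (-16 * Complex.I)^l = (2:ℂ)^(4*l) * (-Complex.I)^l by rw [pow_mul, ← mul_pow]; norm_num,
    show -8 / (((l:ℂ)+2) * Complex.I) = -((2:ℂ)^3 / ((l:ℂ)+2)) * (-Complex.I)^1 by
      rw [← Complex.inv_I]; field_simp; norm_num]
  have h4 : (-Complex.I)^1 * ((-Complex.I)^l * (-Complex.I)^((l+1)*(2*l+1))) = - (-1)^l := by
    rw [← pow_add, ← pow_add, show 1 + (l + (l+1)*(2*l+1)) = 2 * (l*(l+1) + l + 1) by ring, pow_mul, neg_sq, Complex.I_sq, pow_succ, pow_add,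
      (Nat.even_mul_succ_self l).neg_one_pow]
    ring
  have h5 : (2:ℂ)^3 * 2^(4*l) * 2^((l+1)*(2*l+1)) * (2 * 2^((2*l+1)*(l+1))) = 2^(2*(l+1)*(2*l+3)) := by
    rw [← pow_succ', ← pow_add, ← pow_add, ← pow_add]; congr 1; ring
  have h6 : (2:ℂ)^(2*(l+1)*(2*l+3)) ≠ 0 := pow_ne_zero _ (by norm_num)
  have h7 : (2:ℂ)^((2*l+1)*(l+1)) ≠ 0 := pow_ne_zero _ (by norm_num)
  rw [eq_div_iff (mul_ne_zero (mul_ne_zero two_ne_zero hl) h7), ← div_eq_mul_inv, div_mul_eq_mul_div, div_eq_iff h6, ← h5]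
  field_simp
  linear_combination (-p) * h4

lemma superfac (n : ℕ) : (∏ m ∈ Finset.Icc 1 n, (m:ℝ)^m) * ∏ m ∈ Finset.range (n+1), (m.factorial : ℝ) = (n.factorial : ℝ)^(n+1) := by
  induction n with
  | zero => simp
  | succ n ih =>
    rw [Finset.prod_Icc_succ_top (by omega), Finset.prod_range_succ, Nat.factorial_succ]
    push_cast
    rw [mul_pow, pow_succ ((n.factorial:ℝ)) (n+1), ← ih]
    push_cast
    ring

noncomputable def lam (k : ℕ) : ℝ := ((2 * (k : ℝ) + 1) / (2 * (k + 1)) *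
        ((-1 : ℝ) ^ (k * (k - 1) / 2) / (2 : ℝ) ^ ((2 * k - 1) * k)) *
        ((2 * k + 1).factorial : ℝ) ^ (2 * k) / ∏ n ∈ Finset.Icc 1 (2 * k + 1), (n : ℝ) ^ n)

lemma lam_eq (k : ℕ) : lam k = (-1)^(k*(k-1)/2) / (2 * ((k:ℝ)+1) * 2^((2*k-1)*k)) * ∏ m ∈ Finset.range (2*k), (m.factorial : ℝ) := by
  have h := superfac (2*k+1)
  have h0 : (∏ m ∈ Finset.Icc 1 (2*k+1), (m:ℝ)^m) ≠ 0 := by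
    refine Finset.prod_ne_zero_iff.2 fun i hi => pow_ne_zero _ ?_
    have := (Finset.mem_Icc.1 hi).1
    exact_mod_cast (by omega : i ≠ 0)
  rw [Finset.prod_range_succ, Finset.prod_range_succ, show 2*k+1+1 = 2*k + 2 by ring, pow_add,
    Nat.factorial_succ (2*k)] at h
  have hk1 : (k:ℝ) + 1 ≠ 0 := by positivity
  have hp : (2:ℝ)^((2*k-1)*k) ≠ 0 := by positivity
  have hf : ((2*k).factorial : ℝ) ≠ 0 := by positivity
  unfold lam
  rw [div_eq_iff h0, Nat.factorial_succ (2*k)]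
  set A := (∏ m ∈ Finset.Icc 1 (2*k+1), (m:ℝ)^m)
  set B := ∏ m ∈ Finset.range (2*k), (m.factorial : ℝ)
  have hk2 : (2*(k:ℝ)+1) ≠ 0 := by positivity
  push_cast at h ⊢
  have h2 : A * B = ((2*(k:ℝ)+1) * ((2*k).factorial:ℝ))^(2*k) * (2*(k:ℝ)+1) := by
    have h3 : ((2*k).factorial:ℝ)^2 * (2*(k:ℝ)+1) ≠ 0 := by positivity
    apply mul_right_cancel₀ h3
    linear_combination h
  field_simp
  linear_combination -h2

lemma pcol_det (k : ℕ) (hk : 1 ≤ k) :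
    (Matrix.of fun j c : Fin (2*k) => (pcol k c).coeff j).det * ∏ m ∈ Finset.range (2*k), ((m.factorial : ℂ) / 2^(2*k+1)) = (lam k : ℂ) := by
  have h1 : (Matrix.of fun j c : Fin (2*k) => (pcol k c).coeff j) = (Matrix.of fun j i : Fin (2*k) => (mb k i).coeff j)
     * (Matrix.of fun i r : Fin (2*k) => Mf k i r) * (Matrix.of fun r c : Fin (2*k) => Vf k r c) := by
    ext j c
    simp only [Matrix.mul_apply, Matrix.of_apply]
    rw [pcol_coeff k c hk c.2, Finset.sum_range]
    refine Finset.sum_congr rfl fun r _ => ?_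
    rw [Finset.sum_range, Finset.sum_mul]
  obtain ⟨l, rfl⟩ : ∃ l, k = l + 1 := ⟨k-1, by omega⟩
  rw [h1, Matrix.det_mul, Matrix.det_mul, det_mb, det_Mf, det_Vf, lam_eq]
  have h3 : ∏ m ∈ Finset.range (2*(l+1)), ((m.factorial : ℂ) / 2^(2*(l+1)+1)) = (∏ m ∈ Finset.range (2*(l+1)), (m.factorial : ℂ)) / (2^(2*(l+1)+1))^(2*(l+1)) := by
    rw [Finset.prod_div_distrib, Finset.prod_const, Finset.card_range]
  rw [h3]
  have h2 := phase l
  rw [Finset.prod_mul_distrib] at h2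
  push_cast
  rw [show 2*(l+1) - 1 = 2*l+1 by omega, show (l:ℂ) + 1 + 1 = l + 2 by ring, ← h2, ← pow_mul,
    show (2*(l+1)+1)*(2*(l+1)) = 2*(l+1)*(2*l+3) by ring]
  ring

end BW


namespace BW
open MeasureTheory Set Topology

/-- local domination of a holomorphic parametric integrand -/
def LD (μ : Measure ℝ) (F : ℂ → ℝ → ℂ) (v0 : ℂ) : Prop :=
  ∃ R : ℝ, 0 < R ∧ ∃ b : ℝ → ℝ, Integrable b μ ∧ (∀ v ∈ Metric.ball v0 R, AEStronglyMeasurable (F v) μ) ∧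
    ∀ᵐ y ∂μ, DifferentiableOn ℂ (fun v => F v y) (Metric.ball v0 R) ∧ ∀ v ∈ Metric.ball v0 R, ‖F v y‖ ≤ b y

lemma LD.integrable {μ : Measure ℝ} {F : ℂ → ℝ → ℂ} {v0 : ℂ} (h : LD μ F v0) : Integrable (F v0) μ := by
  obtain ⟨R, hR, b, hb, hm, h⟩ := h
  refine hb.mono' (hm v0 (Metric.mem_ball_self hR)) (h.mono fun y hy => hy.2 v0 (Metric.mem_ball_self hR))

lemma LD.eventually {μ : Measure ℝ} {F : ℂ → ℝ → ℂ} {v0 : ℂ} (h : LD μ F v0) : ∀ᶠ v in 𝓝 v0, LD μ F v := by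
  obtain ⟨R, hR, b, hb, hm, h⟩ := h
  filter_upwards [Metric.ball_mem_nhds v0 hR] with v hv
  obtain ⟨r, hr, hs⟩ := Metric.isOpen_iff.1 Metric.isOpen_ball v hv
  exact ⟨r, hr, b, hb, fun w hw => hm w (hs hw), h.mono fun y hy => ⟨hy.1.mono hs, fun w hw => hy.2 w (hs hw)⟩⟩

lemma LD.deriv {μ : Measure ℝ} {F : ℂ → ℝ → ℂ} {v0 : ℂ} (h : LD μ F v0) :
    LD μ (fun v y => deriv (fun v => F v y) v) v0 := by
  obtain ⟨R, hR, b, hb, hm, h⟩ := h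
  refine ⟨R/2, by positivity, fun y => b y / (R/2/2), hb.div_const _, ?_, ?_⟩
  · intro v hv
    have hv : dist v v0 < R/2 := hv
    set t : ℕ → ℂ := fun n => ((R/2/((n:ℝ)+2) : ℝ) : ℂ)
    have ht0 : Tendsto t atTop (𝓝[≠] 0) := by
      rw [tendsto_nhdsWithin_iff]
      constructor
      · have h1 : Tendsto (fun n : ℕ => R/2/((n:ℝ)+2)) atTop (𝓝 0) :=
          Tendsto.div_atTop tendsto_const_nhds (tendsto_atTop_add_const_right _ _ tendsto_natCast_atTop_atTop)
        have := (Complex.continuous_ofReal.tendsto 0).comp h1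
        simpa [t, Function.comp_def] using this
      · refine Eventually.of_forall fun n => ?_
        simp only [t, mem_compl_iff, mem_singleton_iff, Complex.ofReal_eq_zero]
        positivity
    have htb : ∀ n, v + t n ∈ Metric.ball v0 R := by
      intro n
      have : ‖t n‖ < R/2 := by
        simp only [t, Complex.norm_real]
        rw [Real.norm_of_nonneg (by positivity)]
        rw [div_lt_iff₀ (by positivity)]
        nlinarith [Nat.cast_nonneg (α := ℝ) n]
      rw [Metric.mem_ball]
      calc dist (v + t n) v0 ≤ dist (v + t n) v + dist v v0 := dist_triangle _ _ _
        _ < R/2 + R/2 := by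
          refine add_lt_add ?_ hv
          simpa [dist_eq_norm] using this
        _ = R := by ring
    have hvb : v ∈ Metric.ball v0 R := by rw [Metric.mem_ball]; linarith
    refine aestronglyMeasurable_of_tendsto_ae atTop (f := fun n y => (t n)⁻¹ • (F (v + t n) y - F v y)) ?_ ?_
    · intro n
      exact ((hm _ (htb n)).sub (hm _ hvb)).const_smul ((t n)⁻¹)
    · filter_upwards [h] with y hy
      have hd : HasDerivAt (fun v => F v y) (_root_.deriv (fun v => F v y) v) v :=
        ((hy.1 v hvb).differentiableAt (Metric.isOpen_ball.mem_nhds hvb)).hasDerivAt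
      exact (hasDerivAt_iff_tendsto_slope_zero.1 hd).comp ht0
  · filter_upwards [h] with y hy
    refine ⟨(hy.1.deriv Metric.isOpen_ball).mono (Metric.ball_subset_ball (by linarith)), fun v hv => ?_⟩
    have hv : dist v v0 < R/2 := hv
    have hsub : Metric.closedBall v (R/2/2) ⊆ Metric.ball v0 R := by
      intro w hw
      have hw : dist w v ≤ R/2/2 := hw
      rw [Metric.mem_ball]
      linarith [dist_triangle w v v0]
    refine Complex.norm_deriv_le_of_forall_mem_sphere_norm_le (by positivity) ?_ ?_
    · refine DifferentiableOn.diffContOnCl_ball (U := Metric.ball v0 R) hy.1 hsub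
    · intro w hw
      exact hy.2 w (hsub (Metric.sphere_subset_closedBall hw))

lemma LD.hasDerivAt {μ : Measure ℝ} {F : ℂ → ℝ → ℂ} {v0 : ℂ} (h : LD μ F v0) :
    HasDerivAt (fun v => ∫ y, F v y ∂μ) (∫ y, _root_.deriv (fun v => F v y) v0 ∂μ) v0 := by
  have hd := h.deriv
  have hi := h.integrable
  obtain ⟨R, hR, b, hb, hm, h⟩ := h
  obtain ⟨R', hR', b', hb', hm', h'⟩ := hd
  have hs : Metric.ball v0 (min R R') ∈ 𝓝 v0 := Metric.ball_mem_nhds _ (lt_min hR hR')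
  refine (hasDerivAt_integral_of_dominated_loc_of_deriv_le (bound := b') (F' := fun v y => _root_.deriv (fun v => F v y) v) hs ?_ hi (hm' v0 (Metric.mem_ball_self hR')) ?_ hb' ?_).2
  · filter_upwards [Metric.ball_mem_nhds v0 hR] with v hv using hm v hv
  · filter_upwards [h'] with y hy v hv
    exact hy.2 v (Metric.ball_subset_ball (min_le_right _ _) hv)
  · filter_upwards [h] with y hy v hv
    have hv : v ∈ Metric.ball v0 R := Metric.ball_subset_ball (min_le_left _ _) hv
    exact ((hy.1 v hv).differentiableAt (Metric.isOpen_ball.mem_nhds hv)).hasDerivAt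

/-- Polynomially bounded with exponent `α` at zero. -/
def PB (α : ℝ) (g : ℝ → ℂ) : Prop := ∃ C b : ℝ, 0 ≤ C ∧ α ≤ b ∧ ∀ y : ℝ, 0 < y → ‖g y‖ ≤ C * (y^α + y^b)

lemma rpow_between {y a b c : ℝ} (hy : 0 < y) (h1 : a ≤ b) (h2 : b ≤ c) : y^b ≤ y^a + y^c := by
  have ha := Real.rpow_pos_of_pos hy a
  have hc := Real.rpow_pos_of_pos hy c
  rcases le_total y 1 with h | h
  · have := Real.rpow_le_rpow_of_exponent_ge hy h h1; linarith
  · have := Real.rpow_le_rpow_of_exponent_le h h2; linarith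

lemma PB.weaken {α b' : ℝ} {g : ℝ → ℂ} (h : PB α g) : ∃ C b : ℝ, 0 ≤ C ∧ α ≤ b ∧ b' ≤ b ∧ ∀ y : ℝ, 0 < y → ‖g y‖ ≤ C * (y^α + y^b) := by
  obtain ⟨C, b, hC, hab, h⟩ := h
  refine ⟨C * 2, max b b', by positivity, le_trans hab (le_max_left _ _), le_max_right _ _, fun y hy => (h y hy).trans ?_⟩
  have := rpow_between hy hab (le_max_left b b')
  have h3 := Real.rpow_pos_of_pos hy (max b b')
  rw [mul_assoc]
  gcongr
  linarith

lemma PB.mono {α β : ℝ} {g : ℝ → ℂ} (h : PB α g) (hb : β ≤ α) : PB β g := by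
  obtain ⟨C, b, hC, hab, h⟩ := h
  refine ⟨C * 2, b, by positivity, by linarith, fun y hy => (h y hy).trans ?_⟩
  have := rpow_between hy hb hab
  have h3 := Real.rpow_pos_of_pos hy β
  rw [mul_assoc]
  gcongr
  linarith

lemma PB.mul {α β : ℝ} {f g : ℝ → ℂ} (hf : PB α f) (hg : PB β g) : PB (α + β) (fun y => f y * g y) := by
  obtain ⟨C, b, hC, hab, hf⟩ := hf
  obtain ⟨D, d, hD, hbd, hg⟩ := hg
  refine ⟨C * D * 3, b + d, by positivity, by linarith, fun y hy => ?_⟩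
  rw [norm_mul]
  have h1 := rpow_between hy (show α + β ≤ α + d by linarith) (show α + d ≤ b + d by linarith)
  have h2 := rpow_between hy (show α + β ≤ b + β by linarith) (show b + β ≤ b + d by linarith)
  have p1 := Real.rpow_pos_of_pos hy (α + β)
  have p2 := Real.rpow_pos_of_pos hy (b + d)
  calc ‖f y‖ * ‖g y‖ ≤ (C * (y^α + y^b)) * (D * (y^β + y^d)) :=
        mul_le_mul (hf y hy) (hg y hy) (norm_nonneg _) ((norm_nonneg _).trans (hf y hy))
    _ = C * D * (y^(α+β) + y^(α+d) + y^(b+β) + y^(b+d)) := by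
        simp only [Real.rpow_add hy]; ring
    _ ≤ C * D * 3 * (y^(α+β) + y^(b+d)) := by
        rw [mul_assoc (C*D)]
        gcongr
        linarith

lemma PB.add {α : ℝ} {f g : ℝ → ℂ} (hf : PB α f) (hg : PB α g) : PB α (fun y => f y + g y) := by
  obtain ⟨D, d, hD, hbd, hg⟩ := hg
  obtain ⟨C, b, hC, hab, hdb, hf⟩ := hf.weaken (b' := d)
  refine ⟨C + D * 2, b, by positivity, hab, fun y hy => (norm_add_le _ _).trans ?_⟩
  have h1 := rpow_between hy hbd hdb
  have p1 := Real.rpow_pos_of_pos hy b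
  have : D * (y^α + y^d) ≤ D * 2 * (y^α + y^b) := by
    rw [mul_assoc]; gcongr; linarith
  linarith [hf y hy, hg y hy]

lemma PB.const (c : ℂ) : PB 0 (fun _ => c) := ⟨‖c‖, 0, norm_nonneg _, le_rfl, fun y hy => by
  simp only [Real.rpow_zero]; linarith [norm_nonneg c]⟩

lemma PB.const_mul {α : ℝ} {f : ℝ → ℂ} (hf : PB α f) (c : ℂ) : PB α (fun y => c * f y) := by
  have := (PB.const c).mul hf
  rwa [zero_add] at this

lemma PB.sub {α : ℝ} {f g : ℝ → ℂ} (hf : PB α f) (hg : PB α g) : PB α (fun y => f y - g y) := by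
  have := hf.add (hg.const_mul (-1))
  refine this.imp fun C h => ?_
  simpa [sub_eq_add_neg] using h

lemma PB.zero (α : ℝ) : PB α (fun _ => 0) := ⟨0, α, le_rfl, le_rfl, fun y hy => by simp⟩

lemma PB.pow {α : ℝ} {f : ℝ → ℂ} (hf : PB α f) (n : ℕ) : PB (n * α) (fun y => f y ^ n) := by
  induction n with
  | zero => simpa using PB.const 1
  | succ n ih =>
    have := ih.mul hf
    simp only [pow_succ]
    convert this using 1
    push_cast; ring

lemma PB.of_le {α : ℝ} {f : ℝ → ℂ} (C : ℝ) (h : ∀ y : ℝ, 0 < y → ‖f y‖ ≤ C * y^α) : PB α f := by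
  have hC : 0 ≤ C := by have := h 1 one_pos; simp at this; exact (norm_nonneg _).trans this
  refine ⟨C, α, hC, le_rfl, fun y hy => (h y hy).trans ?_⟩
  have p1 := Real.rpow_pos_of_pos hy α
  gcongr; linarith

lemma PB.ypow (m : ℕ) : PB m (fun y => (y:ℂ)^m) := PB.of_le 1 fun y hy => by
  rw [Real.rpow_natCast]; simp [abs_of_pos hy]

lemma PB.congr {α : ℝ} {f g : ℝ → ℂ} (hf : PB α f) (h : ∀ y, 0 < y → g y = f y) : PB α g := by
  obtain ⟨C, b, hC, hab, hf⟩ := hf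
  exact ⟨C, b, hC, hab, fun y hy => by rw [h y hy]; exact hf y hy⟩

lemma integrable_pe {α c : ℝ} (hα : -1 < α) (hc : 0 < c) :
    IntegrableOn (fun y : ℝ => y^α * Real.exp (-c*y)) (Ioi 0) := by
  have := integrableOn_rpow_mul_exp_neg_mul_rpow (p := 1) (s := α) (b := c) hα one_pos hc
  simpa using this

lemma integrable_pe2 {C α b c : ℝ} (hα : -1 < α) (hb : -1 < b) (hc : 0 < c) :
    IntegrableOn (fun y : ℝ => C * (y^α + y^b) * Real.exp (-c*y)) (Ioi 0) := by
  have := ((integrable_pe hα hc).add (integrable_pe hb hc)).const_mul C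
  refine this.congr (Eventually.of_forall fun y => ?_)
  simp only [Pi.add_apply]; ring

lemma tendsto_pe_atTop {C α b c : ℝ} (hc : 0 < c) : Tendsto (fun y : ℝ => C * (y^α + y^b) * Real.exp (-c*y)) atTop (𝓝 0) := by
  have h1 := (tendsto_rpow_mul_exp_neg_mul_atTop_nhds_zero α c hc).add (tendsto_rpow_mul_exp_neg_mul_atTop_nhds_zero b c hc)
  have h2 := h1.const_mul C
  simp only [add_zero, mul_zero] at h2
  refine h2.congr fun y => ?_
  ring

/-- fundamental theorem on the half line with vanishing boundary terms -/
lemma ftc0 {f f' : ℝ → ℂ} (hd : ∀ y : ℝ, 0 < y → HasDerivAt f (f' y) y) (hi : IntegrableOn f' (Ioi 0))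
    {C α b c : ℝ} (hα : 0 < α) (hb : 0 < b) (hc : 0 < c) (hf : ∀ y : ℝ, 0 < y → ‖f y‖ ≤ C * (y^α + y^b) * Real.exp (-c*y)) :
    ∫ y in Ioi (0:ℝ), f' y = 0 := by
  set g : ℝ → ℂ := fun y => if y = 0 then 0 else f y
  have hg : ∀ y : ℝ, 0 ≤ y → ‖g y‖ ≤ C * (y^α + y^b) * Real.exp (-c*y) := by
    intro y hy
    rcases hy.eq_or_lt with rfl | hy
    · simp [g, Real.zero_rpow hα.ne', Real.zero_rpow hb.ne']
    · simp only [g, hy.ne', if_false]; exact hf y hy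
  have h := integral_Ioi_of_hasDerivAt_of_tendsto (f := g) (f' := f') (a := 0) (m := 0) ?_ ?_ hi ?_
  · rw [h]; simp [g]
  · have : g 0 = 0 := by simp [g]
    rw [ContinuousWithinAt, this]
    refine squeeze_zero_norm' (a := fun y : ℝ => C * (y^α + y^b) * Real.exp (-c*y)) ?_ ?_
    · filter_upwards [self_mem_nhdsWithin] with y hy using hg y hy
    · have hcn : Continuous (fun y : ℝ => C * (y^α + y^b) * Real.exp (-c*y)) := by
        have := Real.continuous_rpow_const hα.le
        have := Real.continuous_rpow_const hb.le
        fun_prop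
      have := hcn.tendsto 0
      simp only [Real.zero_rpow hα.ne', Real.zero_rpow hb.ne', add_zero, mul_zero, zero_mul] at this
      exact this.mono_left nhdsWithin_le_nhds
  · intro y hy
    have hy : 0 < y := hy
    refine (hd y hy).congr_of_eventuallyEq ?_
    filter_upwards [lt_mem_nhds hy] with z hz
    simp [g, hz.ne']
  · refine squeeze_zero_norm' (a := fun y : ℝ => C * (y^α + y^b) * Real.exp (-c*y)) ?_ (tendsto_pe_atTop hc)
    filter_upwards [eventually_ge_atTop 0] with y hy using hg y hy

end BW


namespace BW
open MeasureTheory Set Topology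

/-- inverse square root factor -/
noncomputable def qf (r : ℝ) (z : ℂ) : ℂ := ((r:ℂ)^2 + 2*z) ^ (((-1/2 : ℝ)) : ℂ)

noncomputable def hF (z : ℂ) (r : ℝ) : ℂ := Complex.exp (-(r:ℂ)^2) * qf r z

noncomputable def hK (z : ℂ) : ℂ := 2 * ∫ r in Ioi (0:ℝ), hF z r

/-- the complex Macdonald function on the slit plane -/
noncomputable def Kc (z : ℂ) : ℂ := Complex.exp (-z) * hK z

lemma w_mem (r : ℝ) {z : ℂ} (hz : z ∈ Complex.slitPlane) : (r:ℂ)^2 + 2*z ∈ Complex.slitPlane := by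
  rw [Complex.mem_slitPlane_iff] at *
  have h1 : ((r:ℂ)^2 + 2*z).re = r^2 + 2*z.re := by
    simp [pow_two]
  have h2 : ((r:ℂ)^2 + 2*z).im = 2*z.im := by
    simp [pow_two]
  rw [h1, h2]
  rcases hz with h | h
  · left; positivity
  · right; simpa using h

lemma qf_hasDerivAt (r : ℝ) {z : ℂ} (hz : z ∈ Complex.slitPlane) :
    HasDerivAt (fun z => qf r z) (-(qf r z / ((r:ℂ)^2 + 2*z))) z := by
  have hw := w_mem r hz
  have h1 : HasDerivAt (fun z : ℂ => (r:ℂ)^2 + 2*z) 2 z := by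
    simpa using ((hasDerivAt_id z).const_mul (2:ℂ)).const_add ((r:ℂ)^2)
  have := h1.cpow_const (c := (((-1/2 : ℝ)) : ℂ)) hw
  refine this.congr_deriv ?_
  rw [Complex.cpow_sub _ _ (Complex.slitPlane_ne_zero hw), Complex.cpow_one]
  unfold qf
  push_cast; ring

lemma qf_hasDerivAt_r (r : ℝ) {z : ℂ} (hz : z ∈ Complex.slitPlane) :
    HasDerivAt (fun r : ℝ => qf r z) (-(r * qf r z / ((r:ℂ)^2 + 2*z))) r := by
  have hw := w_mem r hz
  have h1 : HasDerivAt (fun x : ℂ => x^2 + 2*z) (2*(r:ℂ)) (r:ℂ) := by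
    simpa using (hasDerivAt_pow 2 (r:ℂ)).add_const (2*z)
  have := (h1.cpow_const (c := (((-1/2 : ℝ)) : ℂ)) hw).comp_ofReal
  refine this.congr_deriv ?_
  rw [Complex.cpow_sub _ _ (Complex.slitPlane_ne_zero hw), Complex.cpow_one]
  unfold qf
  push_cast; ring

lemma le_of_sq_le_sq_aux {a b : ℝ} (h : a^2 ≤ b^2) (hb : 0 ≤ b) : a ≤ b := by
  nlinarith

lemma w_lower {δ : ℝ} (hδ : 0 < δ) (hδ1 : δ ≤ 1) {z : ℂ} (hz : -(1-δ) * ‖z‖ ≤ z.re) (r : ℝ) :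
    Real.sqrt (δ/2) * (r^2 + ‖z‖) ≤ ‖(r:ℂ)^2 + 2*z‖ := by
  refine le_of_sq_le_sq_aux ?_ (norm_nonneg _)
  rw [mul_pow, Real.sq_sqrt (by positivity)]
  have h2 : ‖(r:ℂ)^2 + 2*z‖^2 = r^4 + 4*r^2*z.re + 4*‖z‖^2 := by
    rw [← Complex.normSq_eq_norm_sq, ← Complex.normSq_eq_norm_sq, Complex.normSq_apply, Complex.normSq_apply]
    simp [pow_two]; ring
  rw [h2]
  have hn := norm_nonneg z
  nlinarith [mul_le_mul_of_nonneg_left hz (show 0 ≤ 4*r^2 by positivity), mul_nonneg (sub_nonneg.2 hδ1) (sq_nonneg (r^2 - 2*‖z‖)), mul_nonneg hδ.le (sq_nonneg (r^2 - 2*‖z‖)), mul_nonneg (mul_nonneg hδ.le hn) (sq_nonneg r), mul_nonneg hδ.le (sq_nonneg (‖z‖))]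

lemma sector {z0 : ℂ} (hz : z0 ∈ Complex.slitPlane) : ∃ δ : ℝ, 0 < δ ∧ δ ≤ 1 ∧
    ∀ᶠ z in 𝓝 z0, -(1-δ) * ‖z‖ < z.re ∧ ‖z0‖/2 < ‖z‖ := by
  have h0 : 0 < ‖z0‖ := norm_pos_iff.2 (Complex.slitPlane_ne_zero hz)
  have h1 : 0 < z0.re + ‖z0‖ := by
    rcases Complex.mem_slitPlane_iff.1 hz with h | h
    · positivity
    · have := (Complex.abs_re_lt_norm).2 h
      linarith [neg_abs_le z0.re]
  have hle := Complex.re_le_norm z0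
  refine ⟨(z0.re + ‖z0‖)/(2*‖z0‖), by positivity, by rw [div_le_one (by positivity)]; linarith, ?_⟩
  have c1 : Continuous fun z : ℂ => -(1-(z0.re + ‖z0‖)/(2*‖z0‖)) * ‖z‖ := by fun_prop
  refine (Filter.Tendsto.eventually_lt (c1.tendsto z0) (Complex.continuous_re.tendsto z0) ?_).and
    (Filter.Tendsto.eventually_lt tendsto_const_nhds (continuous_norm.tendsto z0) (by linarith))
  have : -(1-(z0.re + ‖z0‖)/(2*‖z0‖)) * ‖z0‖ = (z0.re - ‖z0‖)/2 := by field_simp; ring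
  rw [this]; linarith

lemma norm_qf (r : ℝ) (z : ℂ) : ‖qf r z‖ = ‖(r:ℂ)^2 + 2*z‖ ^ (-1/2 : ℝ) := by
  unfold qf; rw [Complex.norm_cpow_real]

lemma norm_exp_sq (r : ℝ) : ‖Complex.exp (-(r:ℂ)^2)‖ = Real.exp (-r^2) := by
  rw [Complex.norm_exp]; congr 1; simp [pow_two]

lemma cont_qf {z : ℂ} (hz : z ∈ Complex.slitPlane) : Continuous fun r => qf r z :=
  continuous_iff_continuousAt.2 fun r => (qf_hasDerivAt_r r hz).continuousAt

lemma cont_hF {z : ℂ} (hz : z ∈ Complex.slitPlane) : Continuous (hF z) := by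
  have := cont_qf hz
  unfold hF; fun_prop

lemma integrable_gauss : IntegrableOn (fun r : ℝ => Real.exp (-r^2)) (Ioi 0) := by
  have := (integrable_exp_neg_mul_sq (b := 1) one_pos).integrableOn (s := Ioi 0)
  simpa using this

lemma hF_LD {z0 : ℂ} (hz : z0 ∈ Complex.slitPlane) : LD (volume.restrict (Ioi 0)) hF z0 := by
  obtain ⟨δ, hδ, hδ1, h⟩ := sector hz
  obtain ⟨R, hR, hb⟩ := Metric.eventually_nhds_iff_ball.1 (h.and (Complex.isOpen_slitPlane.eventually_mem hz))
  have h0 : 0 < ‖z0‖ := norm_pos_iff.2 (Complex.slitPlane_ne_zero hz)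
  refine ⟨R, hR, fun r => Real.exp (-r^2) * (Real.sqrt (δ/2) * (‖z0‖/2)) ^ (-1/2:ℝ), integrable_gauss.mul_const _,
    fun z hz => (cont_hF (hb z hz).2).aestronglyMeasurable, Eventually.of_forall fun r => ⟨fun z hz => ?_, fun z hz => ?_⟩⟩
  · unfold hF
    exact ((qf_hasDerivAt r (hb z hz).2).differentiableAt.const_mul _).differentiableWithinAt
  · unfold hF
    rw [norm_mul, norm_exp_sq, norm_qf]
    have h1 := w_lower hδ hδ1 (hb z hz).1.1.le r
    have h2 : Real.sqrt (δ/2) * (‖z0‖/2) ≤ Real.sqrt (δ/2) * (r^2 + ‖z‖) := by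
      gcongr; nlinarith [(hb z hz).1.2]
    refine mul_le_mul_of_nonneg_left ?_ (Real.exp_pos _).le
    exact Real.rpow_le_rpow_of_nonpos (by positivity) (h2.trans h1) (by norm_num)

lemma hF_deriv (r : ℝ) {z : ℂ} (hz : z ∈ Complex.slitPlane) :
    deriv (fun z => hF z r) z = -(Complex.exp (-(r:ℂ)^2) * (qf r z / ((r:ℂ)^2 + 2*z))) := by
  unfold hF
  rw [((qf_hasDerivAt r hz).const_mul _).deriv]; ring

lemma hF_deriv2 (r : ℝ) {z : ℂ} (hz : z ∈ Complex.slitPlane) :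
    deriv (fun z => deriv (fun z => hF z r) z) z = 3 * (Complex.exp (-(r:ℂ)^2) * (qf r z / ((r:ℂ)^2 + 2*z)^2)) := by
  have hw := Complex.slitPlane_ne_zero (w_mem r hz)
  have : (fun z => deriv (fun z => hF z r) z) =ᶠ[𝓝 z] fun z => -(Complex.exp (-(r:ℂ)^2) * (qf r z / ((r:ℂ)^2 + 2*z))) := by
    filter_upwards [Complex.isOpen_slitPlane.eventually_mem hz] with z hz using hF_deriv r hz
  rw [this.deriv_eq]
  have h1 : HasDerivAt (fun z : ℂ => (r:ℂ)^2 + 2*z) 2 z := by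
    simpa using ((hasDerivAt_id z).const_mul (2:ℂ)).const_add ((r:ℂ)^2)
  rw [(((qf_hasDerivAt r hz).fun_div h1 hw).const_mul (Complex.exp (-(r:ℂ)^2))).fun_neg.deriv]
  field_simp
  ring

lemma hK_hasDerivAt {z : ℂ} (hz : z ∈ Complex.slitPlane) :
    HasDerivAt hK (2 * ∫ r in Ioi (0:ℝ), deriv (fun z => hF z r) z) z :=
  (hF_LD hz).hasDerivAt.const_mul 2

lemma hK_hasDerivAt2 {z : ℂ} (hz : z ∈ Complex.slitPlane) :
    HasDerivAt (deriv hK) (2 * ∫ r in Ioi (0:ℝ), deriv (fun z => deriv (fun z => hF z r) z) z) z := by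
  refine ((hF_LD hz).deriv.hasDerivAt.const_mul 2).congr_of_eventuallyEq ?_
  filter_upwards [Complex.isOpen_slitPlane.eventually_mem hz] with z hz using (hK_hasDerivAt hz).deriv

lemma norm_q_le {δ : ℝ} (hδ : 0 < δ) (hδ1 : δ ≤ 1) {z : ℂ} (hz : -(1-δ) * ‖z‖ ≤ z.re) (hz0 : z ≠ 0) (r : ℝ) :
    ‖qf r z‖ ≤ (Real.sqrt (δ/2)) ^ (-1/2:ℝ) * (r^2 + ‖z‖)^(-1/2:ℝ) := by
  have h0 : 0 < ‖z‖ := norm_pos_iff.2 hz0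
  rw [norm_qf, ← Real.mul_rpow (by positivity) (by positivity)]
  exact Real.rpow_le_rpow_of_nonpos (by positivity) (w_lower hδ hδ1 hz r) (by norm_num)

lemma hK_ode {z : ℂ} (hz : z ∈ Complex.slitPlane) :
    z * deriv (deriv hK) z + (1 - 2*z) * deriv hK z - hK z = 0 := by
  rw [(hK_hasDerivAt2 hz).deriv, (hK_hasDerivAt hz).deriv, hK]
  have i0 := (hF_LD hz).integrable
  have i1 := (hF_LD hz).deriv.integrable
  have i2 := (hF_LD hz).deriv.deriv.integrable
  have h0 : 0 < ‖z‖ := norm_pos_iff.2 (Complex.slitPlane_ne_zero hz)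
  have key : ∫ r in Ioi (0:ℝ), (z * deriv (fun z => deriv (fun z => hF z r) z) z + (1-2*z) * deriv (fun z => hF z r) z - hF z r) = 0 := by
    have hintg := ((i2.const_mul z).add (i1.const_mul (1-2*z))).sub i0
    obtain ⟨δ, hδ, hδ1, hs⟩ := sector hz
    have hs := hs.self_of_nhds.1.le
    have := integral_Ioi_of_hasDerivAt_of_tendsto (f := fun r : ℝ => (1/2) * (Complex.exp (-(r:ℂ)^2) * (r * (qf r z / ((r:ℂ)^2 + 2*z)))))
      (f' := fun r => z * deriv (fun z => deriv (fun z => hF z r) z) z + (1-2*z) * deriv (fun z => hF z r) z - hF z r) (a := 0) (m := 0) ?_ ?_ hintg ?_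
    · rw [this]; simp
    · have := cont_qf hz
      have h2 : Continuous fun r : ℝ => (r:ℂ)^2 + 2*z := by fun_prop
      have h3 : ∀ r : ℝ, (r:ℂ)^2 + 2*z ≠ 0 := fun r => Complex.slitPlane_ne_zero (w_mem r hz)
      have : Continuous fun r : ℝ => (1/2) * (Complex.exp (-(r:ℂ)^2) * (r * (qf r z / ((r:ℂ)^2 + 2*z)))) := by
        have := this.div h2 h3
        fun_prop
      exact this.continuousWithinAt
    · intro r _
      rw [hF_deriv2 r hz, hF_deriv r hz]
      have hw := Complex.slitPlane_ne_zero (w_mem r hz)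
      have d1 : HasDerivAt (fun r : ℝ => (r:ℂ)) 1 r := Complex.ofRealCLM.hasDerivAt
      have d2 : HasDerivAt (fun r : ℝ => Complex.exp (-(r:ℂ)^2)) (Complex.exp (-(r:ℂ)^2) * (-(2*r))) r := by
        have := (d1.fun_pow 2).fun_neg.cexp
        simpa using this
      have d3 : HasDerivAt (fun r : ℝ => (r:ℂ)^2+2*z) (2*(r:ℂ)) r := by
        refine ((d1.fun_pow 2).add_const (2*z)).congr_deriv ?_
        simp
      have := (d2.fun_mul (d1.fun_mul ((qf_hasDerivAt_r r hz).fun_div d3 hw))).const_mul (1/2:ℂ)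
      refine this.congr_deriv ?_
      unfold hF
      field_simp
      ring
    · have hb : ∀ r : ℝ, 0 < r → ‖(1/2) * (Complex.exp (-(r:ℂ)^2) * (r * (qf r z / ((r:ℂ)^2 + 2*z))))‖ ≤
          (r * Real.exp (-r^2)) * ((1/2) * ((Real.sqrt (δ/2)) ^ (-1/2:ℝ) * (‖z‖)^(-1/2:ℝ)) / (Real.sqrt (δ/2) * ‖z‖)) := by
        intro r hr
        have e1 : ‖qf r z‖ ≤ (Real.sqrt (δ/2)) ^ (-1/2:ℝ) * (‖z‖)^(-1/2:ℝ) := by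
          refine (norm_q_le hδ hδ1 hs (Complex.slitPlane_ne_zero hz) r).trans ?_
          refine mul_le_mul_of_nonneg_left ?_ (by positivity)
          exact Real.rpow_le_rpow_of_nonpos h0 (by nlinarith [sq_nonneg r]) (by norm_num)
        have e2 : Real.sqrt (δ/2) * ‖z‖ ≤ ‖(r:ℂ)^2 + 2*z‖ := by
          refine le_trans ?_ (w_lower hδ hδ1 hs r)
          gcongr; nlinarith
        rw [norm_mul, norm_mul, norm_mul, norm_div (qf r z), norm_exp_sq, Complex.norm_real, Real.norm_of_nonneg hr.le]
        have e3 : ‖qf r z‖ / ‖(r:ℂ)^2 + 2*z‖ ≤ (Real.sqrt (δ/2)) ^ (-1/2:ℝ) * (‖z‖)^(-1/2:ℝ) / (Real.sqrt (δ/2) * ‖z‖) := by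
          gcongr
        calc ‖(1/2:ℂ)‖ * (Real.exp (-r^2) * (r * (‖qf r z‖ / ‖(r:ℂ)^2 + 2*z‖)))
            ≤ (1/2) * (Real.exp (-r^2) * (r * ((Real.sqrt (δ/2)) ^ (-1/2:ℝ) * (‖z‖)^(-1/2:ℝ) / (Real.sqrt (δ/2) * ‖z‖)))) := by
              gcongr; norm_num
          _ = _ := by ring
      have ht : Tendsto (fun r : ℝ => r * Real.exp (-r^2)) atTop (𝓝 0) := by
        have h1 := tendsto_rpow_mul_exp_neg_mul_atTop_nhds_zero 1 1 one_pos
        refine squeeze_zero' ?_ ?_ h1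
        · filter_upwards [eventually_ge_atTop 0] with r hr; positivity
        · filter_upwards [eventually_ge_atTop 1] with r hr
          simp only [Real.rpow_one]
          gcongr; nlinarith
      have ht2 := ht.mul_const ((1/2) * ((Real.sqrt (δ/2)) ^ (-1/2:ℝ) * (‖z‖)^(-1/2:ℝ)) / (Real.sqrt (δ/2) * ‖z‖))
      rw [zero_mul] at ht2
      refine squeeze_zero_norm' ?_ ht2
      filter_upwards [eventually_gt_atTop 0] with r hr using hb r hr
  have e : ∫ r in Ioi (0:ℝ), (z * deriv (fun z => deriv (fun z => hF z r) z) z + (1-2*z) * deriv (fun z => hF z r) z - hF z r)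
      = z * (∫ r in Ioi (0:ℝ), deriv (fun z => deriv (fun z => hF z r) z) z) + (1-2*z) * (∫ r in Ioi (0:ℝ), deriv (fun z => hF z r) z) - ∫ r in Ioi (0:ℝ), hF z r := by
    rw [integral_sub (f := fun r => z * deriv (fun z => deriv (fun z => hF z r) z) z + (1-2*z) * deriv (fun z => hF z r) z) ((i2.const_mul z).add (i1.const_mul (1-2*z))) i0, integral_add (i2.const_mul z) (i1.const_mul (1-2*z)), integral_const_mul, integral_const_mul]
  rw [e] at key
  linear_combination 2 * key

lemma hK_diff {z : ℂ} (hz : z ∈ Complex.slitPlane) : DifferentiableAt ℂ hK z := (hK_hasDerivAt hz).differentiableAt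

lemma Kc_hasDerivAt {z : ℂ} (hz : z ∈ Complex.slitPlane) :
    HasDerivAt Kc (Complex.exp (-z) * (deriv hK z - hK z)) z := by
  have := ((hasDerivAt_id z).fun_neg.cexp).fun_mul (hK_diff hz).hasDerivAt
  refine this.congr_deriv ?_
  simp only [id]; ring

lemma Kc_diff {z : ℂ} (hz : z ∈ Complex.slitPlane) : DifferentiableAt ℂ Kc z := (Kc_hasDerivAt hz).differentiableAt

lemma Kc_hasDerivAt2 {z : ℂ} (hz : z ∈ Complex.slitPlane) :
    HasDerivAt (deriv Kc) (Kc z - deriv Kc z / z) z := by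
  have h : deriv Kc =ᶠ[𝓝 z] fun z => Complex.exp (-z) * (deriv hK z - hK z) := by
    filter_upwards [Complex.isOpen_slitPlane.eventually_mem hz] with z hz using (Kc_hasDerivAt hz).deriv
  have := (((hasDerivAt_id z).fun_neg.cexp).fun_mul ((hK_hasDerivAt2 hz).differentiableAt.hasDerivAt.fun_sub (hK_diff hz).hasDerivAt)).congr_of_eventuallyEq h
  refine this.congr_deriv ?_
  rw [(Kc_hasDerivAt hz).deriv, Kc]
  have hz0 := Complex.slitPlane_ne_zero hz
  have := hK_ode hz
  simp only [id]
  field_simp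
  linear_combination this

end BW


namespace BW
open MeasureTheory Set Topology

lemma rpow_split {a b η : ℝ} (ha : 0 < a) (hb : 0 < b) (hη : 0 < η) (hη1 : η ≤ 1/2) :
    (a^2 + b)^(-1/2:ℝ) ≤ a^(2*η-1) * b^(-η) := by
  have h1 : (a^2+b)^(-1/2:ℝ) = (a^2+b)^(η - 1/2) * (a^2+b)^(-η) := by
    rw [← Real.rpow_add (by positivity)]; congr 1; ring
  have h2 : a^(2*η-1) = (a^2)^(η-1/2) := by
    rw [← Real.rpow_natCast a 2, ← Real.rpow_mul ha.le]; congr 1; push_cast; ring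
  rw [h1, h2]
  refine mul_le_mul ?_ ?_ (by positivity) (by positivity)
  · exact Real.rpow_le_rpow_of_nonpos (by positivity) (by linarith) (by linarith)
  · exact Real.rpow_le_rpow_of_nonpos hb (by nlinarith) (by linarith)

lemma hK_bound {δ η : ℝ} (hδ : 0 < δ) (hδ1 : δ ≤ 1) (hη : 0 < η) (hη1 : η ≤ 1/2) :
    ∃ C : ℝ, 0 ≤ C ∧ ∀ z : ℂ, z ≠ 0 → -(1-δ) * ‖z‖ ≤ z.re → ‖hK z‖ ≤ C * ‖z‖^(-η) := by
  have hi : IntegrableOn (fun r : ℝ => r^(2*η-1) * Real.exp (-1 * r^(2:ℝ))) (Ioi 0) :=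
    integrableOn_rpow_mul_exp_neg_mul_rpow (by linarith) (by norm_num) one_pos
  refine ⟨2 * ((Real.sqrt (δ/2)) ^ (-1/2:ℝ) * ∫ r in Ioi (0:ℝ), r^(2*η-1) * Real.exp (-1 * r^(2:ℝ))), ?_, ?_⟩
  · have : 0 ≤ ∫ r in Ioi (0:ℝ), r^(2*η-1) * Real.exp (-1 * r^(2:ℝ)) := by
      refine setIntegral_nonneg measurableSet_Ioi fun r hr => ?_
      have hr : 0 < r := hr
      positivity
    positivity
  · intro z hz0 hz
    have h0 : 0 < ‖z‖ := norm_pos_iff.2 hz0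
    have : ‖∫ r in Ioi (0:ℝ), hF z r‖ ≤ ∫ r in Ioi (0:ℝ), ((Real.sqrt (δ/2)) ^ (-1/2:ℝ) * ‖z‖^(-η)) * (r^(2*η-1) * Real.exp (-1 * r^(2:ℝ))) := by
      refine norm_integral_le_of_norm_le (hi.const_mul _) ?_
      refine ae_restrict_of_forall_mem measurableSet_Ioi fun r hr => ?_
      have hr : 0 < r := hr
      unfold hF
      rw [norm_mul, norm_exp_sq]
      have h1 := (norm_q_le hδ hδ1 hz hz0 r).trans (mul_le_mul_of_nonneg_left (rpow_split hr h0 hη hη1) (by positivity))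
      have h2 : Real.exp (-1 * r^(2:ℝ)) = Real.exp (-r^2) := by
        congr 1
        rw [show (2:ℝ) = ((2:ℕ):ℝ) by norm_num, Real.rpow_natCast]; ring
      rw [h2]
      calc Real.exp (-r^2) * ‖qf r z‖ ≤ Real.exp (-r^2) * _ := mul_le_mul_of_nonneg_left h1 (Real.exp_pos _).le
        _ = _ := by ring
    rw [integral_const_mul] at this
    unfold hK
    rw [norm_mul]
    rw [show ‖(2:ℂ)‖ = 2 by norm_num]
    refine (mul_le_mul_of_nonneg_left this (by norm_num : (0:ℝ) ≤ 2)).trans (le_of_eq ?_)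
    ring

lemma Kc_bound {δ η : ℝ} (hδ : 0 < δ) (hδ1 : δ ≤ 1) (hη : 0 < η) (hη1 : η ≤ 1/2) :
    ∃ C : ℝ, 0 ≤ C ∧ ∀ z : ℂ, z ≠ 0 → -(1-δ) * ‖z‖ ≤ z.re → ‖Kc z‖ ≤ C * ‖z‖^(-η) * Real.exp (-z.re) := by
  obtain ⟨C, hC, h⟩ := hK_bound hδ hδ1 hη hη1
  refine ⟨C, hC, fun z hz0 hz => ?_⟩
  unfold Kc
  rw [norm_mul, Complex.norm_exp, mul_comm, Complex.neg_re]
  exact mul_le_mul_of_nonneg_right (h z hz0 hz) (Real.exp_pos _).le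

lemma one_sub_exp_le {z : ℂ} (hz : 0 ≤ z.re) : ‖1 - Complex.exp (-z)‖ ≤ 2 * ‖z‖ := by
  rcases le_total ‖z‖ 1 with h | h
  · have := Complex.norm_exp_sub_one_le (x := -z) (by simpa using h)
    rw [norm_sub_rev]; simpa using this
  · have : ‖Complex.exp (-z)‖ ≤ 1 := by
      rw [Complex.norm_exp]; simpa using hz
    calc _ ≤ ‖(1:ℂ)‖ + ‖Complex.exp (-z)‖ := norm_sub_le _ _
      _ ≤ 2 * ‖z‖ := by rw [norm_one]; linarith

lemma slit_of_re {z : ℂ} (hz0 : z ≠ 0) (hz : 0 ≤ z.re) : z ∈ Complex.slitPlane := by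
  rw [Complex.mem_slitPlane_iff]
  rcases hz.eq_or_lt with h | h
  · right; intro h2; exact hz0 (Complex.ext h.symm h2)
  · left; exact h

lemma norm_q3_le {z : ℂ} (hz : 0 ≤ z.re) (hz0 : z ≠ 0) {r : ℝ} (hr : 0 < r) :
    ‖qf r z / ((r:ℂ)^2 + 2*z)‖ ≤ (Real.sqrt (1/2)) ^ (-1/2:ℝ) / Real.sqrt (1/2) * ((‖z‖)^(-1/2:ℝ) / (r^2 + ‖z‖)) := by
  have h0 : 0 < ‖z‖ := norm_pos_iff.2 hz0
  have e1 : ‖qf r z‖ ≤ (Real.sqrt (1/2)) ^ (-1/2:ℝ) * (‖z‖)^(-1/2:ℝ) := by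
    refine (norm_q_le one_pos le_rfl (by simpa using hz) hz0 r).trans ?_
    refine mul_le_mul_of_nonneg_left ?_ (by positivity)
    exact Real.rpow_le_rpow_of_nonpos h0 (by nlinarith [sq_nonneg r]) (by norm_num)
  have e2 := w_lower one_pos le_rfl (z := z) (by simpa using hz) r
  rw [norm_div]
  calc _ ≤ ((Real.sqrt (1/2)) ^ (-1/2:ℝ) * (‖z‖)^(-1/2:ℝ)) / (Real.sqrt (1/2) * (r^2 + ‖z‖)) := by gcongr
    _ = _ := by rw [mul_div_mul_comm]

lemma pos_mul_cpow {a : ℝ} (ha : 0 < a) {x : ℂ} (hx : x ≠ 0) (c : ℂ) : ((a:ℂ) * x)^c = (a:ℂ)^c * x^c := by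
  have ha' : (a:ℂ) ≠ 0 := by exact_mod_cast ha.ne'
  rw [Complex.cpow_def_of_ne_zero (mul_ne_zero ha' hx), Complex.log_ofReal_mul ha hx, Complex.cpow_def_of_ne_zero ha',
    Complex.cpow_def_of_ne_zero hx, ← Complex.exp_add, Complex.ofReal_log ha.le]
  ring_nf

lemma tendsto_rq {z : ℂ} (hz : 0 ≤ z.re) (hz0 : z ≠ 0) : Tendsto (fun r : ℝ => (r:ℂ) * qf r z) atTop (𝓝 1) := by
  have hs := slit_of_re hz0 hz
  have h1 : Tendsto (fun r : ℝ => (1 + 2 * z * (((r⁻¹:ℝ):ℂ))^2 : ℂ)) atTop (𝓝 1) := by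
    have h2 := (Complex.continuous_ofReal.tendsto 0).comp (tendsto_inv_atTop_zero (𝕜 := ℝ))
    have := (((h2.pow 2).const_mul (2*z)).const_add 1)
    simpa [Function.comp_def] using this
  have h3 : Tendsto (fun r : ℝ => (1 + 2 * z * (((r⁻¹:ℝ):ℂ))^2 : ℂ) ^ (((-1/2 : ℝ)) : ℂ)) atTop (𝓝 1) := by
    have hc : ContinuousAt (fun x : ℂ => x ^ (((-1/2 : ℝ)) : ℂ)) 1 :=
      (hasDerivAt_id (1:ℂ)).cpow_const (c := (((-1/2 : ℝ)) : ℂ)) (by simp [Complex.one_mem_slitPlane]) |>.continuousAt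
    have := hc.tendsto.comp h1
    simpa [Function.comp_def] using this
  refine h3.congr' ?_
  filter_upwards [eventually_gt_atTop 0] with r hr
  have hrc : (r:ℂ) ≠ 0 := by exact_mod_cast hr.ne'
  unfold qf
  have e : (r:ℂ)^2 + 2*z = ((r^2:ℝ):ℂ) * (1 + 2 * z * (((r⁻¹:ℝ):ℂ))^2) := by
    push_cast; field_simp
  have hne : (1 + 2 * z * (((r⁻¹:ℝ):ℂ))^2 : ℂ) ≠ 0 := by
    intro h; rw [h, mul_zero] at e; exact Complex.slitPlane_ne_zero (w_mem r hs) e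
  rw [e, pos_mul_cpow (by positivity) hne]
  rw [← Complex.ofReal_cpow (by positivity), ← mul_assoc, ← Complex.ofReal_mul]
  have : r * (r^2)^(-1/2:ℝ) = 1 := by
    rw [← Real.rpow_natCast r 2, ← Real.rpow_mul hr.le]
    norm_num
    rw [Real.rpow_neg hr.le, Real.rpow_one]; field_simp
  rw [this]; simp

end BW


namespace BW
open MeasureTheory Set Topology

lemma cont_q3 {z : ℂ} (hz : z ∈ Complex.slitPlane) : Continuous fun r : ℝ => qf r z / ((r:ℂ)^2 + 2*z) := by
  have := cont_qf hz
  have h2 : Continuous fun r : ℝ => (r:ℂ)^2 + 2*z := by fun_prop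
  exact this.div h2 fun r => Complex.slitPlane_ne_zero (w_mem r hz)

lemma integrable_q3 {z : ℂ} (hz : 0 ≤ z.re) (hz0 : z ≠ 0) :
    IntegrableOn (fun r : ℝ => qf r z / ((r:ℂ)^2 + 2*z)) (Ioi 0) := by
  have h0 : 0 < ‖z‖ := norm_pos_iff.2 hz0
  have hm : 0 < min 1 ‖z‖ := lt_min one_pos h0
  have hi : IntegrableOn (fun r : ℝ => (Real.sqrt (1/2)) ^ (-1/2:ℝ) / Real.sqrt (1/2) * ((‖z‖)^(-1/2:ℝ) / min 1 ‖z‖ * (1+r^2)⁻¹)) (Ioi 0) :=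
    (integrable_inv_one_add_sq.integrableOn.const_mul _).const_mul _
  refine hi.mono' (cont_q3 (slit_of_re hz0 hz)).aestronglyMeasurable ?_
  refine ae_restrict_of_forall_mem measurableSet_Ioi fun r hr => ?_
  refine (norm_q3_le hz hz0 hr).trans ?_
  refine mul_le_mul_of_nonneg_left ?_ (by positivity)
  rw [← div_eq_mul_inv, div_div]
  have : min 1 ‖z‖ * (1 + r^2) ≤ r^2 + ‖z‖ := by
    nlinarith [min_le_left 1 ‖z‖, min_le_right 1 ‖z‖, sq_nonneg r]
  gcongr

lemma integral_q3 {z : ℂ} (hz : 0 ≤ z.re) (hz0 : z ≠ 0) :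
    2 * z * ∫ r in Ioi (0:ℝ), qf r z / ((r:ℂ)^2 + 2*z) = 1 := by
  have hs := slit_of_re hz0 hz
  rw [← integral_const_mul]
  have := integral_Ioi_of_hasDerivAt_of_tendsto (f := fun r : ℝ => (r:ℂ) * qf r z)
    (f' := fun r => 2 * z * (qf r z / ((r:ℂ)^2 + 2*z))) (a := 0) (m := 1) ?_ ?_ ((integrable_q3 hz hz0).const_mul _) (tendsto_rq hz hz0)
  · rw [this]; simp
  · have := cont_qf hs
    exact Continuous.continuousWithinAt (by fun_prop)
  · intro r hr
    have d1 : HasDerivAt (fun r : ℝ => (r:ℂ)) 1 r := Complex.ofRealCLM.hasDerivAt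
    refine (d1.fun_mul (qf_hasDerivAt_r r hs)).congr_deriv ?_
    have hw := Complex.slitPlane_ne_zero (w_mem r hs)
    field_simp
    ring

lemma Kc_theta : ∃ C : ℝ, 0 ≤ C ∧ ∀ z : ℂ, z ≠ 0 → 0 ≤ z.re → ‖z * deriv Kc z + 1‖ ≤ C * (‖z‖^(1/2:ℝ) + ‖z‖^(1:ℝ)) := by
  obtain ⟨C, hC, hb⟩ := Kc_bound (δ := 1) (η := 1/2) one_pos le_rfl (by norm_num) le_rfl
  set c := (Real.sqrt (1/2)) ^ (-1/2:ℝ) / Real.sqrt (1/2)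
  have hc : 0 ≤ c := by positivity
  set P := ∫ r in Ioi (0:ℝ), 2 * (1+r^2)⁻¹
  have hP : 0 ≤ P := setIntegral_nonneg measurableSet_Ioi fun r hr => by positivity
  refine ⟨2 + 2 * c * P + C, by positivity, fun z hz0 hz => ?_⟩
  have hs := slit_of_re hz0 hz
  have h0 : 0 < ‖z‖ := norm_pos_iff.2 hz0
  have hi3 := integrable_q3 hz hz0
  have hiG : IntegrableOn (fun r : ℝ => Complex.exp (-(r:ℂ)^2) * (qf r z / ((r:ℂ)^2 + 2*z))) (Ioi 0) := by
    refine (hF_LD hs).deriv.integrable.neg.congr (Eventually.of_forall fun r => ?_)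
    simp only [Pi.neg_apply]
    rw [hF_deriv r hs, neg_neg]
  have hh : deriv hK z = -2 * ∫ r in Ioi (0:ℝ), Complex.exp (-(r:ℂ)^2) * (qf r z / ((r:ℂ)^2 + 2*z)) := by
    rw [(hK_hasDerivAt hs).deriv]
    have : (fun r : ℝ => deriv (fun z => hF z r) z) = fun r : ℝ => -(Complex.exp (-(r:ℂ)^2) * (qf r z / ((r:ℂ)^2 + 2*z))) := by
      funext r; exact hF_deriv r hs
    rw [this, integral_neg]; ring
  set M := ∫ r in Ioi (0:ℝ), qf r z / ((r:ℂ)^2 + 2*z) with hM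
  set G := ∫ r in Ioi (0:ℝ), Complex.exp (-(r:ℂ)^2) * (qf r z / ((r:ℂ)^2 + 2*z)) with hG
  have hM1 : 2 * z * M = 1 := integral_q3 hz hz0
  have hD : ‖M - G‖ ≤ c * ‖z‖^(-1/2:ℝ) * P := by
    rw [hM, hG, ← integral_sub hi3 hiG, ← integral_const_mul]
    refine norm_integral_le_of_norm_le ((integrable_inv_one_add_sq.integrableOn.const_mul _).const_mul _) ?_
    refine ae_restrict_of_forall_mem measurableSet_Ioi fun r hr => ?_
    have hr : 0 < r := hr
    have e1 := norm_q3_le hz hz0 hr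
    have e2 : qf r z / ((r:ℂ)^2 + 2*z) - Complex.exp (-(r:ℂ)^2) * (qf r z / ((r:ℂ)^2 + 2*z)) =
      ((1 - Real.exp (-r^2) : ℝ):ℂ) * (qf r z / ((r:ℂ)^2 + 2*z)) := by push_cast; ring
    have e3 : 0 ≤ 1 - Real.exp (-r^2) := by
      have : Real.exp (-r^2) ≤ 1 := Real.exp_le_one_iff.2 (by nlinarith)
      linarith
    have e4 : 1 - Real.exp (-r^2) ≤ r^2 := by
      have := Real.add_one_le_exp (-r^2); linarith
    have e5 : 1 - Real.exp (-r^2) ≤ 1 := by linarith [Real.exp_pos (-r^2)]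
    rw [e2, norm_mul, Complex.norm_real, Real.norm_of_nonneg e3]
    have e6 : (1 - Real.exp (-r^2)) / (r^2 + ‖z‖) ≤ 2 * (1+r^2)⁻¹ := by
      rw [← div_eq_mul_inv, div_le_div_iff₀ (by positivity) (by positivity)]
      nlinarith
    calc _ ≤ (1 - Real.exp (-r^2)) * (c * ((‖z‖)^(-1/2:ℝ) / (r^2 + ‖z‖))) := mul_le_mul_of_nonneg_left e1 e3
      _ = c * ‖z‖^(-1/2:ℝ) * ((1 - Real.exp (-r^2)) / (r^2 + ‖z‖)) := by ring
      _ ≤ _ := mul_le_mul_of_nonneg_left e6 (by positivity)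
  have key : z * deriv Kc z + 1 = (1 - Complex.exp (-z)) + Complex.exp (-z) * (2 * z * (M - G)) - z * Kc z := by
    rw [(Kc_hasDerivAt hs).deriv, hh, Kc]
    linear_combination (-Complex.exp (-z)) * hM1
  have hz12 : ‖z‖ * ‖z‖^(-1/2:ℝ) = ‖z‖^(1/2:ℝ) := by
    nth_rewrite 1 [← Real.rpow_one ‖z‖]
    rw [← Real.rpow_add h0]; norm_num
  have he : ‖Complex.exp (-z)‖ ≤ 1 := by rw [Complex.norm_exp]; simpa using hz
  have he' : Real.exp (-z.re) ≤ 1 := by simpa using hz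
  rw [key]
  refine (norm_sub_le _ _).trans ?_
  refine (add_le_add_left (norm_add_le _ _) _).trans ?_
  have t1 := one_sub_exp_le hz
  have t2 : ‖Complex.exp (-z) * (2 * z * (M - G))‖ ≤ 2 * c * P * ‖z‖^(1/2:ℝ) := by
    rw [norm_mul, norm_mul, norm_mul]
    calc _ ≤ 1 * (2 * ‖z‖ * (c * ‖z‖^(-1/2:ℝ) * P)) := by
          gcongr; norm_num
      _ = _ := by rw [← hz12]; ring
  have t3 : ‖z * Kc z‖ ≤ C * ‖z‖^(1/2:ℝ) := by
    rw [norm_mul]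
    have := hb z hz0 (by simpa using hz)
    calc _ ≤ ‖z‖ * (C * ‖z‖^(-(1/2):ℝ) * 1) := by
          refine mul_le_mul_of_nonneg_left (this.trans ?_) (norm_nonneg _)
          gcongr
      _ = _ := by rw [← hz12]; ring_nf
  rw [Real.rpow_one]
  have := Real.rpow_pos_of_pos h0 (1/2)
  have hcP : 0 ≤ c * P := by positivity
  nlinarith

lemma Kc_real {t : ℝ} (ht : 0 < t) : Kc t = (besselK0 t : ℂ) := by
  set s := Real.sqrt (2*t)
  have hs : 0 < s := Real.sqrt_pos.2 (by positivity)
  have hs2 : s^2 = 2*t := Real.sq_sqrt (by positivity)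
  set f : ℝ → ℝ := fun v => s * Real.sinh (v/2)
  have hd : ∀ v, HasDerivAt f (s/2 * Real.cosh (v/2)) v := by
    intro v
    refine (((hasDerivAt_id v).div_const 2).sinh.const_mul s).congr_deriv ?_
    simp; ring
  have himg : f '' Ioi 0 = Ioi 0 := by
    ext r
    simp only [mem_image, mem_Ioi]
    constructor
    · rintro ⟨v, hv, rfl⟩
      have : 0 < Real.sinh (v/2) := Real.sinh_pos_iff.2 (by linarith)
      positivity
    · intro hr
      refine ⟨2 * Real.arsinh (r/s), ?_, ?_⟩
      · have : 0 < Real.arsinh (r/s) := Real.arsinh_pos_iff.2 (by positivity)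
        linarith
      · simp only [f]
        rw [mul_div_cancel_left₀ _ two_ne_zero, Real.sinh_arsinh]
        field_simp
  have hinj : InjOn f (Ioi 0) := by
    intro a _ b _ hab
    have := Real.sinh_injective (mul_left_cancel₀ hs.ne' hab)
    linarith
  have := integral_image_eq_integral_abs_deriv_smul (f := f) (f' := fun v => s/2 * Real.cosh (v/2)) measurableSet_Ioi (fun v _ => (hd v).hasDerivWithinAt) hinj (fun r => hF t r)
  rw [himg] at this
  unfold Kc hK besselK0
  rw [this, ← integral_complex_ofReal, ← integral_const_mul, ← integral_const_mul]
  refine setIntegral_congr_fun measurableSet_Ioi fun v hv => ?_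
  have hc := Real.cosh_pos (v/2)
  rw [abs_of_pos (by positivity)]
  unfold hF qf
  have e0 : (f v)^2 + 2*t = (s * Real.cosh (v/2))^2 := by
    simp only [f]; rw [mul_pow, mul_pow, ← hs2, Real.cosh_sq]; ring
  have e1 : ((f v : ℝ):ℂ)^2 + 2*(t:ℂ) = (((s * Real.cosh (v/2))^2 : ℝ):ℂ) := by
    rw [← e0]; push_cast; ring
  rw [e1, ← Complex.ofReal_cpow (by positivity)]
  have e2 : ((s * Real.cosh (v/2))^2)^(-1/2:ℝ) = (s * Real.cosh (v/2))⁻¹ := by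
    rw [← Real.rpow_natCast, ← Real.rpow_mul (by positivity)]
    norm_num
    rw [Real.rpow_neg (by positivity), Real.rpow_one]
    ring
  rw [e2]
  have e3 : Real.cosh v = 1 + 2 * Real.sinh (v/2)^2 := by
    have h1 := Real.cosh_two_mul (v/2)
    have h2 := Real.cosh_sq (v/2)
    rw [show 2 * (v/2) = v by ring] at h1
    linarith
  have e4 : Complex.exp (-(t:ℂ)) * (2 * ((s/2*Real.cosh (v/2)) • (Complex.exp (-((f v:ℝ):ℂ)^2) * (((s * Real.cosh (v/2))⁻¹ : ℝ):ℂ))))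
     = ((Real.exp (-t) * (2 * ((s/2*Real.cosh (v/2)) * (Real.exp (-(f v)^2) * (s * Real.cosh (v/2))⁻¹))) : ℝ):ℂ) := by
    rw [Complex.real_smul]; push_cast; ring
  rw [e4]
  congr 1
  have e5 : Real.exp (-(t * Real.cosh v)) = Real.exp (-t) * Real.exp (-(f v)^2) := by
    rw [← Real.exp_add]; congr 1; simp only [f]; rw [e3, mul_pow, hs2]; ring
  rw [e5]
  field_simp

end BW


namespace BW
open MeasureTheory Set Topology

noncomputable def IF (z : ℂ) (θ : ℝ) : ℂ := Complex.exp (z * (Real.cos θ : ℂ))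

/-- the complex modified Bessel function `I₀` -/
noncomputable def I0c (z : ℂ) : ℂ := (1/Real.pi : ℂ) * ∫ θ in Ioc 0 Real.pi, IF z θ

lemma I0c_real (t : ℝ) : I0c t = (besselI0 t : ℂ) := by
  unfold I0c besselI0
  rw [intervalIntegral.integral_of_le Real.pi_pos.le]
  push_cast
  rw [← integral_complex_ofReal]
  congr 1
  refine integral_congr_ae (Eventually.of_forall fun θ => ?_)
  simp [IF]

lemma norm_IF (z : ℂ) (θ : ℝ) : ‖IF z θ‖ ≤ Real.exp |z.re| := by
  unfold IF
  rw [Complex.norm_exp]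
  apply Real.exp_le_exp.2
  rw [Complex.re_mul_ofReal]
  calc z.re * Real.cos θ ≤ |z.re * Real.cos θ| := le_abs_self _
    _ = |z.re| * |Real.cos θ| := abs_mul _ _
    _ ≤ |z.re| * 1 := by gcongr; exact Real.abs_cos_le_one θ
    _ = _ := mul_one _

lemma cont_IF (z : ℂ) : Continuous (IF z) := by
  unfold IF
  have := Real.continuous_cos
  fun_prop

lemma IF_hasDerivAt (z : ℂ) (θ : ℝ) : HasDerivAt (fun z => IF z θ) (Real.cos θ * IF z θ) z := by
  unfold IF
  have := ((hasDerivAt_id z).mul_const ((Real.cos θ : ℝ):ℂ)).cexp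
  refine this.congr_deriv ?_
  simp; ring

lemma IF_LD (z0 : ℂ) : LD (volume.restrict (Ioc 0 Real.pi)) IF z0 := by
  refine ⟨1, one_pos, fun _ => Real.exp (|z0.re| + 1), integrable_const _, fun z _ => (cont_IF z).aestronglyMeasurable,
    Eventually.of_forall fun θ => ⟨fun z _ => (IF_hasDerivAt z θ).differentiableAt.differentiableWithinAt, fun z hz => (norm_IF z θ).trans ?_⟩⟩
  apply Real.exp_le_exp.2
  have h1 : |z.re - z0.re| ≤ ‖z - z0‖ := by rw [← Complex.sub_re]; exact Complex.abs_re_le_norm _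
  have h2 : ‖z - z0‖ < 1 := by simpa [dist_eq_norm] using hz
  have h3 := abs_sub_abs_le_abs_sub z.re z0.re
  linarith

lemma IF_deriv (z : ℂ) (θ : ℝ) : deriv (fun z => IF z θ) z = Real.cos θ * IF z θ := (IF_hasDerivAt z θ).deriv

lemma IF_deriv2 (z : ℂ) (θ : ℝ) : deriv (fun z => deriv (fun z => IF z θ) z) z = Real.cos θ ^ 2 * IF z θ := by
  have : (fun z => deriv (fun z => IF z θ) z) = fun z => Real.cos θ * IF z θ := funext fun z => IF_deriv z θ
  rw [this, ((IF_hasDerivAt z θ).const_mul _).deriv]; ring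

lemma I0c_hasDerivAt (z : ℂ) : HasDerivAt I0c ((1/Real.pi : ℂ) * ∫ θ in Ioc 0 Real.pi, deriv (fun z => IF z θ) z) z :=
  (IF_LD z).hasDerivAt.const_mul _

lemma I0c_diff (z : ℂ) : DifferentiableAt ℂ I0c z := (I0c_hasDerivAt z).differentiableAt

lemma I0c_hasDerivAt2' (z : ℂ) : HasDerivAt (deriv I0c) ((1/Real.pi : ℂ) * ∫ θ in Ioc 0 Real.pi, deriv (fun z => deriv (fun z => IF z θ) z) z) z := by
  have : deriv I0c = fun z => (1/Real.pi : ℂ) * ∫ θ in Ioc 0 Real.pi, deriv (fun z => IF z θ) z := funext fun z => (I0c_hasDerivAt z).deriv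
  rw [this]
  exact (IF_LD z).deriv.hasDerivAt.const_mul _

lemma I0c_hasDerivAt2 {z : ℂ} (hz : z ≠ 0) : HasDerivAt (deriv I0c) (I0c z - deriv I0c z / z) z := by
  refine (I0c_hasDerivAt2' z).congr_deriv ?_
  rw [(I0c_hasDerivAt z).deriv, I0c]
  have i0 := (IF_LD z).integrable
  have i1 := (IF_LD z).deriv.integrable
  have i2 := (IF_LD z).deriv.deriv.integrable
  have key : ∫ θ in Ioc 0 Real.pi, (z * deriv (fun z => deriv (fun z => IF z θ) z) z + deriv (fun z => IF z θ) z - z * IF z θ) = 0 := by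
    rw [← intervalIntegral.integral_of_le Real.pi_pos.le]
    have := intervalIntegral.integral_eq_sub_of_hasDerivAt (a := 0) (b := Real.pi) (f := fun θ : ℝ => (Real.sin θ : ℂ) * IF z θ)
      (f' := fun θ => z * deriv (fun z => deriv (fun z => IF z θ) z) z + deriv (fun z => IF z θ) z - z * IF z θ) ?_ ?_
    · rw [this]; simp
    · intro θ _
      rw [IF_deriv2, IF_deriv]
      have d1 : HasDerivAt (fun θ : ℝ => (Real.sin θ : ℂ)) (Real.cos θ : ℂ) θ := (Real.hasDerivAt_sin θ).ofReal_comp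
      have d2 : HasDerivAt (fun θ : ℝ => (Real.cos θ : ℂ)) ((-Real.sin θ : ℝ) : ℂ) θ := (Real.hasDerivAt_cos θ).ofReal_comp
      have d3 : HasDerivAt (fun θ : ℝ => IF z θ) (IF z θ * (z * ((-Real.sin θ : ℝ) : ℂ))) θ := (d2.const_mul z).cexp
      refine (d1.fun_mul d3).congr_deriv ?_
      have h := Real.sin_sq_add_cos_sq θ
      have h : (Real.sin θ : ℂ)^2 + (Real.cos θ : ℂ)^2 = 1 := by exact_mod_cast h
      rw [Complex.ofReal_neg]
      linear_combination (-z * IF z θ) * h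
    · rw [intervalIntegrable_iff_integrableOn_Ioc_of_le Real.pi_pos.le]
      exact ((i2.const_mul z).add i1).sub (i0.const_mul z)
  rw [integral_sub (f := fun θ => z * deriv (fun z => deriv (fun z => IF z θ) z) z + deriv (fun z => IF z θ) z) ((i2.const_mul z).add i1) (i0.const_mul z),
    integral_add (i2.const_mul z) i1, integral_const_mul, integral_const_mul] at key
  have hpi : (Real.pi:ℂ) ≠ 0 := by exact_mod_cast Real.pi_ne_zero
  field_simp
  linear_combination key

lemma norm_I0c (z : ℂ) : ‖I0c z‖ ≤ Real.exp |z.re| := by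
  unfold I0c
  have := norm_integral_le_of_norm_le_const (μ := volume.restrict (Ioc 0 Real.pi)) (C := Real.exp |z.re|) (Eventually.of_forall fun θ => norm_IF z θ)
  rw [norm_mul]
  have h2 : ‖(1/Real.pi:ℂ)‖ = 1/Real.pi := by simp [abs_of_pos Real.pi_pos]
  have h3 : (volume.restrict (Ioc 0 Real.pi)).real univ = Real.pi := by simp [Measure.real, Real.pi_pos.le]
  rw [h2]; rw [h3] at this
  have hp := Real.pi_pos
  calc _ ≤ 1/Real.pi * (Real.exp |z.re| * Real.pi) := by gcongr
    _ = _ := by field_simp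

lemma norm_I0c_deriv (z : ℂ) : ‖deriv I0c z‖ ≤ Real.exp |z.re| := by
  rw [(I0c_hasDerivAt z).deriv]
  have := norm_integral_le_of_norm_le_const (μ := volume.restrict (Ioc 0 Real.pi)) (f := fun θ => deriv (fun z => IF z θ) z) (C := Real.exp |z.re|) (Eventually.of_forall fun θ => by
    rw [IF_deriv, norm_mul, Complex.norm_real, Real.norm_eq_abs]
    calc _ ≤ 1 * Real.exp |z.re| := by gcongr; exact Real.abs_cos_le_one θ; exact norm_IF z θ
      _ = _ := one_mul _)
  rw [norm_mul]
  have h2 : ‖(1/Real.pi:ℂ)‖ = 1/Real.pi := by simp [abs_of_pos Real.pi_pos]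
  have h3 : (volume.restrict (Ioc 0 Real.pi)).real univ = Real.pi := by simp [Measure.real, Real.pi_pos.le]
  rw [h2]; rw [h3] at this
  have hp := Real.pi_pos
  calc _ ≤ 1/Real.pi * (Real.exp |z.re| * Real.pi) := by gcongr
    _ = _ := by field_simp

lemma I0c_zero : I0c 0 = 1 := by
  unfold I0c IF
  have hpi : (Real.pi:ℂ) ≠ 0 := by exact_mod_cast Real.pi_ne_zero
  simp [Real.pi_pos.le, hpi]

lemma I0c_neg (z : ℂ) : I0c (-z) = I0c z := by
  unfold I0c
  congr 1
  rw [← intervalIntegral.integral_of_le Real.pi_pos.le, ← intervalIntegral.integral_of_le Real.pi_pos.le]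
  have := intervalIntegral.integral_comp_sub_left (a := 0) (b := Real.pi) (fun θ => IF z θ) Real.pi
  simp only [sub_self, sub_zero] at this
  rw [← this]
  congr 1
  funext θ
  simp [IF, Real.cos_pi_sub]

lemma I0c_sub_one (y : ℝ) : ‖I0c (Complex.I * y) - 1‖ ≤ |y| := by
  have hd : ∀ x ∈ (univ : Set ℝ), HasDerivWithinAt (fun y : ℝ => I0c (Complex.I * y)) (deriv I0c (Complex.I * x) * Complex.I) univ x := by
    intro x _
    have d1 : HasDerivAt (fun y : ℝ => Complex.I * (y:ℂ)) Complex.I x := by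
      simpa using (Complex.ofRealCLM.hasDerivAt (x := x)).const_mul Complex.I
    exact ((I0c_diff (Complex.I * x)).hasDerivAt.comp x d1).hasDerivWithinAt
  have := convex_univ.norm_image_sub_le_of_norm_hasDerivWithin_le (C := 1) hd ?_ (mem_univ 0) (mem_univ y)
  · simpa [I0c_zero] using this
  · intro x _
    rw [norm_mul, Complex.norm_I, mul_one]
    simpa using norm_I0c_deriv (Complex.I * x)

end BW


namespace BW
open MeasureTheory Set Topology

/-- a pair `(f, θ f)` solving `θ² f = - y² f` on the half line -/
def Ray (f f1 : ℝ → ℂ) : Prop := ∀ y : ℝ, 0 < y → HasDerivAt f (f1 y / y) y ∧ HasDerivAt f1 (-(y * f y)) y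

lemma Ray.lin {f f1 g g1 : ℝ → ℂ} (hf : Ray f f1) (hg : Ray g g1) (a b : ℂ) :
    Ray (fun y => a * f y + b * g y) (fun y => a * f1 y + b * g1 y) := by
  intro y hy
  obtain ⟨h1, h2⟩ := hf y hy
  obtain ⟨h3, h4⟩ := hg y hy
  refine ⟨((h1.const_mul a).fun_add (h3.const_mul b)).congr_deriv (by ring), ((h2.const_mul a).fun_add (h4.const_mul b)).congr_deriv (by ring)⟩

lemma Ray.of {f : ℂ → ℂ} {e : ℂ} (he : e^2 = -1) (h : ∀ y : ℝ, 0 < y → DifferentiableAt ℂ f (e*y) ∧ HasDerivAt (deriv f) (f (e*y) - deriv f (e*y) / (e*y)) (e*y)) :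
    Ray (fun y => f (e*y)) (fun y => (e*y) * deriv f (e*y)) := by
  intro y hy
  obtain ⟨h1, h2⟩ := h y hy
  have hyc : (y:ℂ) ≠ 0 := by exact_mod_cast hy.ne'
  have he0 : e ≠ 0 := by rintro rfl; norm_num at he
  have d1 : HasDerivAt (fun y : ℝ => e * (y:ℂ)) e y := by
    simpa using (Complex.ofRealCLM.hasDerivAt (x := y)).const_mul e
  have h3 : HasDerivAt (fun y : ℝ => deriv f (e*y)) ((f (e*y) - deriv f (e*y) / (e*y)) * e) y := HasDerivAt.comp (h₂ := deriv f) (h := fun y : ℝ => e * (y:ℂ)) y h2 d1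
  refine ⟨(h1.hasDerivAt.comp y d1).congr_deriv (by field_simp), (d1.fun_mul h3).congr_deriv ?_⟩
  field_simp
  linear_combination y * f (e*y) * he

lemma const_of {F : ℝ → ℂ} {L : ℂ} {α : ℝ} (hα : 0 < α) (hF : ∀ y : ℝ, 0 < y → HasDerivAt F 0 y) (hp : PB α fun y => F y - L) :
    ∀ y : ℝ, 0 < y → F y = L := by
  intro y0 hy0
  have hc : ∀ y : ℝ, 0 < y → F y = F y0 := by
    intro y hy
    refine isOpen_Ioi.is_const_of_deriv_eq_zero (s := Ioi 0) isPreconnected_Ioi (fun y hy => (hF y hy).differentiableAt.differentiableWithinAt) (fun y hy => (hF y hy).deriv) hy hy0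
  obtain ⟨C, b, hC, hab, h⟩ := hp
  have hb : 0 < b := by linarith
  have ht : Tendsto (fun y : ℝ => C * (y^α + y^b)) (𝓝[>] 0) (𝓝 0) := by
    have hcn : Continuous (fun y : ℝ => C * (y^α + y^b)) := by
      have := Real.continuous_rpow_const hα.le
      have := Real.continuous_rpow_const hb.le
      fun_prop
    have := hcn.tendsto 0
    simp only [Real.zero_rpow hα.ne', Real.zero_rpow hb.ne', add_zero, mul_zero] at this
    exact this.mono_left nhdsWithin_le_nhds
  have : ‖F y0 - L‖ ≤ 0 := by
    refine ge_of_tendsto ht ?_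
    filter_upwards [self_mem_nhdsWithin] with y hy
    rw [← hc y hy]; exact h y hy
  exact sub_eq_zero.1 (norm_le_zero_iff.1 this)

lemma Ray.wronskian {f f1 g g1 : ℝ → ℂ} (hf : Ray f f1) (hg : Ray g g1) (y : ℝ) (hy : 0 < y) :
    HasDerivAt (fun y => f y * g1 y - g y * f1 y) 0 y := by
  obtain ⟨h1, h2⟩ := hf y hy
  obtain ⟨h3, h4⟩ := hg y hy
  have hyc : (y:ℂ) ≠ 0 := by exact_mod_cast hy.ne'
  refine ((h1.fun_mul h4).fun_sub (h3.fun_mul h2)).congr_deriv ?_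
  field_simp; ring

noncomputable def Af (y : ℝ) : ℂ := Kc (-Complex.I * y)
noncomputable def Bf (y : ℝ) : ℂ := Kc (Complex.I * y)
noncomputable def Jf (y : ℝ) : ℂ := (Real.pi/2) * I0c (Complex.I * y)
noncomputable def A1f (y : ℝ) : ℂ := (-Complex.I * y) * deriv Kc (-Complex.I * y)
noncomputable def B1f (y : ℝ) : ℂ := (Complex.I * y) * deriv Kc (Complex.I * y)
noncomputable def J1f (y : ℝ) : ℂ := (Real.pi/2) * ((Complex.I * y) * deriv I0c (Complex.I * y))

lemma slit_I {y : ℝ} (hy : 0 < y) : Complex.I * y ∈ Complex.slitPlane := by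
  rw [Complex.mem_slitPlane_iff]; right; simpa using hy.ne'
lemma slit_nI {y : ℝ} (hy : 0 < y) : -Complex.I * y ∈ Complex.slitPlane := by
  rw [Complex.mem_slitPlane_iff]; right; simpa using hy.ne'

lemma ray_A : Ray Af A1f := Ray.of (f := Kc) (e := -Complex.I) (by simp) fun _ hy => ⟨Kc_diff (slit_nI hy), Kc_hasDerivAt2 (slit_nI hy)⟩
lemma ray_B : Ray Bf B1f := Ray.of (f := Kc) (e := Complex.I) (by simp) fun _ hy => ⟨Kc_diff (slit_I hy), Kc_hasDerivAt2 (slit_I hy)⟩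
lemma ray_J : Ray Jf J1f := by
  have := (Ray.of (f := I0c) (e := Complex.I) (by simp) fun y hy => ⟨I0c_diff _, I0c_hasDerivAt2 (Complex.slitPlane_ne_zero (slit_I hy))⟩)
  have := this.lin this (Real.pi/2) 0
  simp only [zero_mul, add_zero] at this
  exact this

lemma PB_A {η : ℝ} (hη : 0 < η) (hη1 : η ≤ 1/2) : PB (-η) Af := by
  obtain ⟨C, hC, h⟩ := Kc_bound one_pos le_rfl hη hη1
  refine PB.of_le C fun y hy => ?_
  have := h _ (Complex.slitPlane_ne_zero (slit_nI hy)) (by simp)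
  unfold Af
  simpa [abs_of_pos hy] using this
lemma PB_B {η : ℝ} (hη : 0 < η) (hη1 : η ≤ 1/2) : PB (-η) Bf := by
  obtain ⟨C, hC, h⟩ := Kc_bound one_pos le_rfl hη hη1
  refine PB.of_le C fun y hy => ?_
  have := h _ (Complex.slitPlane_ne_zero (slit_I hy)) (by simp)
  unfold Bf
  simpa [abs_of_pos hy] using this
lemma PB_A1 : PB (1/2) fun y => A1f y + 1 := by
  obtain ⟨C, hC, h⟩ := Kc_theta
  refine ⟨C, 1, hC, by norm_num, fun y hy => ?_⟩
  have := h _ (Complex.slitPlane_ne_zero (slit_nI hy)) (by simp)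
  have e : ‖-Complex.I * (y:ℂ)‖ = y := by simp [abs_of_pos hy]
  rwa [e] at this
lemma PB_B1 : PB (1/2) fun y => B1f y + 1 := by
  obtain ⟨C, hC, h⟩ := Kc_theta
  refine ⟨C, 1, hC, by norm_num, fun y hy => ?_⟩
  have := h _ (Complex.slitPlane_ne_zero (slit_I hy)) (by simp)
  have e : ‖Complex.I * (y:ℂ)‖ = y := by simp [abs_of_pos hy]
  rwa [e] at this
lemma PB_J : PB 0 Jf := by
  refine PB.of_le (Real.pi/2) fun y hy => ?_
  unfold Jf
  rw [norm_mul]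
  have := norm_I0c (Complex.I * y)
  have h2 : ‖(Real.pi/2:ℂ)‖ = Real.pi/2 := by simp [abs_of_pos Real.pi_pos]
  rw [h2, Real.rpow_zero]
  have hp := Real.pi_pos
  gcongr
  simpa using this
lemma PB_J1 : PB (1/2) J1f := by
  refine PB.mono (α := 1) (PB.of_le (Real.pi/2) fun y hy => ?_) (by norm_num)
  unfold J1f
  rw [norm_mul, norm_mul]
  have := norm_I0c_deriv (Complex.I * y)
  have h2 : ‖(Real.pi/2:ℂ)‖ = Real.pi/2 := by simp [abs_of_pos Real.pi_pos]
  have e : ‖Complex.I * (y:ℂ)‖ = y := by simp [abs_of_pos hy]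
  rw [h2, Real.rpow_one, e]
  have hp := Real.pi_pos
  have h3 : ‖deriv I0c (Complex.I * y)‖ ≤ 1 := by simpa using this
  calc _ ≤ Real.pi/2 * (y * 1) := by gcongr
    _ = _ := by ring
lemma PB_J0 : PB (1/2) fun y => Jf y - Real.pi/2 := by
  refine PB.mono (α := 1) (PB.of_le (Real.pi/2) fun y hy => ?_) (by norm_num)
  have : Jf y - Real.pi/2 = (Real.pi/2) * (I0c (Complex.I * y) - 1) := by unfold Jf; ring
  rw [this, norm_mul]
  have := I0c_sub_one y
  have h2 : ‖(Real.pi/2:ℂ)‖ = Real.pi/2 := by simp [abs_of_pos Real.pi_pos]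
  rw [h2, Real.rpow_one]
  rw [abs_of_pos hy] at this
  have hp := Real.pi_pos
  gcongr

lemma PB_arc : PB (1/2) fun y => Af y - Bf y - Complex.I * Real.pi := by
  obtain ⟨C, hC, h⟩ := Kc_theta
  refine ⟨C * Real.pi, 1, by positivity, by norm_num, fun y hy => ?_⟩
  set z : ℝ → ℂ := fun φ => (y:ℂ) * Complex.exp (φ * Complex.I)
  have hz : ∀ φ, HasDerivAt z (z φ * Complex.I) φ := by
    intro φ
    have d1 : HasDerivAt (fun φ : ℝ => (φ:ℂ) * Complex.I) Complex.I φ := by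
      simpa using (Complex.ofRealCLM.hasDerivAt (x := φ)).mul_const Complex.I
    exact (d1.cexp.const_mul (y:ℂ)).congr_deriv (by simp only [z]; ring)
  have hn : ∀ φ, ‖z φ‖ = y := fun φ => by simp [z, abs_of_pos hy, Complex.norm_exp_ofReal_mul_I]
  have hre : ∀ φ, (z φ).re = y * Real.cos φ := fun φ => by
    simp only [z, Complex.re_ofReal_mul, Complex.exp_ofReal_mul_I_re]
  have h0 : ∀ φ, z φ ≠ 0 := fun φ => by rw [← norm_pos_iff, hn]; exact hy
  have hre0 : ∀ φ ∈ Icc (-(Real.pi/2)) (Real.pi/2), 0 ≤ (z φ).re := fun φ hφ => by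
    rw [hre]; exact mul_nonneg hy.le (Real.cos_nonneg_of_mem_Icc hφ)
  have hd : ∀ φ ∈ Icc (-(Real.pi/2)) (Real.pi/2), HasDerivWithinAt (fun φ : ℝ => Kc (z φ) + Complex.I * φ) (Complex.I * (z φ * deriv Kc (z φ) + 1)) (Icc (-(Real.pi/2)) (Real.pi/2)) φ := by
    intro φ hφ
    have d2 : HasDerivAt (fun φ : ℝ => Complex.I * (φ:ℂ)) Complex.I φ := by
      simpa using (Complex.ofRealCLM.hasDerivAt (x := φ)).const_mul Complex.I
    have d3 := ((Kc_diff (slit_of_re (h0 φ) (hre0 φ hφ))).hasDerivAt.comp φ (hz φ)).fun_add d2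
    exact (d3.congr_deriv (by ring)).hasDerivWithinAt
  have hp := Real.pi_pos
  have := (convex_Icc _ _).norm_image_sub_le_of_norm_hasDerivWithin_le (C := C * (y^(1/2:ℝ) + y^(1:ℝ))) hd ?_ (x := -(Real.pi/2)) (y := Real.pi/2) ⟨le_rfl, by linarith⟩ ⟨by linarith, le_rfl⟩
  · have e1 : z (Real.pi/2) = Complex.I * y := by
      simp only [z]; push_cast; rw [Complex.exp_pi_div_two_mul_I, mul_comm]
    have e2 : z (-(Real.pi/2)) = -Complex.I * y := by
      simp only [z]; push_cast; rw [neg_mul, Complex.exp_neg, Complex.exp_pi_div_two_mul_I, Complex.inv_I, mul_comm]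
    rw [e1, e2] at this
    have e3 : ‖Real.pi/2 - -(Real.pi/2)‖ = Real.pi := by
      rw [Real.norm_of_nonneg (by linarith)]; ring
    rw [e3] at this
    have e4 : Af y - Bf y - Complex.I * Real.pi = -(Kc (Complex.I * y) + Complex.I * ((Real.pi/2 : ℝ):ℂ) - (Kc (-Complex.I * y) + Complex.I * ((-(Real.pi/2) : ℝ):ℂ))) := by
      unfold Af Bf; push_cast; ring
    show ‖Af y - Bf y - Complex.I * Real.pi‖ ≤ _
    rw [e4, norm_neg]
    refine this.trans (le_of_eq (by ring))
  · intro φ hφ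
    rw [norm_mul, Complex.norm_I, one_mul]
    have := h (z φ) (h0 φ) (hre0 φ hφ)
    rwa [hn] at this

lemma AB_J (y : ℝ) (hy : 0 < y) : Af y - Bf y = 2 * Complex.I * Jf y := by
  set g : ℝ → ℂ := fun y => 1 * (1 * Af y + (-1) * Bf y) + (-2 * Complex.I) * Jf y
  set g1 : ℝ → ℂ := fun y => 1 * (1 * A1f y + (-1) * B1f y) + (-2 * Complex.I) * J1f y
  have hg : Ray g g1 := (ray_A.lin ray_B 1 (-1)).lin ray_J 1 (-2 * Complex.I)
  have pA : PB (-(1/4)) Af := PB_A (by norm_num) (by norm_num)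
  have pg : PB (1/2) g := (PB_arc.add (PB_J0.const_mul (-2 * Complex.I))).congr fun y _ => by simp only [g]; ring
  have pg1 : PB (1/2) g1 := ((PB_A1.sub PB_B1).add (PB_J1.const_mul (-2 * Complex.I))).congr fun y _ => by simp only [g1]; ring
  have pA1 : PB 0 A1f := ((PB_A1.mono (by norm_num)).sub (PB.const 1)).congr fun y _ => by ring
  have w1 : g y * J1f y - Jf y * g1 y = 0 := by
    refine const_of (α := 1/2) (by norm_num) (hg.wronskian ray_J) ?_ y hy
    have h1 := (pg.mul PB_J1).mono (β := 1/2) (by norm_num)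
    have h2 := (PB_J.mul pg1).mono (β := 1/2) (by norm_num)
    exact (h1.sub h2).congr fun y _ => by ring
  have w2 : g y * A1f y - Af y * g1 y = 0 := by
    refine const_of (α := 1/4) (by norm_num) (hg.wronskian ray_A) ?_ y hy
    have h1 := (pg.mul pA1).mono (β := 1/4) (by norm_num)
    have h2 := (pA.mul pg1).mono (β := 1/4) (by norm_num)
    exact (h1.sub h2).congr fun y _ => by ring
  have w3 : Af y * J1f y - Jf y * A1f y = Real.pi/2 := by
    refine const_of (α := 1/4) (by norm_num) (ray_A.wronskian ray_J) ?_ y hy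
    have h1 := (pA.mul PB_J1).mono (β := 1/4) (by norm_num)
    have h2 := (PB_J.mul PB_A1).mono (β := 1/4) (by norm_num)
    have h3 := PB_J0.mono (β := 1/4) (by norm_num)
    exact ((h1.sub h2).add h3).congr fun y _ => by ring
  have h : g y * (Real.pi/2) = 0 := by
    rw [← w3]; linear_combination Af y * w1 - Jf y * w2
  have hpi : (Real.pi:ℂ)/2 ≠ 0 := by simp [Real.pi_ne_zero]
  have := (mul_eq_zero.1 h).resolve_right hpi
  simp only [g] at this
  linear_combination this

lemma isPreconnected_uhp : IsPreconnected {z : ℂ | 0 < z.im} := (convex_halfSpace_im_gt 0).isPreconnected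

lemma slit_neg_of_im {z : ℂ} (hz : 0 < z.im) : -z ∈ Complex.slitPlane := by
  rw [Complex.mem_slitPlane_iff]; right; simpa using hz.ne'
lemma slit_of_im {z : ℂ} (hz : 0 < z.im) : z ∈ Complex.slitPlane := by
  rw [Complex.mem_slitPlane_iff]; right; exact hz.ne'

lemma connection {z : ℂ} (hz : 0 < z.im) : Kc (-z) - Kc z = Complex.I * Real.pi * I0c z := by
  have hop : IsOpen {z : ℂ | 0 < z.im} := isOpen_lt continuous_const Complex.continuous_im
  set f : ℂ → ℂ := fun z => Kc (-z) - Kc z - Complex.I * Real.pi * I0c z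
  have hf : DifferentiableOn ℂ f {z : ℂ | 0 < z.im} := by
    intro z hz
    have h1 : DifferentiableAt ℂ (fun z => Kc (-z)) z :=
      DifferentiableAt.comp z (Kc_diff (slit_neg_of_im hz)) differentiableAt_id.neg
    exact ((h1.sub (Kc_diff (slit_of_im hz))).sub ((I0c_diff z).const_mul _)).differentiableWithinAt
  have ha := hf.analyticOnNhd hop
  have h0 : ∃ᶠ z in 𝓝[≠] Complex.I, f z = 0 := by
    have ht : Tendsto (fun n : ℕ => Complex.I * (((1 + 1/((n:ℝ)+1)) : ℝ):ℂ)) atTop (𝓝[≠] Complex.I) := by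
      rw [tendsto_nhdsWithin_iff]
      constructor
      · have h1 := (tendsto_one_div_add_atTop_nhds_zero_nat (𝕜 := ℝ)).const_add 1
        have := ((Complex.continuous_ofReal.tendsto _).comp h1).const_mul Complex.I
        simpa [Function.comp_def] using this
      · refine Eventually.of_forall fun n => ?_
        have : (0:ℝ) < 1/((n:ℝ)+1) := by positivity
        intro h
        have := congrArg Complex.im h
        simp at this
        have h3 : (n:ℝ) + 1 ≠ 0 := by positivity
        norm_cast at this
    refine ht.frequently (Frequently.of_forall fun n => ?_)
    have hy : (0:ℝ) < 1 + 1/((n:ℝ)+1) := by positivity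
    have := AB_J _ hy
    simp only [f]
    unfold Af Bf Jf at this
    rw [neg_mul] at this
    rw [this]; ring
  have := ha.eqOn_zero_of_preconnected_of_frequently_eq_zero isPreconnected_uhp (z₀ := Complex.I) (by simp) h0 hz
  exact sub_eq_zero.1 this

end BW


namespace BW
open MeasureTheory Set Topology

/-- principal square root -/
noncomputable def sq (v : ℂ) : ℂ := v ^ (1/2 : ℂ)

lemma sq_sq (v : ℂ) : sq v ^ 2 = v := by
  unfold sq
  rw [← Complex.cpow_nat_mul]; norm_num

lemma sq_re_pos {v : ℂ} (hv : v ∈ Complex.slitPlane) : 0 < (sq v).re := by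
  unfold sq
  rw [Complex.cpow_def_of_ne_zero (Complex.slitPlane_ne_zero hv), Complex.exp_re]
  refine mul_pos (Real.exp_pos _) ?_
  have : (Complex.log v * (1/2)).im = v.arg / 2 := by
    rw [show (1/2:ℂ) = ((1/2:ℝ):ℂ) by push_cast; ring, Complex.im_mul_ofReal, Complex.log_im]; ring
  rw [this]
  have h1 := Complex.neg_pi_lt_arg v
  have h2 := Complex.arg_le_pi v
  have h3 : v.arg ≠ Real.pi := (Complex.mem_slitPlane_iff_arg.1 hv).1
  have h4 := lt_of_le_of_ne h2 h3
  exact Real.cos_pos_of_mem_Ioo ⟨by linarith, by linarith⟩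

lemma sq_ne {v : ℂ} (hv : v ∈ Complex.slitPlane) : sq v ≠ 0 := by
  intro h; have := sq_re_pos hv; rw [h] at this; simp at this

lemma sq_of_sq {s : ℂ} (hs : 0 < s.re) : sq (s^2) = s := by
  have hs0 : s ≠ 0 := by rintro rfl; simp at hs
  have h : (sq (s^2))^2 = s^2 := sq_sq _
  have hm : s^2 ∈ Complex.slitPlane := by
    rw [Complex.mem_slitPlane_iff]
    by_cases hi : s.im = 0
    · left; simp [pow_two, hi]; positivity
    · right
      simp [pow_two]
      intro h2
      have : s.re * s.im = 0 := by linarith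
      rcases mul_eq_zero.1 this with h3 | h3
      · linarith
      · exact hi h3
  rcases sq_eq_sq_iff_eq_or_eq_neg.1 h with h1 | h1
  · exact h1
  · have := sq_re_pos hm
    rw [h1] at this; simp at this; linarith

lemma sq_hasDerivAt {v : ℂ} (hv : v ∈ Complex.slitPlane) : HasDerivAt sq (1/(2 * sq v)) v := by
  have := (hasDerivAt_id v).cpow_const (c := (1/2:ℂ)) hv
  refine this.congr_deriv ?_
  have h0 := Complex.slitPlane_ne_zero hv
  have hs := sq_ne hv
  have h2 := sq_sq v
  simp only [id]
  rw [Complex.cpow_sub _ _ h0, Complex.cpow_one]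
  change 1/2 * (sq v / v) * 1 = _
  field_simp
  linear_combination h2

lemma smul_slit {s : ℂ} (hs : s ∈ Complex.slitPlane) {y : ℝ} (hy : 0 < y) : s * y ∈ Complex.slitPlane := by
  rw [Complex.mem_slitPlane_iff] at *
  rw [Complex.re_mul_ofReal, Complex.im_mul_ofReal]
  rcases hs with h | h
  · left; positivity
  · right; exact mul_ne_zero h hy.ne'

lemma sq_slit {v : ℂ} (hv : v ∈ Complex.slitPlane) : sq v ∈ Complex.slitPlane :=
  Or.inl (sq_re_pos hv)

lemma Kv_hasDerivAt {v : ℂ} (hv : v ∈ Complex.slitPlane) {y : ℝ} (hy : 0 < y) :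
    HasDerivAt (fun v => Kc (sq v * y)) (deriv Kc (sq v * y) * (y / (2 * sq v))) v := by
  have h1 := (Kc_diff (smul_slit (sq_slit hv) hy)).hasDerivAt
  have := HasDerivAt.comp (h₂ := Kc) (h := fun v => sq v * y) v h1 ((sq_hasDerivAt hv).mul_const (y:ℂ))
  exact this.congr_deriv (by ring)

lemma Kv_ode {v : ℂ} (hv : v ∈ Complex.slitPlane) {y : ℝ} (hy : 0 < y) :
    deriv (fun v => Kc (sq v * y)) v + v * deriv (fun v => deriv (fun v => Kc (sq v * y)) v) v = y^2/4 * Kc (sq v * y) := by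
  have hyc : (y:ℂ) ≠ 0 := by exact_mod_cast hy.ne'
  have hs := sq_ne hv
  have h : (fun v => deriv (fun v => Kc (sq v * y)) v) =ᶠ[𝓝 v] fun v => deriv Kc (sq v * y) * (y / (2 * sq v)) := by
    filter_upwards [Complex.isOpen_slitPlane.eventually_mem hv] with v hv using (Kv_hasDerivAt hv hy).deriv
  rw [h.deriv_eq, (Kv_hasDerivAt hv hy).deriv]
  have h1 := Kc_hasDerivAt2 (smul_slit (sq_slit hv) hy)
  have d1 := HasDerivAt.comp (h₂ := deriv Kc) (h := fun v => sq v * y) v h1 ((sq_hasDerivAt hv).mul_const (y:ℂ))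
  have d2 := (hasDerivAt_const v (y:ℂ)).fun_div ((sq_hasDerivAt hv).const_mul 2) (mul_ne_zero two_ne_zero hs)
  have d3 : HasDerivAt (fun v => deriv Kc (sq v * y) * (y / (2 * sq v))) _ v := d1.fun_mul d2
  rw [d3.deriv]
  have h2 := sq_sq v
  simp only [Function.comp]
  clear d1 d2 d3 h1 h
  generalize sq v = s at *
  clear hv
  subst h2
  field_simp
  ring

/-- Kernel transform -/
noncomputable def TF (g : ℝ → ℂ) (v : ℂ) (y : ℝ) : ℂ := Kc (sq v * y) * (g y * y)
noncomputable def Tr (g : ℝ → ℂ) (v : ℂ) : ℂ := ∫ y in Ioi (0:ℝ), TF g v y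

/-- nice functions -/
def GF (α : ℝ) (g : ℝ → ℂ) : Prop := ContinuousOn g (Ioi 0) ∧ PB α g

lemma Kline_cont {s : ℂ} (hs : s ∈ Complex.slitPlane) : ContinuousOn (fun y : ℝ => Kc (s * y)) (Ioi 0) := by
  intro y hy
  have h1 := (Kc_diff (smul_slit hs hy)).continuousAt
  have h2 : ContinuousAt (fun y : ℝ => s * (y:ℂ)) y := by fun_prop
  exact (ContinuousAt.comp (f := fun y : ℝ => s * (y:ℂ)) (g := Kc) h1 h2).continuousWithinAt

/-- local bound for `Kc` along rays -/
lemma Kray_bound {s0 : ℂ} (hs : s0 ∈ Complex.slitPlane) {η : ℝ} (hη : 0 < η) (hη1 : η ≤ 1/2) : ∃ C : ℝ, 0 ≤ C ∧ ∀ᶠ s in 𝓝 s0, ∀ y : ℝ, 0 < y →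
    ‖Kc (s * y)‖ ≤ C * y^(-η) * Real.exp (-(s.re * y)) := by
  obtain ⟨δ, hδ, hδ1, h⟩ := sector hs
  obtain ⟨C, hC, hb⟩ := Kc_bound hδ hδ1 hη hη1
  have h0 : 0 < ‖s0‖ := norm_pos_iff.2 (Complex.slitPlane_ne_zero hs)
  refine ⟨C * (‖s0‖/2)^(-η), by positivity, ?_⟩
  filter_upwards [h] with s ⟨h1, h2⟩ y hy
  have hs0 : 0 < ‖s‖ := by linarith
  have e : ‖s * y‖ = ‖s‖ * y := by simp [abs_of_pos hy]
  have := hb (s * y) (by rw [← norm_pos_iff, e]; positivity) (by rw [e, Complex.re_mul_ofReal]; nlinarith)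
  rw [e, Complex.re_mul_ofReal, Real.mul_rpow hs0.le hy.le] at this
  refine this.trans ?_
  have h3 : ‖s‖^(-η) ≤ (‖s0‖/2)^(-η) := Real.rpow_le_rpow_of_nonpos (by positivity) h2.le (by linarith)
  calc _ ≤ C * ((‖s0‖/2)^(-η) * y^(-η)) * Real.exp (-(s.re * y)) := by gcongr
    _ = _ := by ring

lemma TF_LD {g : ℝ → ℂ} {α : ℝ} (hα : -1 < α) (hg : GF α g) {v0 : ℂ} (hv : v0 ∈ Complex.slitPlane) :
    LD (volume.restrict (Ioi 0)) (TF g) v0 := by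
  obtain ⟨hc, C, b, hC, hab, hg⟩ := hg
  obtain ⟨D, hD, hK⟩ := Kray_bound (sq_slit hv) (η := 1/2) (by norm_num) (by norm_num)
  have hcs := (sq_hasDerivAt hv).continuousAt
  have hpos := sq_re_pos hv
  have h1 := hcs.eventually hK
  have h2 : ∀ᶠ v in 𝓝 v0, (sq v0).re/2 < (sq v).re :=
    (Filter.Tendsto.eventually_lt tendsto_const_nhds ((Complex.continuous_re.tendsto _).comp hcs) (by simpa using hpos))
  obtain ⟨R, hR, hball⟩ := Metric.eventually_nhds_iff_ball.1 ((h1.and h2).and (Complex.isOpen_slitPlane.eventually_mem hv))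
  refine ⟨R, hR, fun y => (D * C) * (y^(α+1/2) + y^(b+1/2)) * Real.exp (-((sq v0).re/2) * y), integrable_pe2 (by linarith) (by linarith) (by positivity), ?_, ?_⟩
  · intro v hv
    have h3 := (hball v hv).2
    refine ContinuousOn.aestronglyMeasurable ?_ measurableSet_Ioi
    exact (Kline_cont (sq_slit h3)).mul (hc.mul (by fun_prop))
  · refine ae_restrict_of_forall_mem measurableSet_Ioi fun y hy => ?_
    have hy : 0 < y := hy
    refine ⟨fun v hv => ?_, fun v hv => ?_⟩
    · exact ((Kv_hasDerivAt (hball v hv).2 hy).differentiableAt.mul_const _).differentiableWithinAt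
    · have e1 := (hball v hv).1.1 y hy
      have e2 := (hball v hv).1.2
      unfold TF
      rw [norm_mul, norm_mul, Complex.norm_real, Real.norm_of_nonneg hy.le]
      have e3 : Real.exp (-((sq v).re * y)) ≤ Real.exp (-((sq v0).re/2) * y) := by
        apply Real.exp_le_exp.2; nlinarith
      have e4 : ∀ a : ℝ, y^(a+1/2) = y^(-(1/2):ℝ) * (y^a * y) := by
        intro a
        nth_rewrite 4 [← Real.rpow_one y]
        rw [← Real.rpow_add hy, ← Real.rpow_add hy]; congr 1; ring
      show _ ≤ (D * C) * (y^(α+1/2) + y^(b+1/2)) * Real.exp (-((sq v0).re/2) * y)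
      rw [e4, e4]
      calc _ ≤ (D * y^(-(1/2):ℝ) * Real.exp (-((sq v0).re/2) * y)) * ((C * (y^α + y^b)) * y) := by
            gcongr
            · exact e1.trans (by gcongr)
            · exact hg y hy
        _ = _ := by ring

lemma Tr_hasDerivAt {g : ℝ → ℂ} {α : ℝ} (hα : -1 < α) (hg : GF α g) {v : ℂ} (hv : v ∈ Complex.slitPlane) :
    HasDerivAt (Tr g) (∫ y in Ioi (0:ℝ), deriv (fun v => TF g v y) v) v := (TF_LD hα hg hv).hasDerivAt

lemma Tr_diff {g : ℝ → ℂ} {α : ℝ} (hα : -1 < α) (hg : GF α g) {v : ℂ} (hv : v ∈ Complex.slitPlane) :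
    DifferentiableAt ℂ (Tr g) v := (Tr_hasDerivAt hα hg hv).differentiableAt

lemma Tr_hasDerivAt2 {g : ℝ → ℂ} {α : ℝ} (hα : -1 < α) (hg : GF α g) {v : ℂ} (hv : v ∈ Complex.slitPlane) :
    HasDerivAt (deriv (Tr g)) (∫ y in Ioi (0:ℝ), deriv (fun v => deriv (fun v => TF g v y) v) v) v := by
  refine (TF_LD hα hg hv).deriv.hasDerivAt.congr_of_eventuallyEq ?_
  filter_upwards [Complex.isOpen_slitPlane.eventually_mem hv] with z hz using (Tr_hasDerivAt hα hg hz).deriv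

lemma TF_deriv (g : ℝ → ℂ) (y : ℝ) : (fun v => deriv (fun v => TF g v y) v) = fun v => deriv (fun v => Kc (sq v * y)) v * (g y * y) := by
  funext v
  unfold TF
  exact deriv_mul_const_field _

lemma Tr_T3 {g : ℝ → ℂ} {α : ℝ} (hα : -1 < α) (hg : GF α g) {v : ℂ} (hv : v ∈ Complex.slitPlane) :
    deriv (fun v => v * deriv (Tr g) v) v = 1/4 * Tr (fun y => (y:ℂ)^2 * g y) v := by
  have h := (hasDerivAt_id v).fun_mul (Tr_hasDerivAt2 hα hg hv)
  simp only [id] at h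
  rw [h.deriv, (Tr_hasDerivAt hα hg hv).deriv, one_mul, Tr, ← integral_const_mul, ← integral_const_mul,
    ← integral_add (TF_LD hα hg hv).deriv.integrable ((TF_LD hα hg hv).deriv.deriv.integrable.const_mul v)]
  refine setIntegral_congr_fun measurableSet_Ioi fun y hy => ?_
  have hy : 0 < y := hy
  have h1 := Kv_ode hv hy
  have h2 := TF_deriv g y
  rw [h2, deriv_mul_const_field, congrFun h2 v]
  unfold TF
  linear_combination (g y * y) * h1

lemma Tr_T2 {g g1 : ℝ → ℂ} {α : ℝ} (hα : -1 < α) (hg : GF α g) (hg1 : GF α g1) (hd : ∀ y : ℝ, 0 < y → HasDerivAt g (g1 y / y) y)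
    {v : ℂ} (hv : v ∈ Complex.slitPlane) : deriv (fun v => v * Tr g v) v = -(1/2) * Tr g1 v := by
  have h := (hasDerivAt_id v).fun_mul (Tr_hasDerivAt hα hg hv)
  simp only [id] at h
  have i0 := (TF_LD hα hg hv).integrable
  have i1 := (TF_LD hα hg hv).deriv.integrable
  have j0 := (TF_LD hα hg1 hv).integrable
  have key : ∫ y in Ioi (0:ℝ), (2 * TF g v y + 2 * v * deriv (fun v => TF g v y) v + TF g1 v y) = 0 := by
    obtain ⟨hc, C, b, hC, hab, hgb⟩ := hg
    obtain ⟨D, hD, hK⟩ := Kray_bound (sq_slit hv) (η := 1/2) (by norm_num) (by norm_num)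
    have hK := hK.self_of_nhds
    refine ftc0 (f := fun y : ℝ => Kc (sq v * y) * (g y * (y:ℂ)^2)) (C := D * C) (α := α + 3/2) (b := b + 3/2) (c := (sq v).re) ?_
      (((i0.const_mul 2).add (i1.const_mul (2*v))).add j0) (by linarith) (by linarith) (sq_re_pos hv) ?_
    · intro y hy
      have d1 : HasDerivAt (fun y : ℝ => (y:ℂ)) 1 y := Complex.ofRealCLM.hasDerivAt
      have d2 : HasDerivAt (fun y : ℝ => Kc (sq v * y)) (deriv Kc (sq v * y) * (sq v * 1)) y :=
        HasDerivAt.comp (h₂ := Kc) (h := fun y : ℝ => sq v * (y:ℂ)) y (Kc_diff (smul_slit (sq_slit hv) hy)).hasDerivAt (d1.const_mul (sq v))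
      refine (d2.fun_mul ((hd y hy).fun_mul (d1.fun_pow 2))).congr_deriv ?_
      rw [congrFun (TF_deriv g y) v, (Kv_hasDerivAt hv hy).deriv]
      unfold TF
      have hyc : (y:ℂ) ≠ 0 := by exact_mod_cast hy.ne'
      have hs := sq_ne hv
      have h2 := sq_sq v
      simp only [Nat.cast_ofNat, Nat.add_one_sub_one, pow_one, mul_one]
      clear d2 i0 i1 j0 h hK
      generalize sq v = s at *
      clear hv
      subst h2
      field_simp
      ring
    · intro y hy
      have e1 := hK y hy
      have e4 : ∀ a : ℝ, y^(a+3/2) = y^(-(1/2):ℝ) * (y^a * y^2) := by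
        intro a
        rw [← Real.rpow_natCast y 2, ← Real.rpow_add hy, ← Real.rpow_add hy]; congr 1; push_cast; ring
      rw [norm_mul, norm_mul, norm_pow, Complex.norm_real, Real.norm_of_nonneg hy.le, e4, e4]
      calc _ ≤ (D * y^(-(1/2):ℝ) * Real.exp (-((sq v).re * y))) * ((C * (y^α + y^b)) * y^2) := by
            gcongr
            exact hgb y hy
        _ = _ := by rw [neg_mul]; ring
  rw [h.deriv, one_mul]
  have e := integral_add (f := fun y => 2 * TF g v y + 2 * v * deriv (fun v => TF g v y) v) ((i0.const_mul 2).add (i1.const_mul (2*v))) j0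
  rw [e, integral_add (i0.const_mul 2) (i1.const_mul (2*v)), integral_const_mul, integral_const_mul] at key
  unfold Tr
  linear_combination (1/2) * key

end BW


namespace BW
open MeasureTheory Set Topology

lemma Kreal_bound : ∃ C : ℝ, 0 ≤ C ∧ ∀ z : ℝ, 0 < z → ‖Kc z‖ ≤ C * z^(-(1/2):ℝ) * Real.exp (-z) := by
  obtain ⟨C, hC, hb⟩ := Kc_bound (δ := 1) (η := 1/2) one_pos le_rfl (by norm_num) le_rfl
  refine ⟨C, hC, fun z hz => ?_⟩
  have := hb z (by exact_mod_cast hz.ne') (by simp [hz.le])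
  simpa [abs_of_pos hz] using this

lemma rslit {z : ℝ} (hz : 0 < z) : (z:ℂ) ∈ Complex.slitPlane := Or.inl (by simpa using hz)

lemma Kz_integrable : IntegrableOn (fun z : ℝ => Kc z * z) (Ioi 0) := by
  obtain ⟨C, hC, hb⟩ := Kreal_bound
  refine Integrable.mono' (integrable_pe2 (C := C) (α := 1/2) (b := 1/2) (c := 1) (by norm_num) (by norm_num) one_pos) ?_ ?_
  · refine ContinuousOn.aestronglyMeasurable ?_ measurableSet_Ioi
    have := Kline_cont (s := 1) (by simp)
    simp only [one_mul] at this
    exact this.mul (by fun_prop)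
  · refine ae_restrict_of_forall_mem measurableSet_Ioi fun z hz => ?_
    have hz : 0 < z := hz
    rw [norm_mul, Complex.norm_real, Real.norm_of_nonneg hz.le]
    have e : z^(1/2:ℝ) = z^(-(1/2):ℝ) * z := by
      nth_rewrite 3 [← Real.rpow_one z]
      rw [← Real.rpow_add hz]; norm_num
    have p := Real.rpow_pos_of_pos hz (1/2)
    calc _ ≤ C * z^(-(1/2):ℝ) * Real.exp (-z) * z := by gcongr; exact hb z hz
      _ = C * z^(1/2:ℝ) * Real.exp (-1 * z) := by rw [e, neg_one_mul]; ring
      _ ≤ _ := by gcongr; linarith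

lemma Kd_bound : ∃ C : ℝ, 0 ≤ C ∧ ∀ z : ℝ, 2 ≤ z → ‖deriv Kc z‖ ≤ C * Real.exp (-z) := by
  obtain ⟨C, hC, hb⟩ := Kc_bound (δ := 1) (η := 1/2) one_pos le_rfl (by norm_num) le_rfl
  refine ⟨C * Real.exp 1, by positivity, fun z hz => ?_⟩
  have hre : ∀ w ∈ Metric.closedBall (z:ℂ) 1, z - 1 ≤ w.re := by
    intro w hw
    have h1 : ‖w - z‖ ≤ 1 := by simpa [dist_eq_norm] using hw
    have h2 := (Complex.abs_re_le_norm (w - z)).trans h1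
    rw [Complex.sub_re, Complex.ofReal_re] at h2
    linarith [(abs_le.1 h2).1]
  have := Complex.norm_deriv_le_of_forall_mem_sphere_norm_le (f := Kc) (c := (z:ℂ)) (R := 1) (C := C * Real.exp 1 * Real.exp (-z)) one_pos ?_ ?_
  · simpa using this
  · refine DifferentiableOn.diffContOnCl_ball (U := Complex.slitPlane) (fun w hw => (Kc_diff hw).differentiableWithinAt) ?_
    intro w hw
    left; linarith [hre w hw]
  · intro w hw
    have h1 := hre w (Metric.sphere_subset_closedBall hw)
    have h2 : 1 ≤ ‖w‖ := le_trans (by linarith) ((le_abs_self _).trans (Complex.abs_re_le_norm w))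
    refine (hb w (norm_pos_iff.1 (by linarith)) (by simp; linarith)).trans ?_
    have h3 : ‖w‖^(-(1/2):ℝ) ≤ 1 := Real.rpow_le_one_of_one_le_of_nonpos h2 (by norm_num)
    have h4 : Real.exp (-w.re) ≤ Real.exp 1 * Real.exp (-z) := by
      rw [← Real.exp_add]; apply Real.exp_le_exp.2; linarith
    calc _ ≤ C * 1 * (Real.exp 1 * Real.exp (-z)) := by gcongr
      _ = _ := by ring

lemma Kz_integral : ∫ z in Ioi (0:ℝ), Kc z * z = 1 := by
  set f : ℝ → ℂ := fun z => if z = 0 then -1 else z * deriv Kc z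
  have hf : ∀ z : ℝ, 0 < z → f z = z * deriv Kc z := fun z hz => by simp [f, hz.ne']
  have := integral_Ioi_of_hasDerivAt_of_tendsto (f := f) (f' := fun z : ℝ => Kc z * z) (a := 0) (m := 0) ?_ ?_ Kz_integrable ?_
  · rw [this]; simp [f]
  · obtain ⟨C, hC, hb⟩ := Kc_theta
    have h0 : f 0 = -1 := by simp [f]
    rw [ContinuousWithinAt, h0, tendsto_iff_norm_sub_tendsto_zero]
    have hl : Tendsto (fun z : ℝ => C * (z^(1/2:ℝ) + z^(1:ℝ))) (𝓝[Ici 0] 0) (𝓝 0) := by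
      have : ContinuousAt (fun z : ℝ => C * (z^(1/2:ℝ) + z^(1:ℝ))) 0 := by
        refine continuousAt_const.mul (ContinuousAt.add ?_ ?_) <;>
        exact Real.continuousAt_rpow_const _ _ (Or.inr (by norm_num))
      have := this.tendsto.mono_left (nhdsWithin_le_nhds (s := Ici 0))
      simpa using this
    refine squeeze_zero' (Eventually.of_forall fun z => norm_nonneg _) ?_ hl
    filter_upwards [self_mem_nhdsWithin] with z hz
    rcases (show 0 ≤ z from hz).eq_or_lt with h | h
    · subst h; simp [f]
    · rw [hf z h, sub_neg_eq_add]
      have := hb z (by exact_mod_cast h.ne') (by simpa using h.le)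
      simpa [abs_of_pos h] using this
  · intro z hz
    have hz : 0 < z := hz
    have e : f =ᶠ[𝓝 z] fun z : ℝ => (z:ℂ) * deriv Kc z := by
      filter_upwards [Ioi_mem_nhds hz] with w hw using hf w hw
    refine HasDerivAt.congr_of_eventuallyEq ?_ e
    have d1 : HasDerivAt (fun y : ℝ => (y:ℂ)) 1 z := Complex.ofRealCLM.hasDerivAt
    have d2 := HasDerivAt.comp (h₂ := deriv Kc) (h := fun y : ℝ => (y:ℂ)) z (Kc_hasDerivAt2 (rslit hz)) d1
    refine (d1.fun_mul d2).congr_deriv ?_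
    have hzc : (z:ℂ) ≠ 0 := by exact_mod_cast hz.ne'
    simp only [Function.comp]
    field_simp
    ring
  · obtain ⟨C, hC, hb⟩ := Kd_bound
    rw [tendsto_zero_iff_norm_tendsto_zero]
    have hl := tendsto_pe_atTop (C := C) (α := 1) (b := 1) (c := 1) one_pos
    refine squeeze_zero' (Eventually.of_forall fun z => norm_nonneg _) ?_ hl
    filter_upwards [eventually_ge_atTop 2] with z hz
    have hz0 : 0 < z := by linarith
    rw [hf z hz0, norm_mul, Complex.norm_real, Real.norm_of_nonneg hz0.le]
    have := hb z hz
    rw [neg_one_mul, Real.rpow_one]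
    calc _ ≤ z * (C * Real.exp (-z)) := by gcongr
      _ ≤ C * (z + z) * Real.exp (-z) := by nlinarith [mul_nonneg (mul_nonneg hC hz0.le) (Real.exp_pos (-z)).le]

lemma Tr_scale (g : ℝ → ℂ) {x : ℝ} (hx : 0 < x) :
    ((x^2:ℝ):ℂ) * Tr g ((x^2:ℝ):ℂ) = ∫ z in Ioi (0:ℝ), Kc z * (g (z/x) * z) := by
  have h := integral_comp_mul_left_Ioi' (fun z : ℝ => Kc z * (g (z/x) * z)) 0 hx
  rw [mul_zero] at h
  rw [← h, Tr]
  have e : sq ((x^2:ℝ):ℂ) = x := by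
    rw [Complex.ofReal_pow]; exact sq_of_sq (by simpa using hx)
  rw [Complex.real_smul, Complex.ofReal_pow, pow_two, mul_assoc]
  congr 1
  rw [← integral_const_mul]
  refine setIntegral_congr_fun measurableSet_Ioi fun y hy => ?_
  have : x * y / x = y := by field_simp
  simp only [TF]
  rw [← Complex.ofReal_mul, ← pow_two, e, this]
  push_cast; ring

/-- growth of the transform at infinity -/
lemma Tr_growth {g : ℝ → ℂ} {α : ℝ} (hα : -1 < α) (hg : PB α g) :
    ∃ C : ℝ, 0 ≤ C ∧ ∀ x : ℝ, 1 ≤ x → ‖((x^2:ℝ):ℂ) * Tr g ((x^2:ℝ):ℂ)‖ ≤ C * x^(-α) := by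
  obtain ⟨C, b, hC, hab, hg⟩ := hg
  obtain ⟨D, hD, hK⟩ := Kreal_bound
  have hi : IntegrableOn (fun y : ℝ => (D * C) * (y^(α+1/2) + y^(b+1/2)) * Real.exp (-1*y)) (Ioi 0) :=
    integrable_pe2 (by linarith) (by linarith) one_pos
  refine ⟨∫ y in Ioi (0:ℝ), (D * C) * (y^(α+1/2) + y^(b+1/2)) * Real.exp (-1*y), ?_, fun x hx => ?_⟩
  · refine setIntegral_nonneg measurableSet_Ioi fun y hy => ?_
    have hy : 0 < y := hy
    positivity
  have hx0 : 0 < x := by linarith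
  rw [Tr_scale g hx0, ← integral_mul_const]
  refine norm_integral_le_of_norm_le (hi.mul_const _) ?_
  refine ae_restrict_of_forall_mem measurableSet_Ioi fun z hz => ?_
  have hz : 0 < z := hz
  have h1 := hg (z/x) (by positivity)
  have h2 : (z/x)^α + (z/x)^b ≤ x^(-α) * (z^α + z^b) := by
    rw [div_eq_mul_inv, Real.mul_rpow hz.le (by positivity), Real.mul_rpow hz.le (by positivity), Real.inv_rpow hx0.le, Real.inv_rpow hx0.le,
      ← Real.rpow_neg hx0.le, ← Real.rpow_neg hx0.le]
    have : x^(-b) ≤ x^(-α) := Real.rpow_le_rpow_of_exponent_le hx (by linarith)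
    have p := Real.rpow_pos_of_pos hz b
    nlinarith
  have e4 : ∀ a : ℝ, z^(a+1/2) = z^(-(1/2):ℝ) * (z^a * z) := by
    intro a
    nth_rewrite 4 [← Real.rpow_one z]
    rw [← Real.rpow_add hz, ← Real.rpow_add hz]; congr 1; ring
  rw [norm_mul, norm_mul, Complex.norm_real, Real.norm_of_nonneg hz.le, e4, e4]
  calc _ ≤ (D * z^(-(1/2):ℝ) * Real.exp (-z)) * ((C * (x^(-α) * (z^α + z^b))) * z) := by
        gcongr
        · exact hK z hz
        · exact h1.trans (by gcongr)
    _ = _ := by rw [neg_one_mul]; ring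

lemma Tr_sub {g h : ℝ → ℂ} {α : ℝ} (hα : -1 < α) (hg : GF α g) (hh : GF α h) {v : ℂ} (hv : v ∈ Complex.slitPlane) :
    Tr (fun y => g y - h y) v = Tr g v - Tr h v := by
  unfold Tr
  rw [← integral_sub (TF_LD hα hg hv).integrable (TF_LD hα hh hv).integrable]
  refine integral_congr_ae (Eventually.of_forall fun y => ?_)
  simp only [TF]; ring

lemma Tr_add {g h : ℝ → ℂ} {α : ℝ} (hα : -1 < α) (hg : GF α g) (hh : GF α h) {v : ℂ} (hv : v ∈ Complex.slitPlane) :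
    Tr (fun y => g y + h y) v = Tr g v + Tr h v := by
  unfold Tr
  rw [← integral_add (TF_LD hα hg hv).integrable (TF_LD hα hh hv).integrable]
  refine integral_congr_ae (Eventually.of_forall fun y => ?_)
  simp only [TF]; ring

lemma Tr_const_mul (g : ℝ → ℂ) (c : ℂ) (v : ℂ) : Tr (fun y => c * g y) v = c * Tr g v := by
  unfold Tr
  rw [← integral_const_mul]
  refine integral_congr_ae (Eventually.of_forall fun y => ?_)
  simp only [TF]; ring

lemma Tr_congr {g h : ℝ → ℂ} (e : ∀ y, 0 < y → g y = h y) (v : ℂ) : Tr g v = Tr h v := by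
  unfold Tr
  refine setIntegral_congr_fun measurableSet_Ioi fun y hy => ?_
  simp only [TF]; rw [e y hy]

lemma GF.const (c : ℂ) : GF 0 (fun _ => c) := ⟨continuousOn_const, PB.const c⟩
lemma GF.mono {α β : ℝ} {g : ℝ → ℂ} (h : GF α g) (hb : β ≤ α) : GF β g := ⟨h.1, h.2.mono hb⟩

lemma Tr_limit {g : ℝ → ℂ} {c : ℂ} {α : ℝ} (hα : -1 < α) (hc : ContinuousOn g (Ioi 0)) (hg : PB α (fun y => g y - c)) :
    ∃ C : ℝ, 0 ≤ C ∧ ∀ x : ℝ, 1 ≤ x → ‖((x^2:ℝ):ℂ) * Tr g ((x^2:ℝ):ℂ) - c‖ ≤ C * x^(-α) := by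
  obtain ⟨C, hC, hb⟩ := Tr_growth hα hg
  refine ⟨C, hC, fun x hx => ?_⟩
  have hx0 : 0 < x := by linarith
  have hv : ((x^2:ℝ):ℂ) ∈ Complex.slitPlane := rslit (by positivity)
  set m := min α 0
  have hm : -1 < m := lt_min hα (by norm_num)
  have hcst : GF m (fun _ => c) := (GF.const c).mono (min_le_right _ _)
  have hg' : GF m g := by
    refine ⟨hc, ?_⟩
    have := (hg.mono (min_le_left α 0)).add hcst.2
    simpa using this
  have h1 := Tr_sub hm hg' hcst hv
  have h2 : ((x^2:ℝ):ℂ) * Tr (fun _ => c) ((x^2:ℝ):ℂ) = c := by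
    rw [Tr_scale _ hx0]
    have : (fun z : ℝ => Kc z * (c * z)) = fun z : ℝ => c * (Kc z * z) := by funext z; ring
    simp only [this]
    rw [integral_const_mul, Kz_integral, mul_one]
  have h3 := hb x hx
  rw [h1, mul_sub, h2] at h3
  exact h3

end BW


namespace BW
open MeasureTheory Set Topology

noncomputable def Zf (y : ℝ) : ℂ := (1/2) * Af y + (1/2) * Bf y
noncomputable def Z1f (y : ℝ) : ℂ := (1/2) * A1f y + (1/2) * B1f y

lemma ray_Z : Ray Zf Z1f := ray_A.lin ray_B (1/2) (1/2)
lemma PB_Z {η : ℝ} (hη : 0 < η) (hη1 : η ≤ 1/2) : PB (-η) Zf :=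
  ((PB_A hη hη1).const_mul (1/2)).add ((PB_B hη hη1).const_mul (1/2))
lemma PB_Z1 : PB (1/2) fun y => Z1f y + 1 :=
  ((PB_A1.const_mul (1/2)).add (PB_B1.const_mul (1/2))).congr fun y _ => by unfold Z1f; ring
lemma PB_Z1' : PB 0 Z1f :=
  ((PB_Z1.mono (β := 0) (by norm_num)).sub (PB.const 1)).congr fun y _ => by ring

/-- multiplication step -/
noncomputable def stp (f f1 : ℝ → ℂ) (e : ℕ → ℝ → ℂ) : ℕ → ℝ → ℂ
  | 0 => fun y => f y * e 0 y
  | (m+1) => fun y => f y * e (m+1) y + f1 y * e m y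

structure Fam (η : ℝ) (n j : ℕ) (c : ℂ) (e : ℕ → ℝ → ℂ) : Prop where
  d0 : ∀ y : ℝ, 0 < y → HasDerivAt (e 0) (e 1 y / y) y
  ds : ∀ m, ∀ y : ℝ, 0 < y → HasDerivAt (e (m+1)) ((((m:ℂ)+2) * e (m+2) y - ((n:ℂ) - m) * ((y:ℂ)^2 * e m y)) / y) y
  top : ∀ m, n < m → ∀ y, e m y = 0
  pb : ∀ m, PB (-(η*n)) (e m)
  hi : ∀ m, j < m → PB (1/2 - η*n) (e m)
  mid : PB (1/2 - η*n) (fun y => e j y - c)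

lemma Fam.stepD {η : ℝ} {n j : ℕ} {c : ℂ} {e : ℕ → ℝ → ℂ} (h : Fam η n j c e) {f f1 : ℝ → ℂ} (hf : Ray f f1) :
    (∀ y : ℝ, 0 < y → HasDerivAt (stp f f1 e 0) (stp f f1 e 1 y / y) y) ∧
    (∀ m, ∀ y : ℝ, 0 < y → HasDerivAt (stp f f1 e (m+1)) ((((m:ℂ)+2) * stp f f1 e (m+2) y - (((n+1:ℕ):ℂ) - m) * ((y:ℂ)^2 * stp f f1 e m y)) / y) y) ∧
    (∀ m, n + 1 < m → ∀ y, stp f f1 e m y = 0) := by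
  refine ⟨fun y hy => ?_, fun m y hy => ?_, fun m hm y => ?_⟩
  · have hyc : (y:ℂ) ≠ 0 := by exact_mod_cast hy.ne'
    refine ((hf y hy).1.fun_mul (h.d0 y hy)).congr_deriv ?_
    simp only [stp]; field_simp; ring
  · have hyc : (y:ℂ) ≠ 0 := by exact_mod_cast hy.ne'
    cases m with
    | zero =>
      refine (((hf y hy).1.fun_mul (h.ds 0 y hy)).fun_add ((hf y hy).2.fun_mul (h.d0 y hy))).congr_deriv ?_
      simp only [stp]; push_cast; field_simp; ring
    | succ m =>
      refine (((hf y hy).1.fun_mul (h.ds (m+1) y hy)).fun_add ((hf y hy).2.fun_mul (h.ds m y hy))).congr_deriv ?_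
      simp only [stp]; push_cast; field_simp; ring
  · cases m with
    | zero => omega
    | succ m => simp only [stp]; rw [h.top _ (by omega), h.top _ (by omega)]; simp

lemma Fam.stepJ {η : ℝ} (hη : 0 < η) {n j : ℕ} {c : ℂ} {e : ℕ → ℝ → ℂ} (h : Fam η n j c e) :
    Fam η (n+1) j (c * (Real.pi/2)) (stp Jf J1f e) := by
  obtain ⟨a1, a2, a3⟩ := h.stepD ray_J
  have e1 : -(η*(n+1:ℕ)) ≤ 0 + -(η*n) := by push_cast; linarith
  have e2 : -(η*(n+1:ℕ)) ≤ 1/2 + -(η*n) := by push_cast; linarith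
  have e3 : 1/2 - η*(n+1:ℕ) ≤ 0 + (1/2 - η*n) := by push_cast; linarith
  have e4 : 1/2 - η*(n+1:ℕ) ≤ 1/2 + -(η*n) := by push_cast; linarith
  have hn : (0:ℝ) ≤ η * (n+1:ℕ) := by positivity
  have e5 : 1/2 - η*(n+1:ℕ) ≤ (1/2:ℝ) := by linarith
  refine ⟨a1, a2, a3, fun m => ?_, fun m hm => ?_, ?_⟩
  · cases m with
    | zero => exact (PB_J.mul (h.pb 0)).mono e1
    | succ m => exact ((PB_J.mul (h.pb (m+1))).mono e1).add ((PB_J1.mul (h.pb m)).mono e2)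
  · cases m with
    | zero => omega
    | succ m => exact ((PB_J.mul (h.hi (m+1) hm)).mono e3).add ((PB_J1.mul (h.pb m)).mono e4)
  · have b1 := ((PB_J.mul h.mid).mono e3).add ((PB_J0.const_mul c).mono e5)
    cases j with
    | zero => exact b1.congr fun y _ => by simp only [stp]; ring
    | succ j => exact (b1.add ((PB_J1.mul (h.pb j)).mono e4)).congr fun y _ => by simp only [stp]; ring

lemma Fam.stepZ {η : ℝ} (hη : 0 < η) (hη1 : η ≤ 1/2) {n j : ℕ} {c : ℂ} {e : ℕ → ℝ → ℂ} (h : Fam η n j c e) :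
    Fam η (n+1) (j+1) (-c) (stp Zf Z1f e) := by
  obtain ⟨a1, a2, a3⟩ := h.stepD ray_Z
  have hZ := PB_Z hη hη1
  have e1 : -(η*(n+1:ℕ)) ≤ -η + -(η*n) := by push_cast; linarith
  have e2 : -(η*(n+1:ℕ)) ≤ 0 + -(η*n) := by push_cast; linarith
  have e3 : 1/2 - η*(n+1:ℕ) ≤ -η + (1/2 - η*n) := by push_cast; linarith
  have e4 : 1/2 - η*(n+1:ℕ) ≤ 0 + (1/2 - η*n) := by push_cast; linarith
  have e5 : 1/2 - η*(n+1:ℕ) ≤ 1/2 + -(η*n) := by push_cast; linarith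
  have e6 : 1/2 - η*(n+1:ℕ) ≤ (1/2 - η*n) := by push_cast; linarith
  refine ⟨a1, a2, a3, fun m => ?_, fun m hm => ?_, ?_⟩
  · cases m with
    | zero => exact (hZ.mul (h.pb 0)).mono e1
    | succ m => exact ((hZ.mul (h.pb (m+1))).mono e1).add ((PB_Z1'.mul (h.pb m)).mono e2)
  · cases m with
    | zero => omega
    | succ m => exact ((hZ.mul (h.hi (m+1) (by omega))).mono e3).add ((PB_Z1'.mul (h.hi m (by omega))).mono e4)
  · have b1 := ((hZ.mul (h.hi (j+1) (by omega))).mono e3).add (((PB_Z1.mul (h.pb j)).mono e5).sub (h.mid.mono e6))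
    exact b1.congr fun y _ => by simp only [stp]; ring

noncomputable def fam0 : ℕ → ℝ → ℂ := fun m _ => if m = 0 then 1 else 0
noncomputable def fam (j p : ℕ) : ℕ → ℝ → ℂ := (stp Zf Z1f)^[j] ((stp Jf J1f)^[p] fam0)

lemma fam0_Fam (η : ℝ) : Fam η 0 0 1 fam0 := by
  have z0 : fam0 0 = fun _ => 1 := by funext y; simp [fam0]
  have z1 : ∀ m, 0 < m → fam0 m = fun _ => 0 := fun m hm => by funext y; simp [fam0, hm.ne']
  refine ⟨fun y hy => ?_, fun m y hy => ?_, fun m hm y => ?_, fun m => ?_, fun m hm => ?_, ?_⟩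
  · rw [z0, z1 1 one_pos]; exact (hasDerivAt_const y (1:ℂ)).congr_deriv (by simp)
  · refine (hasDerivAt_const y (0:ℂ)).congr_deriv ?_
    rcases m with _ | m <;> simp [fam0]
  · simp [fam0, hm.ne']
  · rcases m with _ | m
    · rw [z0]; simpa using PB.const 1
    · rw [z1 _ (by omega)]; exact PB.zero _
  · rw [z1 m hm]; exact PB.zero _
  · simpa [fam0] using PB.zero (1/2 - η*0)

lemma fam_Fam {η : ℝ} (hη : 0 < η) (hη1 : η ≤ 1/2) (j p : ℕ) : Fam η (j+p) j ((-1)^j * (Real.pi/2)^p) (fam j p) := by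
  induction j with
  | zero =>
    induction p with
    | zero => simpa [fam] using fam0_Fam η
    | succ p ih =>
      have := ih.stepJ hη
      simp only [fam, Function.iterate_succ_apply', Function.iterate_zero_apply] at this ⊢
      convert this using 1
      · omega
      · rw [pow_succ]; ring
  | succ j ih =>
    have := ih.stepZ hη hη1
    simp only [fam, Function.iterate_succ_apply', Function.iterate_zero_apply] at this ⊢
    convert this using 1
    · omega
    · rw [pow_succ]; ring

lemma fam_zero (j p : ℕ) (y : ℝ) : fam j p 0 y = Zf y ^ j * Jf y ^ p := by
  induction j with
  | zero =>
    induction p with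
    | zero => simp [fam, fam0]
    | succ p ih =>
      simp only [fam, Function.iterate_succ_apply', Function.iterate_zero_apply] at ih ⊢
      simp only [stp]; rw [ih]; ring
  | succ j ih =>
    simp only [fam, Function.iterate_succ_apply', Function.iterate_zero_apply] at ih ⊢
    simp only [stp]; rw [ih]; ring

lemma Fam.cont {η : ℝ} {n j : ℕ} {c : ℂ} {e : ℕ → ℝ → ℂ} (h : Fam η n j c e) (m : ℕ) : ContinuousOn (e m) (Ioi 0) := by
  intro y hy
  cases m with
  | zero => exact (h.d0 y hy).continuousAt.continuousWithinAt
  | succ m => exact (h.ds m y hy).continuousAt.continuousWithinAt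

lemma GF.y2 {α : ℝ} {g : ℝ → ℂ} (h : GF α g) : GF α (fun y => (y:ℂ)^2 * g y) :=
  ⟨ContinuousOn.mul (by fun_prop) h.1, ((PB.ypow 2).mul h.2).mono (by push_cast; linarith)⟩
lemma GF.cm {α : ℝ} {g : ℝ → ℂ} (h : GF α g) (c : ℂ) : GF α (fun y => c * g y) :=
  ⟨ContinuousOn.mul (by fun_prop) h.1, h.2.const_mul c⟩
lemma GF.add {α : ℝ} {f g : ℝ → ℂ} (h : GF α f) (h' : GF α g) : GF α (fun y => f y + g y) := ⟨h.1.add h'.1, h.2.add h'.2⟩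
lemma GF.sub {α : ℝ} {f g : ℝ → ℂ} (h : GF α f) (h' : GF α g) : GF α (fun y => f y - g y) := ⟨h.1.sub h'.1, h.2.sub h'.2⟩

lemma Fam.gf {η : ℝ} {n j : ℕ} {c : ℂ} {e : ℕ → ℝ → ℂ} (h : Fam η n j c e) (hηn : η * n ≤ 1/8) (m : ℕ) : GF (-(1/8)) (e m) :=
  ⟨h.cont m, (h.pb m).mono (by linarith)⟩

lemma Fam.r0 {η : ℝ} {n j : ℕ} {c : ℂ} {e : ℕ → ℝ → ℂ} (h : Fam η n j c e) (hηn : η * n ≤ 1/8) {v : ℂ} (hv : v ∈ Complex.slitPlane) :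
    Tr (e 1) v = -2 * deriv (fun v => v * Tr (e 0) v) v := by
  rw [Tr_T2 (by norm_num) (h.gf hηn 0) (h.gf hηn 1) h.d0 hv]; ring

lemma Fam.gf1 {η : ℝ} {n j : ℕ} {c : ℂ} {e : ℕ → ℝ → ℂ} (h : Fam η n j c e) (hηn : η * n ≤ 1/8) (m : ℕ) :
    GF (-(1/8)) (fun y => ((m:ℂ)+2) * e (m+2) y - ((n:ℂ) - m) * ((y:ℂ)^2 * e m y)) :=
  ((h.gf hηn _).cm _).sub ((h.gf hηn _).y2.cm _)

lemma Fam.rs {η : ℝ} {n j : ℕ} {c : ℂ} {e : ℕ → ℝ → ℂ} (h : Fam η n j c e) (hηn : η * n ≤ 1/8) (m : ℕ) {v : ℂ} (hv : v ∈ Complex.slitPlane) :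
    ((m:ℂ)+2) * Tr (e (m+2)) v = -2 * deriv (fun v => v * (Tr (e (m+1)) v - 2 * ((n:ℂ) - m) * deriv (Tr (e m)) v)) v := by
  have ha : (-1:ℝ) < -(1/8) := by norm_num
  have h1 := Tr_T2 ha (h.gf hηn (m+1)) (h.gf1 hηn m) (h.ds m) hv
  have h2 := Tr_T3 ha (h.gf hηn m) hv
  rw [Tr_sub ha ((h.gf hηn _).cm _) ((h.gf hηn _).y2.cm _) hv, Tr_const_mul, Tr_const_mul] at h1
  have d1 : DifferentiableAt ℂ (fun v => v * Tr (e (m+1)) v) v := differentiableAt_id.mul (Tr_diff ha (h.gf hηn _) hv)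
  have d2 : DifferentiableAt ℂ (fun v => v * deriv (Tr (e m)) v) v :=
    differentiableAt_id.mul (Tr_hasDerivAt2 ha (h.gf hηn _) hv).differentiableAt
  have e3 : (fun v => v * (Tr (e (m+1)) v - 2 * ((n:ℂ) - m) * deriv (Tr (e m)) v)) =
     fun v => v * Tr (e (m+1)) v - (2 * ((n:ℂ) - m)) * (v * deriv (Tr (e m)) v) := by funext v; ring
  rw [e3, deriv_fun_sub d1 (d2.const_mul _), h1, deriv_const_mul _ d2, h2]
  ring

lemma tendsto_of_sq {F : ℝ → ℂ} {l : ℂ} (h : Tendsto (fun x : ℝ => F (x^2)) atTop (𝓝 l)) : Tendsto F atTop (𝓝 l) := by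
  refine (h.comp Real.tendsto_sqrt_atTop).congr' ?_
  filter_upwards [eventually_ge_atTop 0] with x hx
  simp [Real.sq_sqrt hx]

lemma lim0 {g : ℝ → ℂ} {α : ℝ} (hα : 0 < α) (hg : PB α g) : Tendsto (fun v : ℝ => (v:ℂ) * Tr g v) atTop (𝓝 0) := by
  obtain ⟨C, hC, h⟩ := Tr_growth (by linarith) hg
  refine tendsto_of_sq ?_
  rw [tendsto_zero_iff_norm_tendsto_zero]
  have hl : Tendsto (fun x : ℝ => C * x^(-α)) atTop (𝓝 0) := by
    simpa using (tendsto_rpow_neg_atTop hα).const_mul C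
  refine squeeze_zero' (Eventually.of_forall fun z => norm_nonneg _) ?_ hl
  filter_upwards [eventually_ge_atTop 1] with x hx using h x hx

lemma lim1 {g : ℝ → ℂ} {α : ℝ} (hα : -1 < α) (hg : PB α g) : Tendsto (fun v : ℝ => Tr g v) atTop (𝓝 0) := by
  obtain ⟨C, hC, h⟩ := Tr_growth (by linarith) hg
  refine tendsto_of_sq ?_
  rw [tendsto_zero_iff_norm_tendsto_zero]
  have hl : Tendsto (fun x : ℝ => C * x^(-(α+1))) atTop (𝓝 0) := by
    simpa using (tendsto_rpow_neg_atTop (show 0 < α + 1 by linarith)).const_mul C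
  refine squeeze_zero' (Eventually.of_forall fun z => norm_nonneg _) ?_ hl
  filter_upwards [eventually_ge_atTop 1] with x hx
  have h1 := h x hx
  have hx0 : 0 < x := by linarith
  rw [norm_mul, Complex.norm_real, Real.norm_of_nonneg (by positivity)] at h1
  have e : x^(-α) = x^(-(α+1)) * x := by
    nth_rewrite 3 [← Real.rpow_one x]
    rw [← Real.rpow_add hx0]; congr 1; ring
  rw [e] at h1
  have h3 : 0 ≤ ‖Tr g ((x^2:ℝ):ℂ)‖ := norm_nonneg _
  have h4 : x * (x * ‖Tr g ((x^2:ℝ):ℂ)‖) ≤ x * (C * x^(-(α+1))) := by linarith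
  have h5 := le_of_mul_le_mul_left h4 hx0
  nlinarith

lemma lim2 {g g1 : ℝ → ℂ} {α : ℝ} (hα : -1 < α) (hg : GF α g) (hg1 : GF α g1) (hd : ∀ y : ℝ, 0 < y → HasDerivAt g (g1 y / y) y) :
    Tendsto (fun v : ℝ => (v:ℂ) * deriv (Tr g) v) atTop (𝓝 0) := by
  have h := (((lim1 hα hg1.2).const_mul (-(1/2))).sub (lim1 hα hg.2))
  rw [mul_zero, sub_zero] at h
  refine h.congr' ?_
  filter_upwards [eventually_gt_atTop 0] with v hv
  have h1 := Tr_T2 hα hg hg1 hd (rslit hv)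
  have h2 := ((hasDerivAt_id (v:ℂ)).fun_mul (Tr_diff hα hg (rslit hv)).hasDerivAt).deriv
  simp only [id] at h2
  rw [← h1, h2]; ring

lemma const0 {F : ℂ → ℂ} (hF : DifferentiableOn ℂ F {v : ℂ | 0 < v.re}) (hd : ∀ v : ℂ, 0 < v.re → deriv F v = 0)
    (hl : Tendsto (fun v : ℝ => F v) atTop (𝓝 0)) (v : ℂ) (hv : 0 < v.re) : F v = 0 := by
  have hpre : IsPreconnected {v : ℂ | 0 < v.re} := (convex_halfSpace_re_gt 0).isPreconnected
  obtain ⟨a, ha⟩ := isOpen_rhp.exists_is_const_of_deriv_eq_zero hpre hF hd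
  have : Tendsto (fun v : ℝ => F v) atTop (𝓝 a) := by
    refine tendsto_const_nhds.congr' ?_
    filter_upwards [eventually_gt_atTop 0] with v hv
    exact (ha v (by simpa using hv)).symm
  rw [ha v hv]; exact tendsto_nhds_unique this hl

lemma Fam.solFam {η : ℝ} {k j : ℕ} (hk : 1 ≤ k) {c : ℂ} {e : ℕ → ℝ → ℂ} (h : Fam η (2*k+1) j c e) (hj : j < 2*k) (hηn : η * (2*k+1:ℕ) ≤ 1/8) :
    SolFam k (fun m => Tr (e m)) := by
  have hs : ∀ v : ℂ, 0 < v.re → v ∈ Complex.slitPlane := fun v hv => Or.inl hv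
  have ha : (-1:ℝ) < -(1/8) := by norm_num
  have hT : ∀ m, DifferentiableOn ℂ (Tr (e m)) {v : ℂ | 0 < v.re} := fun m v hv => (Tr_diff ha (h.gf hηn m) (hs v hv)).differentiableWithinAt
  have hT' : ∀ m, DifferentiableOn ℂ (deriv (Tr (e m))) {v : ℂ | 0 < v.re} := fun m => (hT m).deriv isOpen_rhp
  have hvd : ∀ m, Tendsto (fun v : ℝ => (v:ℂ) * deriv (Tr (e (m+1))) v) atTop (𝓝 0) := fun m =>
    lim2 ha (h.gf hηn (m+1)) (h.gf1 hηn m) (h.ds m)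
  have hvd' : ∀ m, Tendsto (fun v : ℝ => (v:ℂ) * deriv (Tr (e m)) v) atTop (𝓝 0) := fun m => by
    cases m with
    | zero => exact lim2 ha (h.gf hηn 0) (h.gf hηn 1) h.d0
    | succ m => exact hvd m
  have s1 : ∀ v : ℂ, 0 < v.re → v * (Tr (e (2*k+1)) v - 2 * deriv (Tr (e (2*k))) v) = 0 := by
    refine const0 ?_ ?_ ?_
    · exact differentiableOn_id.mul ((hT _).sub ((hT' _).const_mul 2))
    · intro v hv
      have h1 := h.rs hηn (2*k) (hs v hv)
      have h0 : Tr (e (2*k+2)) v = 0 := by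
        rw [Tr_congr (h := fun _ => (0:ℂ)) (fun y _ => h.top _ (by omega) y)]; simp [Tr, TF]
      have e1 : (2 * (((2*k+1:ℕ):ℂ) - (2*k:ℕ))) = 2 := by push_cast; ring
      rw [h0, e1] at h1
      linear_combination (1/2) * h1
    · have := (lim0 (by linarith) (h.hi (2*k+1) (by omega))).sub ((hvd' (2*k)).const_mul 2)
      rw [mul_zero, sub_zero] at this
      refine this.congr fun v => ?_
      ring
  refine ⟨hT, fun v hv => h.r0 hηn (hs v hv), fun m _ v hv => h.rs hηn m (hs v hv), ?_⟩
  have hfin : ∀ v : ℂ, 0 < v.re → v * (Tr (e (2*k)) v - 4 * deriv (Tr (e (2*k-1))) v) + ((2*k+1:ℕ):ℂ) * Tr (e (2*k)) v = 0 := by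
    have D1 : DifferentiableOn ℂ (fun v => v * (Tr (e (2*k)) v - 4 * deriv (Tr (e (2*k-1))) v)) {v : ℂ | 0 < v.re} :=
      differentiableOn_id.mul ((hT _).sub ((hT' _).const_mul 4))
    refine const0 ?_ ?_ ?_
    · exact D1.add ((hT _).const_mul _)
    · intro v hv
      have hn := isOpen_rhp.mem_nhds hv
      have h1 := h.rs hηn (2*k-1) (hs v hv)
      rw [show 2*k-1+2 = 2*k+1 by omega, show 2*k-1+1 = 2*k by omega] at h1
      have c1 : (((2*k-1:ℕ):ℂ)) = 2*k - 1 := by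
        rw [Nat.cast_sub (by omega)]; push_cast; ring
      have e1 : (2 * (((2*k+1:ℕ):ℂ) - (2*k-1:ℕ))) = 4 := by rw [c1]; push_cast; ring
      rw [e1, c1] at h1
      have h2 := s1 v hv
      have hv0 : v ≠ 0 := by rintro rfl; simp at hv
      have h3 := (mul_eq_zero.1 h2).resolve_left hv0
      rw [deriv_fun_add (D1.differentiableAt hn) (((hT _).differentiableAt hn).const_mul _), deriv_const_mul _ ((hT _).differentiableAt hn)]
      push_cast
      linear_combination (1/2) * h1 - (2*k+1)/2 * h3
    · have h1 := (lim0 (by linarith) (h.hi (2*k) (by omega))).sub ((hvd' (2*k-1)).const_mul 4)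
      have h2 := h1.add ((lim1 ha (h.gf hηn (2*k)).2).const_mul ((2*k+1:ℕ):ℂ))
      rw [mul_zero, sub_zero, mul_zero, add_zero] at h2
      refine h2.congr fun v => ?_
      ring
  intro v hv
  linear_combination hfin v hv

end BW


namespace BW
open MeasureTheory Set Topology

/-- the weight exponent -/
noncomputable def dl (k : ℕ) : ℝ := 1 / (4 * ((2*k+1:ℕ):ℝ))
noncomputable def et (k : ℕ) : ℝ := 1 / (8 * ((2*k+1:ℕ):ℝ)^2)

lemma et_pos (k : ℕ) : 0 < et k := by unfold et; positivity
lemma et_le (k : ℕ) : et k ≤ 1/2 := by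
  unfold et
  rw [div_le_div_iff₀ (by positivity) (by norm_num)]
  have : (1:ℝ) ≤ ((2*k+1:ℕ):ℝ) := by exact_mod_cast (by omega : 1 ≤ 2*k+1)
  nlinarith
lemma et_mul (k : ℕ) : et k * ((2*k+1:ℕ):ℝ) = dl k / 2 := by
  unfold et dl;
  have : (0:ℝ) < ((2*k+1:ℕ):ℝ) := by positivity
  field_simp; norm_num
lemma dl_pos (k : ℕ) : 0 < dl k := by unfold dl; positivity
lemma dl_mul (k : ℕ) : dl k * ((2*k+1:ℕ):ℝ) = 1/4 := by
  unfold dl;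
  have : (0:ℝ) < ((2*k+1:ℕ):ℝ) := by positivity
  field_simp
lemma dl_le (k : ℕ) : dl k ≤ 1/4 := by
  have h := dl_mul k
  have : (1:ℝ) ≤ ((2*k+1:ℕ):ℝ) := by exact_mod_cast (by omega : 1 ≤ 2*k+1)
  nlinarith [dl_pos k]

lemma fam_k {k j : ℕ} (hj : j < 2*k) : Fam (et k) (2*k+1) j ((-1)^j * (Real.pi/2)^(2*k+1-j)) (fam j (2*k+1-j)) := by
  have := fam_Fam (et_pos k) (et_le k) j (2*k+1-j)
  rwa [show j + (2*k+1-j) = 2*k+1 by omega] at this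

lemma entry_lim {k j m : ℕ} (hj : j < 2*k) (hm : m < 2*k) :
    Tendsto (fun x : ℝ => ((x^(dl k * m) : ℝ):ℂ) * ((((x^2:ℝ):ℂ) * Tr (fam j (2*k+1-j) m) ((x^2:ℝ):ℂ)) * ((x^(-(dl k * j)) : ℝ):ℂ))) atTop
      (𝓝 (if m = j then (-1)^j * (Real.pi/2)^(2*k+1-j) else 0)) := by
  have h := fam_k hj
  have hd := dl_pos k
  have hdl := dl_le k
  have he := et_mul k
  have gen : ∀ α : ℝ, -1 < α → 0 < α + dl k * j - dl k * m → PB α (fam j (2*k+1-j) m) →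
    Tendsto (fun x : ℝ => ((x^(dl k * m) : ℝ):ℂ) * ((((x^2:ℝ):ℂ) * Tr (fam j (2*k+1-j) m) ((x^2:ℝ):ℂ)) * ((x^(-(dl k * j)) : ℝ):ℂ))) atTop (𝓝 0) := by
    intro α hα hp hb
    obtain ⟨C, hC, hb⟩ := Tr_growth hα hb
    rw [tendsto_zero_iff_norm_tendsto_zero]
    have hl : Tendsto (fun x : ℝ => C * x^(-(α + dl k * j - dl k * m))) atTop (𝓝 0) := by
      simpa using (tendsto_rpow_neg_atTop hp).const_mul C
    refine squeeze_zero' (Eventually.of_forall fun z => norm_nonneg _) ?_ hl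
    filter_upwards [eventually_ge_atTop 1] with x hx
    have hx0 : 0 < x := by linarith
    have h1 := hb x hx
    rw [norm_mul, norm_mul _ (((x^(-(dl k * j)) : ℝ):ℂ)), Complex.norm_real, Complex.norm_real, Real.norm_of_nonneg (by positivity), Real.norm_of_nonneg (by positivity)]
    calc _ ≤ x^(dl k * m) * (C * x^(-α) * x^(-(dl k * j))) := by gcongr
      _ = C * (x^(dl k * m) * x^(-α) * x^(-(dl k * j))) := by ring
      _ = _ := by
        rw [← Real.rpow_add hx0, ← Real.rpow_add hx0]; congr 2; ring
  rcases lt_trichotomy m j with hmj | hmj | hmj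
  · rw [if_neg hmj.ne]
    refine gen _ ?_ ?_ (h.pb m)
    · rw [he]; linarith
    · rw [he]
      have : (m:ℝ) + 1 ≤ j := by exact_mod_cast hmj
      nlinarith
  · subst hmj
    rw [if_pos rfl]
    obtain ⟨C, hC, hb⟩ := Tr_limit (by rw [he]; linarith) (h.cont m) h.mid
    have h0 : Tendsto (fun x : ℝ => ((x^2:ℝ):ℂ) * Tr (fam m (2*k+1-m) m) ((x^2:ℝ):ℂ)) atTop (𝓝 ((-1)^m * (Real.pi/2)^(2*k+1-m))) := by
      rw [tendsto_iff_norm_sub_tendsto_zero]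
      have hp : 0 < 1/2 - et k * ((2*k+1:ℕ):ℝ) := by rw [he]; linarith
      have hl : Tendsto (fun x : ℝ => C * x^(-(1/2 - et k * ((2*k+1:ℕ):ℝ)))) atTop (𝓝 0) := by
        simpa only [mul_zero] using (tendsto_rpow_neg_atTop hp).const_mul C
      refine squeeze_zero' (Eventually.of_forall fun z => norm_nonneg _) ?_ hl
      filter_upwards [eventually_ge_atTop 1] with x hx using hb x hx
    refine h0.congr' ?_
    filter_upwards [eventually_ge_atTop 1] with x hx
    have hx0 : 0 < x := by linarith
    have : ((x^(dl k * m) : ℝ):ℂ) * ((x^(-(dl k * m)) : ℝ):ℂ) = 1 := by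
      rw [← Complex.ofReal_mul, ← Real.rpow_add hx0]; simp
    linear_combination (-(((x^2:ℝ):ℂ) * Tr (fam m (2*k+1-m) m) ((x^2:ℝ):ℂ))) * this
  · rw [if_neg hmj.ne']
    refine gen _ ?_ ?_ (h.hi m hmj)
    · rw [he]; linarith
    · rw [he]
      have h1 : (m:ℝ) ≤ ((2*k+1:ℕ):ℝ) := by exact_mod_cast (by omega : m ≤ 2*k+1)
      have h2 := dl_mul k
      have h3 : dl k * m ≤ 1/4 := by rw [← h2]; gcongr
      have h4 : 0 ≤ dl k * j := by positivity
      linarith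

lemma det_lim (k : ℕ) : Tendsto (fun v : ℝ => (Matrix.of fun m j : Fin (2*k) => (v:ℂ) * Tr (fam j (2*k+1-j) m) v).det) atTop
    (𝓝 (∏ j : Fin (2*k), ((-1)^(j:ℕ) * (Real.pi/2)^(2*k+1-j) : ℂ))) := by
  refine tendsto_of_sq (F := fun v : ℝ => (Matrix.of fun m j : Fin (2*k) => (v:ℂ) * Tr (fam j (2*k+1-j) m) v).det) ?_
  have hM : Tendsto (fun x : ℝ => (fun m j : Fin (2*k) => ((x^(dl k * m) : ℝ):ℂ) * ((((x^2:ℝ):ℂ) * Tr (fam j (2*k+1-j) m) ((x^2:ℝ):ℂ)) * ((x^(-(dl k * j)) : ℝ):ℂ)) : Matrix (Fin (2*k)) (Fin (2*k)) ℂ)) atTop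
      (𝓝 (Matrix.diagonal fun j : Fin (2*k) => ((-1)^(j:ℕ) * (Real.pi/2)^(2*k+1-j) : ℂ))) := by
    refine tendsto_pi_nhds.2 fun m => tendsto_pi_nhds.2 fun j => ?_
    have := entry_lim (k := k) j.2 m.2
    refine this.trans_eq ?_
    rw [Matrix.diagonal_apply]
    congr 1
    by_cases hmj : m = j
    · subst hmj; simp
    · rw [if_neg hmj, if_neg (fun h => hmj (Fin.ext h))]
  have hdet : Continuous fun M : Matrix (Fin (2*k)) (Fin (2*k)) ℂ => M.det := continuous_id.matrix_det
  have := (hdet.tendsto _).comp hM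
  rw [Matrix.det_diagonal] at this
  refine this.congr' ?_
  filter_upwards [eventually_ge_atTop 1] with x hx
  have hx0 : 0 < x := by linarith
  simp only [Function.comp]
  have e1 := Matrix.det_mul_column (fun m : Fin (2*k) => ((x^(dl k * m) : ℝ):ℂ)) (Matrix.of fun m j : Fin (2*k) => (((x^2:ℝ):ℂ) * Tr (fam j (2*k+1-j) m) ((x^2:ℝ):ℂ)) * ((x^(-(dl k * j)) : ℝ):ℂ))
  have e2 := Matrix.det_mul_row (fun j : Fin (2*k) => ((x^(-(dl k * j)) : ℝ):ℂ)) (Matrix.of fun m j : Fin (2*k) => (((x^2:ℝ):ℂ) * Tr (fam j (2*k+1-j) m) ((x^2:ℝ):ℂ)))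
  have e3 : (Matrix.of fun m j : Fin (2*k) => (((x^2:ℝ):ℂ) * Tr (fam j (2*k+1-j) m) ((x^2:ℝ):ℂ)) * ((x^(-(dl k * j)) : ℝ):ℂ)).det
     = (∏ j : Fin (2*k), ((x^(-(dl k * j)) : ℝ):ℂ)) * (Matrix.of fun m j : Fin (2*k) => (((x^2:ℝ):ℂ) * Tr (fam j (2*k+1-j) m) ((x^2:ℝ):ℂ))).det := by
    rw [← e2]; congr 1; ext m j; simp only [Matrix.of_apply]; ring
  rw [e3, ← mul_assoc, ← Finset.prod_mul_distrib] at e1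
  have e4 : (∏ i : Fin (2*k), ((x^(dl k * (i:ℕ)) : ℝ):ℂ) * ((x^(-(dl k * (i:ℕ))) : ℝ):ℂ)) = 1 := by
    refine Finset.prod_eq_one fun i _ => ?_
    rw [← Complex.ofReal_mul, ← Real.rpow_add hx0]; simp
  rw [e4, one_mul] at e1
  exact e1

noncomputable def Gf (k j : ℕ) : ℂ → ℂ := Tr (fun y => Zf y ^ j * Jf y ^ (2*k+1-j))

lemma Gf_eq (k j : ℕ) : Gf k j = Tr (fam j (2*k+1-j) 0) := by
  unfold Gf; congr 1; funext y; rw [fam_zero]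

lemma Wr_G {k : ℕ} (hk : 1 ≤ k) (v : ℂ) (hv : 0 < v.re) :
    Wr (fun j : Fin (2*k) => Gf k j) v * (Pk k).eval v ^ k = ∏ m ∈ Finset.range (2*k), ((m.factorial:ℂ) * (Real.pi:ℂ)^(2*k+1-m) / 2^(2*k+1)) := by
  have h := Wr_value hk (fun m j => Tr (fam j (2*k+1-j) m)) (fun j => (fam_k j.2).solFam hk j.2 (by rw [et_mul]; linarith [dl_le k])) _ (det_lim k) v hv
  have e : (fun j : Fin (2*k) => Gf k j) = fun j : Fin (2*k) => Tr (fam j (2*k+1-j) 0) := by funext j; exact Gf_eq k j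
  rw [e]
  rw [Fin.prod_univ_eq_prod_range (fun j => ((-1)^(j:ℕ) * (Real.pi/2)^(2*k+1-j) : ℂ)) (2*k)] at h
  have hne : (∏ m ∈ Finset.range (2*k), ((-2:ℂ)^m / m.factorial)) ≠ 0 := by
    refine Finset.prod_ne_zero_iff.2 fun m _ => div_ne_zero (pow_ne_zero _ (by norm_num)) (by exact_mod_cast m.factorial_ne_zero)
  refine mul_left_cancel₀ hne (h.trans ?_)
  rw [← Finset.prod_mul_distrib]
  refine Finset.prod_congr rfl fun m hm => ?_
  have hm := Finset.mem_range.1 hm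
  have hf : (m.factorial:ℂ) ≠ 0 := by exact_mod_cast m.factorial_ne_zero
  have e2 : (2:ℂ)^(2*k+1) = 2^m * 2^(2*k+1-m) := by rw [← pow_add]; congr 1; omega
  have e3 : (-2:ℂ)^m = (-1)^m * 2^m := by rw [← mul_pow]; norm_num
  rw [e2, e3, div_pow]
  field_simp

end BW


namespace BW
open MeasureTheory Set Topology

/-- the integrand as an entire-like function -/
noncomputable def Hf (κ : ℂ) (a b : ℕ) (w : ℂ) : ℂ := Kc (κ * w) * (I0c w ^ a * Kc w ^ b * w)
noncomputable def RF (κ : ℂ) (a b : ℕ) (ζ : ℂ) (t : ℝ) : ℂ := ζ * Hf κ a b (ζ * t)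

def Good (κ : ℂ) (a b : ℕ) (ζ : ℂ) : Prop := ζ ∈ Complex.slitPlane ∧ κ * ζ ∈ Complex.slitPlane ∧
  0 < (κ * ζ).re + b * ζ.re - a * |ζ.re|

lemma Hf_diff {κ : ℂ} (a b : ℕ) {w : ℂ} (h1 : w ∈ Complex.slitPlane) (h2 : κ * w ∈ Complex.slitPlane) : DifferentiableAt ℂ (Hf κ a b) w := by
  have d1 : DifferentiableAt ℂ (fun w => Kc (κ * w)) w :=
    DifferentiableAt.comp (g := Kc) (f := fun w => κ * w) w (Kc_diff h2) (by fun_prop)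
  exact d1.mul ((((I0c_diff w).pow a).mul ((Kc_diff h1).pow b)).mul differentiableAt_id)

lemma Hf_bound {κ : ℂ} {a b : ℕ} {ζ0 : ℂ} (h : Good κ a b ζ0) : ∃ C c : ℝ, 0 ≤ C ∧ 0 < c ∧ ∀ᶠ ζ in 𝓝 ζ0,
    (ζ ∈ Complex.slitPlane ∧ κ * ζ ∈ Complex.slitPlane) ∧ ‖ζ‖ < ‖ζ0‖ + 1 ∧ ∀ t : ℝ, 0 < t → ‖Hf κ a b (ζ * t)‖ ≤ C * t^(1/2:ℝ) * Real.exp (-c * t) := by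
  obtain ⟨h1, h2, h3⟩ := h
  have hη : (0:ℝ) < 1 / (2 * (b+1)) := by positivity
  have hη1 : (1:ℝ) / (2 * (b+1)) ≤ 1/2 := by
    rw [div_le_div_iff₀ (by positivity) (by norm_num)]
    have : (0:ℝ) ≤ b := by positivity
    linarith
  obtain ⟨D1, hD1, k1⟩ := Kray_bound h1 hη hη1
  obtain ⟨D2, hD2, k2⟩ := Kray_bound h2 hη hη1
  have hcm : Continuous fun ζ : ℂ => κ * ζ := by fun_prop
  have k2' := (hcm.tendsto ζ0).eventually k2
  have hrate : Continuous fun ζ : ℂ => (κ * ζ).re + b * ζ.re - a * |ζ.re| := by fun_prop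
  have k3 := (hrate.tendsto ζ0).eventually (eventually_gt_nhds (half_lt_self h3))
  have k4 := (continuous_norm.tendsto ζ0).eventually (eventually_lt_nhds (show ‖ζ0‖ < ‖ζ0‖+1 by linarith))
  have k5 := Complex.isOpen_slitPlane.eventually_mem h1
  have k6 := (hcm.tendsto ζ0).eventually (Complex.isOpen_slitPlane.eventually_mem h2)
  set c := ((κ * ζ0).re + b * ζ0.re - a * |ζ0.re|)/2
  refine ⟨D2 * D1^b * (‖ζ0‖+1), c, by positivity, by positivity, ?_⟩
  filter_upwards [k1, k2', k3, k4, k5, k6] with ζ k1 k2 k3 k4 k5 k6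
  refine ⟨⟨k5, k6⟩, k4, fun t ht => ?_⟩
  have b1 := k1 t ht
  have b2 := k2 t ht
  have b3 := norm_I0c (ζ * t)
  rw [Complex.re_mul_ofReal, abs_mul, abs_of_pos ht] at b3
  set η : ℝ := 1 / (2 * (b+1))
  have e1 : t^(1/2:ℝ) = t^(-η) * ((t^(-η))^b * t) := by
    rw [← Real.rpow_natCast, ← Real.rpow_mul ht.le]
    nth_rewrite 4 [← Real.rpow_one t]
    rw [← Real.rpow_add ht, ← Real.rpow_add ht]; congr 1
    simp only [η]; field_simp; ring
  have e2 : Real.exp (-((κ * ζ).re * t)) * (Real.exp (|ζ.re| * t)^a * Real.exp (-(ζ.re * t))^b) ≤ Real.exp (-c * t) := by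
    rw [← Real.exp_nat_mul, ← Real.exp_nat_mul, ← Real.exp_add, ← Real.exp_add]
    apply Real.exp_le_exp.2
    nlinarith
  unfold Hf
  rw [← mul_assoc κ, norm_mul, norm_mul, norm_mul, norm_mul, norm_pow, norm_pow, Complex.norm_real, Real.norm_of_nonneg ht.le, e1]
  have p1 : 0 ≤ t^(-η) := by positivity
  calc _ ≤ (D2 * t^(-η) * Real.exp (-((κ * ζ).re * t))) * ((Real.exp (|ζ.re| * t))^a * (D1 * t^(-η) * Real.exp (-(ζ.re * t)))^b * ((‖ζ0‖+1) * t)) := by gcongr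
    _ = (D2 * D1^b * (‖ζ0‖+1)) * (t^(-η) * ((t^(-η))^b * t)) * (Real.exp (-((κ * ζ).re * t)) * (Real.exp (|ζ.re| * t)^a * Real.exp (-(ζ.re * t))^b)) := by
      rw [mul_pow, mul_pow]; ring
    _ ≤ _ := by gcongr

lemma Hf_cont {κ : ℂ} (a b : ℕ) {ζ : ℂ} (h1 : ζ ∈ Complex.slitPlane) (h2 : κ * ζ ∈ Complex.slitPlane) :
    ContinuousOn (fun t : ℝ => Hf κ a b (ζ * t)) (Ioi 0) := by
  intro t ht
  have := (Hf_diff (κ := κ) a b (smul_slit h1 ht) (by rw [← mul_assoc]; exact smul_slit h2 ht)).continuousAt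
  have h2 : ContinuousAt (fun y : ℝ => ζ * (y:ℂ)) t := by fun_prop
  exact (ContinuousAt.comp (f := fun y : ℝ => ζ * (y:ℂ)) (g := Hf κ a b) this h2).continuousWithinAt

lemma RF_LD {κ : ℂ} {a b : ℕ} {ζ0 : ℂ} (h : Good κ a b ζ0) : LD (volume.restrict (Ioi 0)) (RF κ a b) ζ0 := by
  obtain ⟨C, c, hC, hc, hb⟩ := Hf_bound h
  obtain ⟨R, hR, hball⟩ := Metric.eventually_nhds_iff_ball.1 hb
  refine ⟨R, hR, fun t => ((‖ζ0‖+1) * C) * (t^(1/2:ℝ) + t^(1/2:ℝ)) * Real.exp (-c * t), integrable_pe2 (by norm_num) (by norm_num) hc, ?_, ?_⟩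
  · intro ζ hζ
    obtain ⟨⟨h1, h2⟩, -, -⟩ := hball ζ hζ
    refine ContinuousOn.aestronglyMeasurable ?_ measurableSet_Ioi
    exact continuousOn_const.mul (Hf_cont a b h1 h2)
  · refine ae_restrict_of_forall_mem measurableSet_Ioi fun t ht => ?_
    have ht : 0 < t := ht
    refine ⟨fun ζ hζ => ?_, fun ζ hζ => ?_⟩
    · obtain ⟨⟨h1, h2⟩, -, -⟩ := hball ζ hζ
      have := Hf_diff (κ := κ) a b (smul_slit h1 ht) (by rw [← mul_assoc]; exact smul_slit h2 ht)
      exact (differentiableAt_id.mul (DifferentiableAt.comp (g := Hf κ a b) (f := fun ζ : ℂ => ζ * (t:ℂ)) ζ this (by fun_prop))).differentiableWithinAt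
    · obtain ⟨-, h1, h2⟩ := hball ζ hζ
      have h2 := h2 t ht
      show ‖RF κ a b ζ t‖ ≤ ((‖ζ0‖+1) * C) * (t^(1/2:ℝ) + t^(1/2:ℝ)) * Real.exp (-c * t)
      unfold RF
      rw [norm_mul]
      have p := Real.rpow_nonneg ht.le (1/2)
      calc _ ≤ (‖ζ0‖+1) * (C * t^(1/2:ℝ) * Real.exp (-c * t)) := by gcongr
        _ = ((‖ζ0‖+1) * C) * (t^(1/2:ℝ)) * Real.exp (-c * t) := by ring
        _ ≤ _ := by gcongr; linarith

lemma RF_deriv0 {κ : ℂ} {a b : ℕ} {ζ0 : ℂ} (h : Good κ a b ζ0) : HasDerivAt (fun ζ => ∫ t in Ioi (0:ℝ), RF κ a b ζ t) 0 ζ0 := by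
  have hl := RF_LD h
  refine hl.hasDerivAt.congr_deriv ?_
  obtain ⟨C, c, hC, hc, hb⟩ := Hf_bound h
  obtain ⟨⟨h1, h2⟩, -, hb⟩ := hb.self_of_nhds
  refine ftc0 (f := fun t : ℝ => t * Hf κ a b (ζ0 * t)) (C := C) (α := 3/2) (b := 3/2) (c := c) ?_ hl.deriv.integrable (by norm_num) (by norm_num) hc ?_
  · intro t ht
    have hd := (Hf_diff (κ := κ) a b (smul_slit h1 ht) (by rw [← mul_assoc]; exact smul_slit h2 ht)).hasDerivAt
    have d1 : HasDerivAt (fun y : ℝ => (y:ℂ)) 1 t := Complex.ofRealCLM.hasDerivAt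
    have d2 := HasDerivAt.comp (h₂ := Hf κ a b) (h := fun y : ℝ => ζ0 * (y:ℂ)) t hd (d1.const_mul ζ0)
    have d3 := HasDerivAt.comp (h₂ := Hf κ a b) (h := fun ζ : ℂ => ζ * (t:ℂ)) ζ0 hd ((hasDerivAt_id ζ0).mul_const (t:ℂ))
    have d4 : HasDerivAt (fun ζ => RF κ a b ζ t) _ ζ0 := (hasDerivAt_id ζ0).fun_mul d3
    rw [d4.deriv]
    refine (d1.fun_mul d2).congr_deriv ?_
    simp only [Function.comp, id]
    ring
  · intro t ht
    have := hb t ht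
    rw [norm_mul, Complex.norm_real, Real.norm_of_nonneg ht.le]
    have e : t^(3/2:ℝ) = t * t^(1/2:ℝ) := by
      nth_rewrite 2 [← Real.rpow_one t]
      rw [← Real.rpow_add ht]; norm_num
    have p := Real.rpow_nonneg ht.le (3/2)
    calc _ ≤ t * (C * t^(1/2:ℝ) * Real.exp (-c * t)) := by gcongr
      _ = C * t^(3/2:ℝ) * Real.exp (-c * t) := by rw [e]; ring
      _ ≤ _ := by gcongr; linarith

lemma rot {κ : ℂ} {a b : ℕ} {e : ℂ} (h : ∀ τ : ℝ, 0 ≤ τ → τ ≤ 1 → Good κ a b ((1 - τ) + τ * e)) :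
    ∫ t in Ioi (0:ℝ), RF κ a b 1 t = ∫ t in Ioi (0:ℝ), RF κ a b e t := by
  have hd : ∀ τ : ℝ, 0 ≤ τ → τ ≤ 1 → HasDerivAt (fun τ : ℝ => ∫ t in Ioi (0:ℝ), RF κ a b ((1 - τ) + τ * e) t) 0 τ := by
    intro τ h0 h1
    have d1 : HasDerivAt (fun y : ℝ => (y:ℂ)) 1 τ := Complex.ofRealCLM.hasDerivAt
    have := HasDerivAt.comp (h₂ := fun ζ => ∫ t in Ioi (0:ℝ), RF κ a b ζ t) (h := fun τ : ℝ => (1 - (τ:ℂ)) + τ * e) τ (RF_deriv0 (h τ h0 h1))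
      ((d1.const_sub 1).fun_add (d1.mul_const e))
    exact this.congr_deriv (by simp)
  have := constant_of_has_deriv_right_zero (f := fun τ : ℝ => ∫ t in Ioi (0:ℝ), RF κ a b ((1 - τ) + τ * e) t) (a := 0) (b := 1)
    (fun τ hτ => (hd τ hτ.1 hτ.2).continuousAt.continuousWithinAt) (fun τ hτ => (hd τ hτ.1 hτ.2.le).hasDerivWithinAt) 1 (by simp)
  simp at this
  exact this.symm

noncomputable def ga (a b : ℕ) (t : ℝ) : ℂ := I0c t ^ a * Kc t ^ b

lemma good_phi {s : ℂ} (h1 : 0 < s.re) (h2 : 0 < s.im) {a b : ℕ} (hab : a < b) (τ : ℝ) (h0 : 0 ≤ τ) (ht : τ ≤ 1) :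
    Good s a b ((1 - τ) + τ * (-Complex.I)) := by
  have hab' : (a:ℝ) + 1 ≤ b := by exact_mod_cast hab
  have hre : ((1 - (τ:ℂ)) + τ * (-Complex.I)).re = 1 - τ := by simp
  have him : ((1 - (τ:ℂ)) + τ * (-Complex.I)).im = - τ := by simp
  have hk : 0 < (s * ((1 - (τ:ℂ)) + τ * (-Complex.I))).re := by
    rw [Complex.mul_re, hre, him]
    rcases h0.eq_or_lt with h | h
    · rw [← h]; simpa using h1
    · nlinarith
  refine ⟨?_, Or.inl hk, ?_⟩
  · rw [Complex.mem_slitPlane_iff, hre, him]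
    rcases h0.eq_or_lt with h | h
    · left; linarith
    · right; linarith
  · rw [hre, abs_of_nonneg (by linarith)]
    nlinarith

lemma good_psi {s : ℂ} (h1 : 0 < s.re) (h1' : s.re < 1) (h2 : 0 < s.im) {a b : ℕ} (hab : a < b) (τ : ℝ) (h0 : 0 ≤ τ) (ht : τ ≤ 1) :
    Good (-s) a b ((1 - τ) + τ * Complex.I) := by
  have hab' : (a:ℝ) + 1 ≤ b := by exact_mod_cast hab
  have hre : ((1 - (τ:ℂ)) + τ * Complex.I).re = 1 - τ := by simp
  have him : ((1 - (τ:ℂ)) + τ * Complex.I).im = τ := by simp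
  refine ⟨?_, ?_, ?_⟩
  · rw [Complex.mem_slitPlane_iff, hre, him]
    rcases h0.eq_or_lt with h | h
    · left; linarith
    · right; linarith
  · rw [Complex.mem_slitPlane_iff]
    right
    rw [Complex.mul_im, hre, him, Complex.neg_re, Complex.neg_im]
    rcases h0.eq_or_lt with h | h
    · rw [← h]; simp; linarith
    · nlinarith
  · rw [Complex.mul_re, hre, him, abs_of_nonneg (by linarith), Complex.neg_re, Complex.neg_im]
    rcases h0.eq_or_lt with h | h
    · rw [← h]; linarith
    · nlinarith

lemma RF_one (κ : ℂ) (a b : ℕ) (t : ℝ) : RF κ a b 1 t = Kc (κ * t) * (ga a b t * t) := by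
  simp [RF, Hf, ga]

lemma sq_neg_u {s : ℂ} (h2 : 0 < s.im) : sq (-s^2) = -Complex.I * s := by
  have : -s^2 = (-Complex.I * s)^2 := by rw [mul_pow]; simp
  rw [this]; exact sq_of_sq (by simpa using h2)

lemma phi_rot {s : ℂ} (h1 : 0 < s.re) (h2 : 0 < s.im) {a b : ℕ} (hab : a < b) :
    ∫ t in Ioi (0:ℝ), Kc (s * t) * (ga a b t * t) = -(2/Real.pi)^a * Tr (fun y => Jf y^a * Af y^b) (-s^2) := by
  have := rot (good_phi h1 h2 hab)
  simp only [RF_one] at this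
  rw [this, Tr, ← integral_const_mul]
  refine setIntegral_congr_fun measurableSet_Ioi fun y hy => ?_
  simp only [RF, Hf, TF]
  rw [sq_neg_u h2]
  have hp : (Real.pi:ℂ) ≠ 0 := by exact_mod_cast Real.pi_ne_zero
  have e1 : I0c (-Complex.I * y) = (2/Real.pi) * Jf y := by
    unfold Jf; rw [neg_mul, I0c_neg]; field_simp
  have e2 : Kc (-Complex.I * y) = Af y := rfl
  have e3 : Complex.I^2 = -1 := Complex.I_sq
  rw [e1, e2, mul_pow, show s * (-Complex.I * (y:ℂ)) = -Complex.I * s * y by ring]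
  linear_combination (Kc (-Complex.I * s * y) * ((2/Real.pi)^a * Jf y^a * Af y^b * y)) * e3

lemma psi_rot {s : ℂ} (h1 : 0 < s.re) (h1' : s.re < 1) (h2 : 0 < s.im) {a b : ℕ} (hab : a < b) :
    ∫ t in Ioi (0:ℝ), Kc (-s * t) * (ga a b t * t) = -(2/Real.pi)^a * Tr (fun y => Jf y^a * Bf y^b) (-s^2) := by
  have := rot (good_psi h1 h1' h2 hab)
  simp only [RF_one] at this
  rw [this, Tr, ← integral_const_mul]
  refine setIntegral_congr_fun measurableSet_Ioi fun y hy => ?_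
  simp only [RF, Hf, TF]
  rw [sq_neg_u h2]
  have hp : (Real.pi:ℂ) ≠ 0 := by exact_mod_cast Real.pi_ne_zero
  have e1 : I0c (Complex.I * y) = (2/Real.pi) * Jf y := by
    unfold Jf; field_simp
  have e2 : Kc (Complex.I * y) = Bf y := rfl
  have e3 : Complex.I^2 = -1 := Complex.I_sq
  rw [e1, e2, mul_pow, show -s * (Complex.I * (y:ℂ)) = -Complex.I * s * y by ring]
  linear_combination (Kc (-Complex.I * s * y) * ((2/Real.pi)^a * Jf y^a * Bf y^b * y)) * e3

noncomputable def Am (a b : ℕ) (u : ℂ) : ℂ := ∫ t in Ioi (0:ℝ), I0c (sq u * t) * (ga a b t * t)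

lemma Am_rot {s : ℂ} (h1 : 0 < s.re) (h1' : s.re < 1) (h2 : 0 < s.im) {a b : ℕ} (hab : a < b) :
    Complex.I * Real.pi * Am a b (s^2) = (2/Real.pi)^a * (Tr (fun y => Jf y^a * Af y^b) (-s^2) - Tr (fun y => Jf y^a * Bf y^b) (-s^2)) := by
  have g1 := good_phi h1 h2 hab 0 le_rfl zero_le_one
  have g2 := good_psi h1 h1' h2 hab 0 le_rfl zero_le_one
  simp only [Complex.ofReal_zero, sub_zero, zero_mul, add_zero] at g1 g2
  have i1 := (RF_LD g1).integrable
  have i2 := (RF_LD g2).integrable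
  have e : Complex.I * Real.pi * Am a b (s^2) = ∫ t in Ioi (0:ℝ), (RF (-s) a b 1 t - RF s a b 1 t) := by
    rw [Am, ← integral_const_mul, sq_of_sq h1]
    refine setIntegral_congr_fun measurableSet_Ioi fun t ht => ?_
    have ht : 0 < t := ht
    have hc := connection (z := s * t) (by rw [Complex.im_mul_ofReal]; positivity)
    simp only [RF_one]
    rw [neg_mul]
    linear_combination (-(ga a b t * t)) * hc
  rw [e, integral_sub i2 i1]
  simp only [RF_one]
  rw [phi_rot h1 h2 hab, psi_rot h1 h1' h2 hab]
  ring

lemma Phi_rot {s : ℂ} (h1 : 0 < s.re) (h2 : 0 < s.im) {a b : ℕ} (hab : a < b) :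
    Tr (ga a b) (s^2) = -(2/Real.pi)^a * Tr (fun y => Jf y^a * Af y^b) (-s^2) := by
  rw [← phi_rot h1 h2 hab, Tr]
  simp only [TF]
  rw [sq_of_sq h1]

end BW


namespace BW
open MeasureTheory Set Topology

lemma ga_cont (a b : ℕ) : ContinuousOn (ga a b) (Ioi 0) := by
  have h1 := Kline_cont (s := 1) (by simp)
  simp only [one_mul] at h1
  have h2 : Continuous (fun y : ℝ => I0c (y:ℂ)) :=
    (continuous_iff_continuousAt.2 fun z => (I0c_diff z).continuousAt).comp Complex.continuous_ofReal
  unfold ga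
  exact (h2.continuousOn.pow a).mul (h1.pow b)

lemma ga_bound {a b : ℕ} (hab : a < b) : ∃ C : ℝ, 0 ≤ C ∧ ∀ t : ℝ, 0 < t → ‖ga a b t‖ ≤ C * t^(-(1/4):ℝ) * Real.exp (-t) := by
  have hb0 : (1:ℝ) ≤ b := by exact_mod_cast (by omega : 1 ≤ b)
  obtain ⟨C, hC, hb⟩ := Kc_bound (δ := 1) (η := 1/(4*b)) one_pos le_rfl (by positivity) (by
    rw [div_le_div_iff₀ (by positivity) (by norm_num)]; linarith)
  refine ⟨C^b, by positivity, fun t ht => ?_⟩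
  have h1 := hb t (by exact_mod_cast ht.ne') (by simp [ht.le])
  rw [Complex.norm_real, Real.norm_of_nonneg ht.le, Complex.ofReal_re] at h1
  have h2 := norm_I0c (t:ℂ)
  rw [Complex.ofReal_re, abs_of_pos ht] at h2
  unfold ga
  rw [norm_mul, norm_pow, norm_pow]
  have e1 : (t^(-(1/(4*b)):ℝ))^b = t^(-(1/4):ℝ) := by
    rw [← Real.rpow_natCast, ← Real.rpow_mul ht.le]; congr 1; field_simp
  have e2 : Real.exp t ^ a * Real.exp (-t)^b ≤ Real.exp (-t) := by
    rw [← Real.exp_nat_mul, ← Real.exp_nat_mul, ← Real.exp_add]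
    apply Real.exp_le_exp.2
    have : (a:ℝ) + 1 ≤ b := by exact_mod_cast hab
    nlinarith
  calc _ ≤ Real.exp t ^ a * (C * t^(-(1/(4*b)):ℝ) * Real.exp (-t))^b := by gcongr
    _ = C^b * t^(-(1/4):ℝ) * (Real.exp t ^ a * Real.exp (-t)^b) := by rw [mul_pow, mul_pow, e1]; ring
    _ ≤ _ := by gcongr

lemma ga_GF {a b : ℕ} (hab : a < b) : GF (-(1/4)) (ga a b) := by
  obtain ⟨C, hC, h⟩ := ga_bound hab
  refine ⟨ga_cont a b, PB.of_le C fun y hy => (h y hy).trans ?_⟩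
  have : Real.exp (-y) ≤ 1 := Real.exp_le_one_iff.2 (by linarith)
  have p : 0 ≤ C * y^(-(1/4):ℝ) := by positivity
  nlinarith

/-- domain of holomorphy -/
def Us : Set ℂ := {u | u ∈ Complex.slitPlane ∧ (sq u).re < 1}

lemma Us_open : IsOpen Us := by
  rw [isOpen_iff_mem_nhds]
  rintro u ⟨h1, h2⟩
  have h3 := (sq_hasDerivAt h1).continuousAt
  have h4 : ∀ᶠ v in 𝓝 u, (sq v).re < 1 :=
    (Filter.Tendsto.eventually_lt ((Complex.continuous_re.tendsto _).comp h3) tendsto_const_nhds h2)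
  exact (Complex.isOpen_slitPlane.eventually_mem h1).and h4

lemma sq_mem_slit {s : ℂ} (hs : 0 < s.re) : s^2 ∈ Complex.slitPlane := by
  rw [Complex.mem_slitPlane_iff]
  by_cases hi : s.im = 0
  · left; simp [pow_two, hi]; positivity
  · right
    simp [pow_two]
    intro h2
    have : s.re * s.im = 0 := by linarith
    rcases mul_eq_zero.1 this with h3 | h3
    · linarith
    · exact hi h3

lemma Us_pre : IsPreconnected Us := by
  have e : Us = (fun s : ℂ => s^2) '' {s : ℂ | s.re ∈ Ioo (0:ℝ) 1} := by
    ext u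
    constructor
    · rintro ⟨h1, h2⟩
      exact ⟨sq u, ⟨sq_re_pos h1, h2⟩, sq_sq u⟩
    · rintro ⟨s, ⟨h1, h2⟩, rfl⟩
      refine ⟨sq_mem_slit h1, ?_⟩
      show (sq (s^2)).re < 1
      rwa [sq_of_sq h1]
  rw [e]
  refine IsPreconnected.image ?_ _ (by fun_prop)
  have : Convex ℝ {s : ℂ | s.re ∈ Ioo (0:ℝ) 1} := (convex_Ioo (0:ℝ) 1).linear_preimage Complex.reLm
  exact this.isPreconnected

lemma Am_LD {a b : ℕ} (hab : a < b) {u : ℂ} (hu : u ∈ Us) :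
    LD (volume.restrict (Ioi 0)) (fun u t => I0c (sq u * t) * (ga a b t * t)) u := by
  obtain ⟨C, hC, hg⟩ := ga_bound hab
  have hsc := (sq_hasDerivAt hu.1).continuousAt
  have hre : Tendsto (fun v => (sq v).re) (𝓝 u) (𝓝 (sq u).re) := (Complex.continuous_re.tendsto _).comp hsc
  obtain ⟨ρ, h1, h2⟩ := exists_between hu.2
  obtain ⟨R, hR, hball⟩ := Metric.eventually_nhds_iff_ball.1 ((hre.eventually_lt_const h1).and (Us_open.eventually_mem hu))
  have hc : Continuous I0c := continuous_iff_continuousAt.2 fun z => (I0c_diff z).continuousAt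
  refine ⟨R, hR, fun t => C * (t^(3/4:ℝ) + t^(3/4:ℝ)) * Real.exp (-(1-ρ)*t), integrable_pe2 (by norm_num) (by norm_num) (by linarith), ?_, ?_⟩
  · intro v hv
    refine ContinuousOn.aestronglyMeasurable ?_ measurableSet_Ioi
    exact (hc.comp (by fun_prop : Continuous fun t : ℝ => sq v * t)).continuousOn.mul ((ga_cont a b).mul (by fun_prop))
  · refine ae_restrict_of_forall_mem measurableSet_Ioi fun t ht => ?_
    have ht : 0 < t := ht
    refine ⟨fun v hv => ?_, fun v hv => ?_⟩
    · have h3 := (hball v hv).2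
      have := HasDerivAt.comp (h₂ := I0c) (h := fun v => sq v * t) v (I0c_diff _).hasDerivAt ((sq_hasDerivAt h3.1).mul_const (t:ℂ))
      exact (this.differentiableAt.mul_const _).differentiableWithinAt
    · have h3 := hball v hv
      have h4 := norm_I0c (sq v * t)
      rw [Complex.re_mul_ofReal, abs_of_pos (mul_pos (sq_re_pos h3.2.1) ht)] at h4
      have h5 : Real.exp ((sq v).re * t) ≤ Real.exp (ρ * t) := Real.exp_le_exp.2 (by nlinarith [h3.1])
      show ‖I0c (sq v * t) * (ga a b t * t)‖ ≤ C * (t^(3/4:ℝ) + t^(3/4:ℝ)) * Real.exp (-(1-ρ)*t)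
      rw [norm_mul, norm_mul, Complex.norm_real, Real.norm_of_nonneg ht.le]
      have e : t^(3/4:ℝ) = t^(-(1/4):ℝ) * t := by
        nth_rewrite 3 [← Real.rpow_one t]
        rw [← Real.rpow_add ht]; norm_num
      have e2 : Real.exp (-(1-ρ)*t) = Real.exp (ρ*t) * Real.exp (-t) := by rw [← Real.exp_add]; congr 1; ring
      have p := Real.rpow_pos_of_pos ht (3/4)
      calc _ ≤ Real.exp (ρ*t) * ((C * t^(-(1/4):ℝ) * Real.exp (-t)) * t) := by
            gcongr
            · exact h4.trans h5
            · exact hg t ht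
        _ = C * t^(3/4:ℝ) * Real.exp (-(1-ρ)*t) := by rw [e, e2]; ring
        _ ≤ _ := by gcongr; linarith

lemma Am_diff {a b : ℕ} (hab : a < b) {u : ℂ} (hu : u ∈ Us) : DifferentiableAt ℂ (Am a b) u :=
  (Am_LD hab hu).hasDerivAt.differentiableAt

/-- complexified columns -/
noncomputable def fcol (k c : ℕ) (u : ℂ) : ℂ :=
  if c = 0 then ((Real.pi^(-(k:ℝ) - 1/2) : ℝ):ℂ) * ((Am 0 (2*k+1) u + (2*k+1) * Tr (ga 1 (2*k)) u) / (2*(k+1)))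
  else if c ≤ k then ((Real.pi^((c:ℝ) - k - 1/2) : ℝ):ℂ) * Am c (2*k+1-c) u
  else ((Real.pi^((c:ℝ) - 2*k - 1/2) : ℝ):ℂ) * Tr (ga (c+1-k) (3*k-c)) u

lemma fcol_diff {k c : ℕ} (hk : 1 ≤ k) (hc : c < 2*k) : DifferentiableOn ℂ (fcol k c) Us := by
  intro u hu
  refine DifferentiableAt.differentiableWithinAt ?_
  rcases Nat.eq_zero_or_pos c with h | h
  · have e : fcol k c = fun u => ((Real.pi^(-(k:ℝ) - 1/2) : ℝ):ℂ) * ((Am 0 (2*k+1) u + (2*k+1) * Tr (ga 1 (2*k)) u) / (2*(k+1))) := by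
      funext u; simp [fcol, h]
    rw [e]
    exact (((Am_diff (by omega) hu).add ((Tr_diff (by norm_num) (ga_GF (by omega)) hu.1).const_mul _)).div_const _).const_mul _
  · by_cases h2 : c ≤ k
    · have e : fcol k c = fun u => ((Real.pi^((c:ℝ) - k - 1/2) : ℝ):ℂ) * Am c (2*k+1-c) u := by
        funext u; simp [fcol, h.ne', h2]
      rw [e]
      exact (Am_diff (by omega) hu).const_mul _
    · have e : fcol k c = fun u => ((Real.pi^((c:ℝ) - 2*k - 1/2) : ℝ):ℂ) * Tr (ga (c+1-k) (3*k-c)) u := by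
        funext u; simp [fcol, h.ne', h2]
      rw [e]
      exact (Tr_diff (by norm_num) (ga_GF (by omega)) hu.1).const_mul _

lemma sq_real {u : ℝ} (hu : 0 < u) : sq (u:ℂ) = (Real.sqrt u : ℂ) := by
  have := sq_of_sq (s := (Real.sqrt u : ℂ)) (by simpa using hu)
  rwa [← Complex.ofReal_pow, Real.sq_sqrt hu.le] at this

lemma Am_real (a b : ℕ) {u : ℝ} (hu : 0 < u) : Am a b u = (IvKM (a+1) b 1 u : ℂ) := by
  rw [Am, IvKM, sq_real hu, ← integral_complex_ofReal]
  refine setIntegral_congr_fun measurableSet_Ioi fun t ht => ?_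
  simp only [ga]
  rw [← Complex.ofReal_mul, I0c_real, I0c_real, Kc_real ht]
  push_cast
  simp only [Nat.add_sub_cancel, pow_one]
  ring

lemma Tr_real (a b : ℕ) {u : ℝ} (hu : 0 < u) : Tr (ga a b) u = (IKvM a (b+1) 1 u : ℂ) := by
  rw [Tr, IKvM, ← integral_complex_ofReal]
  refine setIntegral_congr_fun measurableSet_Ioi fun t ht => ?_
  simp only [ga, TF]
  rw [sq_real hu, ← Complex.ofReal_mul, I0c_real, Kc_real ht, Kc_real (mul_pos (Real.sqrt_pos.2 hu) ht)]
  push_cast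
  simp only [Nat.add_sub_cancel, pow_one]
  ring

lemma fcol_real {k c : ℕ} (hk : 1 ≤ k) (hc : c < 2*k) {u : ℝ} (hu : 0 < u) : fcol k c u = (nuS k 1 (c+1) u : ℂ) := by
  rcases Nat.eq_zero_or_pos c with h | h
  · subst h
    simp only [fcol, nuS, if_true, zero_add]
    rw [Am_real _ _ hu, Tr_real _ _ hu]
    push_cast
    rfl
  · by_cases h2 : c ≤ k
    · simp only [fcol, nuS]
      rw [if_neg h.ne', if_pos h2, if_neg (by omega), if_pos (by omega), Am_real _ _ hu]
      rw [show 2*k+2-(c+1) = 2*k+1-c by omega, show ((c+1:ℕ):ℝ) - k - 3/2 = (c:ℝ) - k - 1/2 by push_cast; ring]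
      push_cast; rfl
    · simp only [fcol, nuS]
      rw [if_neg h.ne', if_neg h2, if_neg (by omega), if_neg (by omega), Tr_real _ _ hu]
      rw [show 3*k+2-(c+1) = 3*k-c+1 by omega, show ((c+1:ℕ):ℝ) - 2*k - 3/2 = (c:ℝ) - 2*k - 1/2 by push_cast; ring]
      push_cast; rfl

end BW


namespace BW
open MeasureTheory Set Topology

noncomputable def Hp (n : ℕ) (p : ℂ[X]) (z w : ℂ) : ℂ := ∑ j ∈ Finset.range (n+1), p.coeff j * (z^j * w^(n-j))

lemma Hp_C_mul (n : ℕ) (r : ℂ) (p : ℂ[X]) (z w : ℂ) : Hp n (C r * p) z w = r * Hp n p z w := by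
  simp only [Hp, coeff_C_mul, Finset.mul_sum, mul_assoc]

lemma Hp_sub (n : ℕ) (p q : ℂ[X]) (z w : ℂ) : Hp n (p - q) z w = Hp n p z w - Hp n q z w := by
  simp only [Hp, coeff_sub, sub_mul, Finset.sum_sub_distrib]

lemma Hp_pow {n b : ℕ} (hb : b ≤ n) (r z w : ℂ) : Hp n ((X + C r)^b) z w = w^(n-b) * (z + r * w)^b := by
  have h1 : Hp n ((X + C r)^b) z w = ∑ j ∈ Finset.range (b+1), ((X + C r)^b).coeff j * (z^j * w^(n-j)) := by
    refine (Finset.sum_subset (Finset.range_subset_range.2 (by omega)) fun j _ hj => ?_).symm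
    rw [coeff_X_add_C_pow, Nat.choose_eq_zero_of_lt (by simpa using hj)]
    simp
  rw [h1, add_pow z, Finset.mul_sum]
  refine Finset.sum_congr rfl fun j hj => ?_
  have hj : j ≤ b := by simpa [Nat.lt_succ_iff] using hj
  rw [coeff_X_add_C_pow, mul_pow, show n - j = (n-b) + (b-j) by omega, pow_add]
  ring

lemma ZJ_A {y : ℝ} (hy : 0 < y) : Zf y + Complex.I * Jf y = Af y := by
  have := AB_J y hy
  unfold Zf; linear_combination (-1/2) * this

lemma ZJ_B {y : ℝ} (hy : 0 < y) : Zf y + (-Complex.I) * Jf y = Bf y := by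
  have := AB_J y hy
  unfold Zf; linear_combination (1/2) * this

lemma Hp_al {n b : ℕ} (hb : b ≤ n) {y : ℝ} (hy : 0 < y) : Hp n (al^b) (Zf y) (Jf y) = Jf y^(n-b) * Af y^b := by
  rw [al, Hp_pow hb, ZJ_A hy]

lemma Hp_be {n b : ℕ} (hb : b ≤ n) {y : ℝ} (hy : 0 < y) : Hp n (be^b) (Zf y) (Jf y) = Jf y^(n-b) * Bf y^b := by
  rw [be, show (X - C Complex.I : ℂ[X]) = X + C (-Complex.I) by simp [sub_eq_add_neg], Hp_pow hb, ZJ_B hy]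

lemma GF_JX {F : ℝ → ℂ} (hc : ContinuousOn F (Ioi 0)) (hF : ∀ {η : ℝ}, 0 < η → η ≤ 1/2 → PB (-η) F) (a b : ℕ) :
    GF (-(1/4)) (fun y => Jf y^a * F y^b) := by
  have hJ : ContinuousOn Jf (Ioi 0) := fun y hy => (ray_J y hy).1.continuousAt.continuousWithinAt
  refine ⟨(hJ.pow a).mul (hc.pow b), ?_⟩
  have h1 := (PB_J.pow a).mul ((hF (η := 1/(4*(b+1))) (by positivity) (by
    rw [div_le_div_iff₀ (by positivity) (by norm_num)]; nlinarith [Nat.cast_nonneg (α := ℝ) b])).pow b)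
  refine h1.mono ?_
  have : (b:ℝ) * (1/(4*(b+1))) ≤ 1/4 := by
    rw [mul_one_div, div_le_div_iff₀ (by positivity) (by norm_num)]; linarith
  linarith

lemma GF_JA (a b : ℕ) : GF (-(1/4)) (fun y => Jf y^a * Af y^b) :=
  GF_JX (fun y hy => (ray_A y hy).1.continuousAt.continuousWithinAt) (fun h h' => PB_A h h') a b

lemma GF_JB (a b : ℕ) : GF (-(1/4)) (fun y => Jf y^a * Bf y^b) :=
  GF_JX (fun y hy => (ray_B y hy).1.continuousAt.continuousWithinAt) (fun h h' => PB_B h h') a b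

lemma GF_ZJ {k j : ℕ} (hj : j < 2*k) : GF (-(1/8)) (fun y => Zf y^j * Jf y^(2*k+1-j)) := by
  have h := (fam_k hj).gf (by rw [et_mul]; linarith [dl_le k]) 0
  have e : fam j (2*k+1-j) 0 = (fun y => Zf y^j * Jf y^(2*k+1-j)) := funext fun y => fam_zero _ _ _
  rwa [e] at h

lemma Tr_sum (s : Finset ℕ) (c : ℕ → ℂ) (g : ℕ → ℝ → ℂ) {α : ℝ} (hα : -1 < α) (hg : ∀ j ∈ s, GF α (g j)) {v : ℂ} (hv : v ∈ Complex.slitPlane) :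
    Tr (fun y => ∑ j ∈ s, c j * g j y) v = ∑ j ∈ s, c j * Tr (g j) v := by
  have : ∀ j ∈ s, Integrable (fun y => c j * TF (g j) v y) (volume.restrict (Ioi 0)) := fun j hj => (TF_LD hα (hg j hj) hv).integrable.const_mul _
  simp only [Tr, ← integral_const_mul]
  rw [← integral_finset_sum _ this]
  refine setIntegral_congr_fun measurableSet_Ioi fun y hy => ?_
  simp only [TF, Finset.sum_mul, Finset.mul_sum]
  exact Finset.sum_congr rfl fun j _ => by ring

lemma Tr_Hp {k : ℕ} {p : ℂ[X]} (hp : ∀ j, 2*k ≤ j → p.coeff j = 0) {v : ℂ} (hv : v ∈ Complex.slitPlane) :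
    Tr (fun y => Hp (2*k+1) p (Zf y) (Jf y)) v = ∑ j ∈ Finset.range (2*k), p.coeff j * Gf k j v := by
  have e : ∀ y : ℝ, 0 < y → Hp (2*k+1) p (Zf y) (Jf y) = ∑ j ∈ Finset.range (2*k), p.coeff j * (Zf y^j * Jf y^(2*k+1-j)) := by
    intro y _
    refine (Finset.sum_subset (Finset.range_subset_range.2 (by omega)) fun j _ hj => ?_).symm
    rw [hp j (by simpa using hj), zero_mul]
  rw [Tr_congr e, Tr_sum _ _ (fun j y => Zf y^j * Jf y^(2*k+1-j)) (α := -(1/8)) (by norm_num) (fun j hj => GF_ZJ (by simpa using hj)) hv]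
  rfl

/-- normalization constant -/
noncomputable def vpi (k : ℕ) : ℝ := Real.pi^(-(k:ℝ) - 3/2)

lemma vpi_mul (k m : ℕ) (x : ℝ) (h : x = -(k:ℝ) - 3/2 + m) : Real.pi^x = vpi k * Real.pi^m := by
  rw [h, Real.rpow_add Real.pi_pos, Real.rpow_natCast, vpi]

lemma fcol_eq {k c : ℕ} (hk : 1 ≤ k) (hc : c < 2*k) {s : ℂ} (h1 : 0 < s.re) (h1' : s.re < 1) (h2 : 0 < s.im) :
    fcol k c (s^2) = vpi k * ∑ j ∈ Finset.range (2*k), (pcol k c).coeff j * Gf k j (-s^2) := by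
  have hv : -s^2 ∈ Complex.slitPlane := by
    right
    simp [pow_two]
    nlinarith [mul_pos h1 h2]
  rw [← Tr_Hp (fun j hj => pcol_coeff_zero k c hk hc j hj) hv]
  have hp : (Real.pi:ℂ) ≠ 0 := by exact_mod_cast Real.pi_ne_zero
  have hI := Complex.I_ne_zero
  have hk1 : (k:ℂ) + 1 ≠ 0 := by exact_mod_cast Nat.succ_ne_zero k
  rcases Nat.eq_zero_or_pos c with h | h
  · subst h
    have e : ∀ y : ℝ, 0 < y → Hp (2*k+1) (pcol k 0) (Zf y) (Jf y) = (1/(2*((k:ℂ)+1)*Complex.I)) * ((Jf y^0 * Af y^(2*k+1) - Jf y^0 * Bf y^(2*k+1)) - (2*Complex.I*(2*k+1)) * (Jf y^1 * Af y^(2*k))) := by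
      intro y hy
      rw [pcol, if_pos rfl, Hp_C_mul, Hp_sub, Hp_sub, Hp_C_mul, Hp_al le_rfl hy, Hp_be le_rfl hy, Hp_al (by omega) hy]
      rw [Nat.sub_self, show 2*k+1-2*k = 1 by omega]
    have q1 := Am_rot h1 h1' h2 (a := 0) (b := 2*k+1) (by omega)
    have q2 := Phi_rot h1 h2 (a := 1) (b := 2*k) (by omega)
    rw [Tr_congr e, Tr_const_mul, Tr_sub (α := -(1/4)) (by norm_num) ((GF_JA _ _).sub (GF_JB _ _)) ((GF_JA _ _).cm _) hv,
      Tr_sub (α := -(1/4)) (by norm_num) (GF_JA _ _) (GF_JB _ _) hv, Tr_const_mul, fcol, if_pos rfl, q2, vpi_mul k 1 _ (by push_cast; ring)]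
    have q3 : Am 0 (2*k+1) (s^2) = (Tr (fun y => Jf y^0 * Af y^(2*k+1)) (-s^2) - Tr (fun y => Jf y^0 * Bf y^(2*k+1)) (-s^2)) / (Complex.I * Real.pi) := by
      rw [pow_zero, one_mul] at q1
      rw [← q1]; field_simp
    rw [q3]
    push_cast
    field_simp
    ring
  · by_cases hck : c ≤ k
    · have e : ∀ y : ℝ, 0 < y → Hp (2*k+1) (pcol k c) (Zf y) (Jf y) = (2^c / Complex.I) * (Jf y^c * Af y^(2*k+1-c) - Jf y^c * Bf y^(2*k+1-c)) := by
        intro y hy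
        rw [pcol, if_neg h.ne', if_pos hck, Hp_C_mul, Hp_sub, Hp_al (by omega) hy, Hp_be (by omega) hy]
        rw [show 2*k+1-(2*k+1-c) = c by omega]
      have q1 := Am_rot h1 h1' h2 (a := c) (b := 2*k+1-c) (by omega)
      rw [Tr_congr e, Tr_const_mul,
        Tr_sub (α := -(1/4)) (by norm_num) (GF_JA _ _) (GF_JB _ _) hv, fcol, if_neg h.ne', if_pos hck, vpi_mul k (c+1) _ (by push_cast; ring)]
      have q3 : Am c (2*k+1-c) (s^2) = (2/Real.pi)^c * (Tr (fun y => Jf y^c * Af y^(2*k+1-c)) (-s^2) - Tr (fun y => Jf y^c * Bf y^(2*k+1-c)) (-s^2)) / (Complex.I * Real.pi) := by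
        rw [← q1]; field_simp
      rw [q3]
      push_cast
      rw [div_pow, pow_succ]
      field_simp
    · have e : ∀ y : ℝ, 0 < y → Hp (2*k+1) (pcol k c) (Zf y) (Jf y) = (-2^(c+1-k)) * (Jf y^(c+1-k) * Af y^(3*k-c)) := by
        intro y hy
        rw [pcol, if_neg h.ne', if_neg hck, Hp_C_mul, Hp_al (by omega) hy]
        rw [show 2*k+1-(3*k-c) = c+1-k by omega]
      have q2 := Phi_rot h1 h2 (a := c+1-k) (b := 3*k-c) (by omega)
      rw [Tr_congr e, Tr_const_mul, fcol, if_neg h.ne', if_neg hck, vpi_mul k (c+1-k) _ (by rw [Nat.cast_sub (by omega)]; push_cast; ring), q2]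
      push_cast
      rw [div_pow]
      field_simp

end BW


namespace BW
open MeasureTheory Set Topology

/-- region where the rotated formula holds -/
def Rg : Set ℂ := {u | u ∈ Us ∧ 0 < (sq u).im ∧ u.re < 0}

lemma Rg_open : IsOpen Rg := by
  rw [isOpen_iff_mem_nhds]
  rintro u ⟨h1, h2, h3⟩
  have h4 := (sq_hasDerivAt h1.1).continuousAt
  have h5 : ∀ᶠ v in 𝓝 u, 0 < (sq v).im :=
    (Filter.Tendsto.eventually_lt tendsto_const_nhds ((Complex.continuous_im.tendsto _).comp h4) h2)
  have h6 : ∀ᶠ v in 𝓝 u, v.re < 0 :=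
    (Filter.Tendsto.eventually_lt (Complex.continuous_re.tendsto _) tendsto_const_nhds h3)
  exact (Us_open.eventually_mem h1).and (h5.and h6)

lemma Gf_diff {k j : ℕ} (hj : j < 2*k) : DifferentiableOn ℂ (Gf k j) Complex.slitPlane :=
  fun _ hv => (Tr_diff (by norm_num) (GF_ZJ hj) hv).differentiableWithinAt

lemma iter_fcol {k c : ℕ} (hk : 1 ≤ k) (hc : c < 2*k) (i : ℕ) : ∀ u ∈ Rg,
    iteratedDeriv i (fcol k c) u = ∑ j ∈ Finset.range (2*k), (vpi k * (-1)^i * iteratedDeriv i (Gf k j) (-u)) * (pcol k c).coeff j := by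
  induction i with
  | zero =>
    intro u hu
    have := fcol_eq hk hc (s := sq u) (sq_re_pos hu.1.1) hu.1.2 hu.2.1
    rw [sq_sq] at this
    simp only [iteratedDeriv_zero]
    rw [this, Finset.mul_sum]
    exact Finset.sum_congr rfl fun j _ => by ring
  | succ i ih =>
    intro u hu
    have e : iteratedDeriv i (fcol k c) =ᶠ[𝓝 u] fun u => ∑ j ∈ Finset.range (2*k), (vpi k * (-1)^i * iteratedDeriv i (Gf k j) (-u)) * (pcol k c).coeff j := by
      filter_upwards [Rg_open.eventually_mem hu] with v hv using ih v hv
    rw [iteratedDeriv_succ, e.deriv_eq]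
    refine HasDerivAt.deriv ?_
    refine HasDerivAt.fun_sum fun j hj => ?_
    have hv : -u ∈ Complex.slitPlane := Or.inl (by simpa using hu.2.2)
    have d := hasDerivAt_iteratedDeriv Complex.isOpen_slitPlane (Gf_diff (by simpa using hj)) i (-u) hv
    have d2 := HasDerivAt.comp (h₂ := iteratedDeriv i (Gf k j)) (h := fun u : ℂ => -u) u d (hasDerivAt_neg u)
    refine ((d2.const_mul (vpi k * (-1)^i : ℂ)).mul_const ((pcol k c).coeff j)).congr_deriv ?_
    ring

noncomputable def Qf (k : ℕ) (u : ℂ) : ℂ := u^k * ∏ j ∈ Finset.Icc 1 (k+1), ((2*(j:ℂ)-1)^2 - u)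

lemma neg_one_kk (k : ℕ) : ((-1:ℂ)^k)^k = (-1)^k := by
  rcases Nat.even_or_odd k with h | h
  · rw [h.neg_one_pow, one_pow]
  · rw [h.neg_one_pow, h.neg_one_pow]

lemma Pk_neg (k : ℕ) (u : ℂ) : (Pk k).eval (-u) = (-1)^k * Qf k u := by
  unfold Pk Qf
  rw [eval_mul, eval_pow, eval_X, eval_prod, neg_pow, mul_assoc, Finset.range_eq_Ico,
    Finset.prod_Ico_add' (fun j : ℕ => (2*(j:ℂ)-1)^2 - u) 0 (k+1) 1 |>.symm.trans rfl |> fun h => (show ∏ j ∈ Finset.Icc 1 (k+1), ((2*(j:ℂ)-1)^2 - u) = _ from h)]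
  congr 2
  refine Finset.prod_congr rfl fun j _ => ?_
  simp only [eval_add, eval_X, eval_C]
  push_cast; ring

lemma prod_neg_one (k : ℕ) : ∏ i ∈ Finset.range (2*k), (-1:ℂ)^i = (-1)^k := by
  induction k with
  | zero => simp
  | succ k ih =>
    rw [show 2*(k+1) = 2*k+1+1 by ring, Finset.prod_range_succ, Finset.prod_range_succ, ih, pow_succ (-1:ℂ) (2*k), pow_mul]
    simp [pow_succ]

lemma sum_exps (N : ℕ) : 2 * ∑ m ∈ Finset.range N, (N + 1 - m) = N * (N+3) := by
  have h : ∑ m ∈ Finset.range N, (N + 1 - m) = ∑ m ∈ Finset.range N, (m+2) := by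
    rw [← Finset.sum_range_reflect]
    refine Finset.sum_congr rfl fun m hm => ?_
    have : m < N := by simpa using hm
    omega
  rw [h]
  clear h
  induction N with
  | zero => simp
  | succ N ih => rw [Finset.sum_range_succ, mul_add, ih]; ring

lemma vpi_prod (k : ℕ) : vpi k^(2*k) * ∏ m ∈ Finset.range (2*k), Real.pi^(2*k+1-m) = 1 := by
  have h := sum_exps (2*k)
  have h2 : ∑ m ∈ Finset.range (2*k), (2*k+1-m) = k*(2*k+3) := by nlinarith
  rw [Finset.prod_pow_eq_pow_sum, h2, vpi, ← Real.rpow_natCast, ← Real.rpow_natCast, ← Real.rpow_mul Real.pi_pos.le, ← Real.rpow_add Real.pi_pos]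
  rw [← Real.rpow_zero Real.pi]
  congr 1
  push_cast; ring

lemma Wr_region {k : ℕ} (hk : 1 ≤ k) {u : ℂ} (hu : u ∈ Rg) :
    Wr (fun c : Fin (2*k) => fcol k c) u * Qf k u ^ k = (lam k : ℂ) := by
  have e : Wr (fun c : Fin (2*k) => fcol k c) u = (vpi k : ℂ)^(2*k) * (-1)^k * Wr (fun j : Fin (2*k) => Gf k j) (-u) *
      (Matrix.of fun j c : Fin (2*k) => (pcol k c).coeff j).det := by
    have e1 : (Matrix.of fun i c : Fin (2*k) => iteratedDeriv (i:ℕ) (fcol k c) u) =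
        (Matrix.of fun i j : Fin (2*k) => ((vpi k : ℂ) * (-1)^(i:ℕ)) * (Matrix.of fun i j : Fin (2*k) => iteratedDeriv (i:ℕ) (Gf k j) (-u)) i j) * (Matrix.of fun j c : Fin (2*k) => (pcol k c).coeff j) := by
      ext i c
      rw [Matrix.mul_apply]
      simp only [Matrix.of_apply]
      rw [iter_fcol hk c.2 i u hu, Finset.sum_range]
    rw [Wr, e1, Matrix.det_mul, Matrix.det_mul_column, Finset.prod_mul_distrib, Finset.prod_const, Finset.card_univ, Fintype.card_fin,
      ← Finset.prod_range (fun i => (-1:ℂ)^i), prod_neg_one]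
    rfl
  have hW := Wr_G hk (-u) (by simpa using hu.2.2)
  have hP := pcol_det k hk
  have hv : (vpi k:ℂ)^(2*k) * ∏ m ∈ Finset.range (2*k), (Real.pi:ℂ)^(2*k+1-m) = 1 := by exact_mod_cast vpi_prod k
  rw [Pk_neg, mul_pow, neg_one_kk] at hW
  have h3 : ∏ m ∈ Finset.range (2*k), ((m.factorial:ℂ) * (Real.pi:ℂ)^(2*k+1-m) / 2^(2*k+1)) =
     (∏ m ∈ Finset.range (2*k), ((m.factorial:ℂ) / 2^(2*k+1))) * ∏ m ∈ Finset.range (2*k), (Real.pi:ℂ)^(2*k+1-m) := by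
    rw [← Finset.prod_mul_distrib]
    exact Finset.prod_congr rfl fun m _ => by ring
  rw [h3] at hW
  rw [e, ← hP]
  linear_combination ((vpi k : ℂ)^(2*k) * (Matrix.of fun j c : Fin (2*k) => (pcol k c).coeff j).det) * hW +
    ((Matrix.of fun j c : Fin (2*k) => (pcol k c).coeff j).det * ∏ m ∈ Finset.range (2*k), ((m.factorial:ℂ) / 2^(2*k+1))) * hv

lemma Wr_Us {k : ℕ} (hk : 1 ≤ k) {u : ℂ} (hu : u ∈ Us) :
    Wr (fun c : Fin (2*k) => fcol k c) u * Qf k u ^ k = (lam k : ℂ) := by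
  have hd : DifferentiableOn ℂ (fun u => Wr (fun c : Fin (2*k) => fcol k c) u * Qf k u ^ k) Us := by
    intro v hv
    refine DifferentiableAt.differentiableWithinAt ?_
    refine DifferentiableAt.mul ?_ ?_
    · have e : Wr (fun c : Fin (2*k) => fcol k c) = fun v => ∑ σ : Equiv.Perm (Fin (2*k)), ((Equiv.Perm.sign σ : ℤ) : ℂ) * ∏ i, iteratedDeriv ((σ i : Fin (2*k)) : ℕ) (fcol k i) v := by
        funext v
        rw [Wr, Matrix.det_apply']
        rfl
      rw [e]
      refine DifferentiableAt.fun_sum fun σ _ => DifferentiableAt.const_mul ?_ _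
      refine DifferentiableAt.fun_finset_prod fun i _ => ?_
      exact (hasDerivAt_iteratedDeriv Us_open (fcol_diff hk i.2) _ v hv).differentiableAt
    · unfold Qf
      fun_prop
  have han := hd.analyticOnNhd Us_open
  have hs : sq ((1/2 + Complex.I)^2) = 1/2 + Complex.I := sq_of_sq (by norm_num)
  have h0 : (1/2 + Complex.I)^2 ∈ Rg := by
    refine ⟨⟨sq_mem_slit (by norm_num), ?_⟩, ?_, ?_⟩
    · rw [hs]; norm_num
    · rw [hs]; norm_num
    · norm_num [pow_two]
  refine han.eqOn_of_preconnected_of_eventuallyEq (g := fun _ => (lam k : ℂ)) analyticOnNhd_const Us_pre h0.1 ?_ hu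
  filter_upwards [Rg_open.eventually_mem h0] with v hv using Wr_region hk hv

lemma real_mem_Us {u : ℝ} (hu : u ∈ Ioo (0:ℝ) 1) : (u:ℂ) ∈ Us := by
  refine ⟨rslit hu.1, ?_⟩
  rw [sq_real hu.1, Complex.ofReal_re, Real.sqrt_lt' one_pos]
  simpa using hu.2

lemma iter_real {f : ℂ → ℂ} {g : ℝ → ℝ} (hf : DifferentiableOn ℂ f Us) (h : ∀ u ∈ Ioo (0:ℝ) 1, f u = g u) (i : ℕ) :
    ∀ u ∈ Ioo (0:ℝ) 1, iteratedDeriv i f u = ((iteratedDeriv i g u : ℝ) : ℂ) := by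
  induction i with
  | zero => simpa using h
  | succ i ih =>
    intro u hu
    have d := hasDerivAt_iteratedDeriv Us_open hf i u (real_mem_Us hu)
    have d1 := d.real_of_complex
    have e : (fun x : ℝ => (iteratedDeriv i f x).re) =ᶠ[𝓝 u] iteratedDeriv i g := by
      filter_upwards [isOpen_Ioo.eventually_mem hu] with x hx
      rw [ih x hx, Complex.ofReal_re]
    have d2 := d1.congr_of_eventuallyEq e.symm
    have d3 := d2.ofReal_comp
    have e2 : (fun x : ℝ => ((iteratedDeriv i g x : ℝ) : ℂ)) =ᶠ[𝓝 u] fun x : ℝ => iteratedDeriv i f x := by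
      filter_upwards [isOpen_Ioo.eventually_mem hu] with x hx using (ih x hx).symm
    have d4 := d.comp_ofReal.congr_of_eventuallyEq e2
    rw [iteratedDeriv_succ (f := g), d2.deriv]
    exact d4.unique d3

lemma final {k : ℕ} (hk : 1 ≤ k) {u : ℝ} (hu : u ∈ Ioo (0:ℝ) 1) :
    Matrix.det (Matrix.of fun i j : Fin (2 * k) => iteratedDeriv (i : ℕ) (nuS k 1 ((j : ℕ) + 1)) u) =
      lam k / (u ^ k * ∏ j ∈ Finset.Icc 1 (k + 1), ((2 * (j : ℝ) - 1) ^ 2 - u)) ^ k := by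
  have h := Wr_Us hk (real_mem_Us hu)
  have hQ : 0 < u ^ k * ∏ j ∈ Finset.Icc 1 (k + 1), ((2 * (j : ℝ) - 1) ^ 2 - u) := by
    refine mul_pos (pow_pos hu.1 _) (Finset.prod_pos fun j hj => ?_)
    have : (1:ℝ) ≤ j := by exact_mod_cast (Finset.mem_Icc.1 hj).1
    nlinarith [hu.2]
  rw [eq_div_iff (by positivity)]
  have e1 : Wr (fun c : Fin (2*k) => fcol k c) u = ((Matrix.det (Matrix.of fun i j : Fin (2 * k) => iteratedDeriv (i : ℕ) (nuS k 1 ((j : ℕ) + 1)) u) : ℝ) : ℂ) := by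
    refine Eq.trans ?_ (RingHom.map_det Complex.ofRealHom _).symm
    rw [Wr]
    congr 1
    ext i j
    simp only [Matrix.of_apply, RingHom.mapMatrix_apply, Matrix.map_apply, Complex.ofRealHom_eq_coe]
    exact iter_real (fcol_diff hk j.2) (fun x hx => fcol_real hk j.2 hx.1) i u hu
  rw [e1, Qf] at h
  exact_mod_cast h

end BW

theorem wronskian_det_even (k : ℕ) (hk : 1 ≤ k) (u : ℝ) (hu : u ∈ Set.Ioo (0 : ℝ) 1) :
    Matrix.det
      (Matrix.of fun i j : Fin (2 * k) =>
        iteratedDeriv (i : ℕ) (nuS k 1 ((j : ℕ) + 1)) u) =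
    ((2 * (k : ℝ) + 1) / (2 * (k + 1)) *
        ((-1 : ℝ) ^ (k * (k - 1) / 2) / (2 : ℝ) ^ ((2 * k - 1) * k)) *
        ((2 * k + 1).factorial : ℝ) ^ (2 * k) / ∏ n ∈ Finset.Icc 1 (2 * k + 1), (n : ℝ) ^ n) /
      (u ^ k * ∏ j ∈ Finset.Icc 1 (k + 1), ((2 * (j : ℝ) - 1) ^ 2 - u)) ^ k := by
  exact BW.final hk hu
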